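/- arXiv:math/0001022 — 3 statements merged into one kernel-verified Lean document; each statement's English description precedes it below -/
import Mathlib

section
/- Fix real numbers t and β with 0 < t < 1, β > 0 and 0 < βt < 1. There exist constants M₀, C, c > 0 such that for all positive integers N and l, if x := (l - η(t)N)/(ρ(t)N^{1/3}) satisfies x ≤ -M₀, then 0 ≤ φ(N, l, t, β) ≤ C e^{-c |x|³}. -/
open scoped Classical

noncomputable section

/-- Semistandard Young tableaux of shape `μ` with entries in `{1, …, N}`. -/
def SSYTN (N : ℕ) (μ : YoungDiagram) : Type :=
  {T : SemistandardYoungTableau μ // ∀ i j : ℕ, (i, j) ∈ μ → T i j ∈ Finset.Icc 1 N}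

/-- `d_λ(N)`: the number of semistandard Young tableaux of shape `μ`
with entries in `{1, …, N}`. -/
def dCount (N : ℕ) (μ : YoungDiagram) : ℕ := Nat.card (SSYTN N μ)

/-- `f(λ')`: the number of odd columns of `μ`. -/
def oddCols (μ : YoungDiagram) : ℕ :=
  ((Finset.range μ.card).filter fun j => Odd (μ.colLen j)).card

/-- `ℓ(λ)`: the number of rows of `μ` (the length of its first column). -/
def numRows (μ : YoungDiagram) : ℕ := μ.colLen 0

/-- The generating function
`φ(N, l, t, β) = (1-t²)^{N(N-1)/2} (1-βt)^N Σ_{ℓ(λ) ≤ l} t^{|λ|} β^{f(λ')} d_λ(N)`. -/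
def phiGF (N l : ℕ) (t β : ℝ) : ℝ :=
  (1 - t ^ 2) ^ (N * (N - 1) / 2) * (1 - β * t) ^ N *
    ∑' μ : {μ : YoungDiagram // numRows μ ≤ l},
      t ^ (μ.1.card) * β ^ (oddCols μ.1) * (dCount N μ.1 : ℝ)

/-- `η(t) = 2t/(1+t)`. -/
def etaT (t : ℝ) : ℝ := 2 * t / (1 + t)

/-- `ρ(t) = (t(1-t))^{1/3}/(1+t)`. -/
def rhoT (t : ℝ) : ℝ := (t * (1 - t)) ^ ((1 : ℝ) / 3) / (1 + t)

/-- The coefficient of `z ^ n` in `(1 - t z)^{-N}`. -/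
def hCoef (t : ℝ) (N : ℕ) (n : ℤ) : ℝ :=
  if 0 ≤ n then (Nat.multichoose N n.toNat : ℝ) * t ^ n.toNat else 0

lemma hCoef_neg (t : ℝ) (N : ℕ) {n : ℤ} (hn : n < 0) : hCoef t N n = 0 := by
  simp [hCoef, not_le.mpr hn]

lemma hCoef_natCast (t : ℝ) (N n : ℕ) : hCoef t N (n : ℤ) = Nat.multichoose N n * t ^ n := by
  simp [hCoef]

lemma hCoef_zero_right (t : ℝ) (N : ℕ) : hCoef t N 0 = 1 := by
  simp [hCoef]

lemma hCoef_zero_left (t : ℝ) (n : ℤ) : hCoef t 0 n = if n = 0 then 1 else 0 := by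
  rcases lt_or_ge n 0 with h | h
  · rw [hCoef_neg t 0 h, if_neg (by omega)]
  · obtain ⟨k, rfl⟩ := Int.eq_ofNat_of_zero_le h
    rw [hCoef_natCast]
    cases k <;> simp
    omega

lemma hCoef_nonneg {t : ℝ} (ht : 0 ≤ t) (N : ℕ) (n : ℤ) : 0 ≤ hCoef t N n := by
  unfold hCoef
  split_ifs <;> positivity

lemma hCoef_succ (t : ℝ) (N : ℕ) (n : ℤ) :
    hCoef t (N + 1) n = hCoef t N n + t * hCoef t (N + 1) (n - 1) := by
  rcases lt_or_ge n 0 with h | h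
  · simp [hCoef_neg t _ h, hCoef_neg t _ (show n - 1 < 0 by omega)]
  · obtain ⟨k, rfl⟩ := Int.eq_ofNat_of_zero_le h
    cases k with
    | zero => simp [hCoef_zero_right, hCoef_neg t _ (show (-1 : ℤ) < 0 by omega)]
    | succ k =>
      rw [show ((k + 1 : ℕ) : ℤ) - 1 = (k : ℤ) by push_cast; ring, hCoef_natCast, hCoef_natCast,
        hCoef_natCast, Nat.multichoose_succ_succ]
      push_cast
      ring

lemma sum_Ioc_hCoef (t : ℝ) (N : ℕ) {a b : ℕ} (hab : a ≤ b) (j : ℤ) :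
    ∑ g ∈ Finset.Ioc a b, t ^ (b - g) * hCoef t N (g - j) =
      hCoef t (N + 1) (b - j) - t ^ (b - a) * hCoef t (N + 1) (a - j) := by
  induction b, hab using Nat.le_induction with
  | base => simp
  | succ b hb ih =>
    rw [← Finset.insert_Ioc_right_eq_Ioc_add_one hb, Finset.sum_insert (by simp)]
    have h : ∀ g ∈ Finset.Ioc a b, t ^ (b + 1 - g) * hCoef t N (g - j) =
        t * (t ^ (b - g) * hCoef t N (g - j)) := by
      intro g hg
      rw [Finset.mem_Ioc] at hg
      rw [Nat.sub_add_comm hg.2, pow_succ]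
      ring
    rw [Finset.sum_congr rfl h, ← Finset.mul_sum, ih, hCoef_succ t N ((b + 1 : ℕ) - j),
      Nat.sub_add_comm hb, pow_succ, show ((b + 1 : ℕ) : ℤ) - j - 1 = b - j by push_cast; ring]
    simp
    ring

lemma sum_range_hCoef (t : ℝ) (N : ℕ) (b : ℕ) (j : ℕ) :
    ∑ g ∈ Finset.range (b + 1), t ^ (b - g) * hCoef t N (g - j) = hCoef t (N + 1) (b - j) := by
  have h0 : hCoef t (N + 1) (0 - j) = hCoef t N (0 - j) := by
    rw [hCoef_succ, hCoef_neg t _ (show (0 - j - 1 : ℤ) < 0 by omega)]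
    simp
  have := sum_Ioc_hCoef t N (Nat.zero_le b) j
  have h2 : Finset.range (b + 1) = insert 0 (Finset.Ioc 0 b) := by
    ext x; simp
  rw [h2, Finset.sum_insert (by simp), this]
  simp only [Nat.cast_zero, h0]
  simp

/-- A determinant whose rows are finite sums expands over the choices of one summand per row. -/
lemma det_sum_rows {ι κ : Type*} [Fintype ι] [DecidableEq ι] (S : ι → Finset κ) (w : ι → κ → ℝ)
    (f : ι → κ → ι → ℝ) :
    Matrix.det (Matrix.of fun i j => ∑ g ∈ S i, w i g * f i g j) =
      ∑ γ ∈ Fintype.piFinset S, (∏ i, w i (γ i)) * Matrix.det (Matrix.of fun i j => f i (γ i) j) := by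
  have h := (Matrix.detRowAlternating (n := ι) (R := ℝ)).toMultilinearMap.map_sum_finset
    (fun i g j => w i g * f i g j) S
  have e : (Matrix.of fun i j => ∑ g ∈ S i, w i g * f i g j) =
      fun i => ∑ g ∈ S i, fun j => w i g * f i g j := by
    ext i j
    simp
  rw [e]
  refine h.trans (Finset.sum_congr rfl fun γ _ => ?_)
  exact Matrix.det_mul_column (fun i => w i (γ i)) (Matrix.of fun i j => f i (γ i) j)

/-- The Jacobi–Trudi determinant attached to a set of particle positions. -/
def jtDet (t : ℝ) (N : ℕ) {L : ℕ} (α : Fin L → ℕ) : ℝ :=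
  Matrix.det (Matrix.of fun i j : Fin L => hCoef t N ((α i : ℤ) - (j : ℕ)))

/-- The particle configurations interlacing `α` from below. -/
def branchSet {L : ℕ} (α : Fin L → ℕ) : Finset (Fin L → ℕ) :=
  Fintype.piFinset fun i => if h : (i : ℕ) = 0 then Finset.range (α i + 1)
    else Finset.Ioc (α ⟨i - 1, by omega⟩) (α i)

lemma mem_branchSet {L : ℕ} {α γ : Fin L → ℕ} :
    γ ∈ branchSet α ↔ (∀ i, γ i ≤ α i) ∧ ∀ i j : Fin L, (j : ℕ) + 1 = i → α j < γ i := by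
  simp only [branchSet, Fintype.mem_piFinset]
  constructor
  · intro h
    refine ⟨fun i => ?_, fun i j hij => ?_⟩
    · have := h i
      split_ifs at this <;> simp at this <;> omega
    · have := h i
      rw [dif_neg (by omega), Finset.mem_Ioc] at this
      have e : (⟨(i : ℕ) - 1, by omega⟩ : Fin L) = j := by ext; simp; omega
      rw [e] at this
      exact this.1
  · rintro ⟨h1, h2⟩ i
    split_ifs with h
    · simpa [Nat.lt_succ_iff] using h1 i
    · exact Finset.mem_Ioc.2 ⟨h2 i _ (by simp; omega), h1 i⟩

lemma strictMono_of_mem_branchSet {L : ℕ} {α γ : Fin L → ℕ} (h : γ ∈ branchSet α) :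
    StrictMono γ := by
  rw [mem_branchSet] at h
  cases L with
  | zero => exact fun i => i.elim0
  | succ n =>
    refine Fin.strictMono_iff_lt_succ.2 fun i => ?_
    exact (h.1 _).trans_lt (h.2 i.succ i.castSucc (by simp))

lemma sum_sub_of_le {ι : Type*} [Fintype ι] {a b : ι → ℕ} (h : ∀ i, b i ≤ a i) :
    ∑ i, (a i - b i) = ∑ i, a i - ∑ i, b i := by
  rw [Finset.sum_tsub_distrib _ fun i _ => h i]

lemma jtDet_succ (t : ℝ) (N : ℕ) {L : ℕ} {α : Fin L → ℕ} (hα : StrictMono α) :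
    jtDet t (N + 1) α = ∑ γ ∈ branchSet α, t ^ (∑ i, (α i - γ i)) * jtDet t N γ := by
  have h := det_sum_rows (fun i : Fin L => if h : (i : ℕ) = 0 then Finset.range (α i + 1)
    else Finset.Ioc (α ⟨i - 1, by omega⟩) (α i)) (fun i g => t ^ (α i - g))
    (fun i g j => hCoef t N ((g : ℤ) - (j : ℕ)))
  simp only [Finset.prod_pow_eq_pow_sum] at h
  simp only [jtDet, branchSet]
  rw [← h]
  cases L with
  | zero => simp
  | succ n =>
    refine Matrix.det_eq_of_forall_row_eq_smul_add_pred
      (fun i => t ^ (α i.succ - α i.castSucc)) (fun j => ?_) (fun i j => ?_)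
    · simp [sum_range_hCoef]
    · have hlt : α i.castSucc < α i.succ := hα (by simp [Fin.lt_def])
      have e : (⟨((i.succ : Fin (n + 1)) : ℕ) - 1, by simp⟩ : Fin (n + 1)) = i.castSucc := by
        ext; simp
      simp only [Matrix.of_apply]
      rw [dif_neg (by simp), e, sum_Ioc_hCoef t N hlt.le]
      ring

lemma jtDet_zero_nonneg (t : ℝ) {L : ℕ} {α : Fin L → ℕ} (hα : StrictMono α) :
    0 ≤ jtDet t 0 α := by
  have hge : ∀ i : Fin L, (i : ℕ) ≤ α i := by
    intro i
    obtain ⟨k, hk⟩ := i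
    induction k with
    | zero => simp
    | succ k ih =>
      have := ih (by omega)
      have h2 : α ⟨k, by omega⟩ < α ⟨k + 1, hk⟩ := hα (by simp [Fin.lt_def])
      simp at *
      omega
  unfold jtDet
  rw [Matrix.det_of_isUpperTriangular]
  · exact Finset.prod_nonneg fun i _ => by
      simp only [Matrix.of_apply, hCoef_zero_left]; split_ifs <;> norm_num
  · intro i j hij
    have := hge i
    simp only [id] at hij
    simp only [Matrix.of_apply, hCoef_zero_left]
    rw [if_neg]
    have h3 : (j : ℕ) < i := hij
    omega

lemma jtDet_nonneg {t : ℝ} (ht : 0 ≤ t) (N : ℕ) {L : ℕ} {α : Fin L → ℕ} (hα : StrictMono α) :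
    0 ≤ jtDet t N α := by
  induction N generalizing α with
  | zero => exact jtDet_zero_nonneg t hα
  | succ N ih =>
    rw [jtDet_succ t N hα]
    exact Finset.sum_nonneg fun γ hγ =>
      mul_nonneg (by positivity) (ih (strictMono_of_mem_branchSet hγ))

/-- The densest packing of `L` particles, corresponding to the empty partition. -/
lemma jtDet_ground (t : ℝ) (N L : ℕ) : jtDet t N (fun i : Fin L => (i : ℕ)) = 1 := by
  unfold jtDet
  rw [Matrix.det_of_isLowerTriangular]
  · simp [hCoef_zero_right]
  · intro i j hij
    have h3 : (i : ℕ) < j := hij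
    simp only [Matrix.of_apply]
    exact hCoef_neg t N (by omega)

/-- The particle positions of `μ`, listed increasingly. -/
def particlePos (L : ℕ) (μ : YoungDiagram) (i : Fin L) : ℕ := μ.rowLen (L - 1 - i) + i

lemma strictMono_particlePos (L : ℕ) (μ : YoungDiagram) : StrictMono (particlePos L μ) := by
  intro i j hij
  have h1 : (i : ℕ) < j := hij
  have := μ.rowLen_anti (L - 1 - j) (L - 1 - i) (by omega)
  simp only [particlePos]
  omega

lemma rowLen_eq_zero {L : ℕ} {μ : YoungDiagram} (h : numRows μ ≤ L) {i : ℕ} (hi : L ≤ i) :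
    μ.rowLen i = 0 := by
  by_contra h0
  have h1 : (i, 0) ∈ μ := YoungDiagram.mem_iff_lt_rowLen.2 (Nat.pos_of_ne_zero h0)
  have h2 := YoungDiagram.mem_iff_lt_colLen.1 h1
  unfold numRows at h
  omega

lemma young_ext {μ ν : YoungDiagram} (h : ∀ i, μ.rowLen i = ν.rowLen i) : μ = ν := by
  ext ⟨i, j⟩
  rw [YoungDiagram.mem_cells, YoungDiagram.mem_cells, YoungDiagram.mem_iff_lt_rowLen,
    YoungDiagram.mem_iff_lt_rowLen, h]

lemma particlePos_injective {L : ℕ} {μ ν : YoungDiagram} (hμ : numRows μ ≤ L) (hν : numRows ν ≤ L)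
    (h : particlePos L μ = particlePos L ν) : μ = ν := by
  refine young_ext fun i => ?_
  rcases lt_or_ge i L with hi | hi
  · have := congrFun h ⟨L - 1 - i, by omega⟩
    simp only [particlePos] at this
    rw [show L - 1 - (L - 1 - i) = i by omega] at this
    omega
  · rw [rowLen_eq_zero hμ hi, rowLen_eq_zero hν hi]

lemma card_eq_sum_rowLen {L : ℕ} {μ : YoungDiagram} (h : numRows μ ≤ L) :
    μ.card = ∑ i ∈ Finset.range L, μ.rowLen i := by
  have h1 : ∀ c ∈ μ.cells, c.1 ∈ Finset.range L := by
    rintro ⟨i, j⟩ hc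
    rw [Finset.mem_range]
    by_contra h2
    have h3 := YoungDiagram.mem_iff_lt_rowLen.1 ((YoungDiagram.mem_cells _).1 hc)
    rw [rowLen_eq_zero h (by simpa using h2)] at h3
    omega
  rw [YoungDiagram.card, Finset.card_eq_sum_card_fiberwise h1]
  exact Finset.sum_congr rfl fun i _ => (μ.rowLen_eq_card).symm

lemma sum_particlePos {L : ℕ} {μ : YoungDiagram} (h : numRows μ ≤ L) :
    ∑ i, particlePos L μ i = μ.card + ∑ i : Fin L, (i : ℕ) := by
  simp only [particlePos, Finset.sum_add_distrib]
  rw [card_eq_sum_rowLen h, ← Finset.sum_range_reflect,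
    ← Fin.sum_univ_eq_sum_range (fun i => μ.rowLen (L - 1 - i))]

instance (N : ℕ) (μ : YoungDiagram) : Finite (SSYTN N μ) := by
  refine Finite.of_injective
    (fun (T : SSYTN N μ) (c : μ.cells) => (⟨T.1 c.1.1 c.1.2, ?_⟩ : Fin (N + 1))) ?_
  · have := T.2 c.1.1 c.1.2 ((YoungDiagram.mem_cells _).1 c.2)
    rw [Finset.mem_Icc] at this
    omega
  · intro T T' h
    refine Subtype.ext (SemistandardYoungTableau.ext fun i j => ?_)
    by_cases hc : (i, j) ∈ μ
    · have := congrFun h ⟨(i, j), (YoungDiagram.mem_cells _).2 hc⟩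
      simpa using this
    · rw [T.1.zeros hc, T'.1.zeros hc]

/-- The cells of a tableau with entries at most `N`. -/
def innerShape {μ : YoungDiagram} (N : ℕ) (T : SemistandardYoungTableau μ) : YoungDiagram where
  cells := μ.cells.filter fun c => T c.1 c.2 ≤ N
  isLowerSet := by
    rintro ⟨i, j⟩ ⟨i', j'⟩ hle h
    simp only [Finset.coe_filter, Set.mem_ofPred_eq, YoungDiagram.mem_cells] at h ⊢
    have hle' : i' ≤ i ∧ j' ≤ j := hle
    have h1 : (i', j) ∈ μ := μ.up_left_mem hle'.1 le_rfl h.1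
    exact ⟨μ.up_left_mem hle'.1 hle'.2 h.1,
      (T.row_weak_of_le hle'.2 h1).trans ((T.col_weak hle'.1 h.1).trans h.2)⟩

lemma mem_innerShape {μ : YoungDiagram} {N : ℕ} {T : SemistandardYoungTableau μ} {i j : ℕ} :
    (i, j) ∈ innerShape N T ↔ (i, j) ∈ μ ∧ T i j ≤ N := by
  rw [← YoungDiagram.mem_cells]
  simp [innerShape]

/-- The restriction of a tableau to its entries at most `N`. -/
def innerTableau {μ : YoungDiagram} (N : ℕ) (T : SSYTN (N + 1) μ) : SSYTN N (innerShape N T.1) :=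
  ⟨{ entry := fun i j => if (i, j) ∈ innerShape N T.1 then T.1 i j else 0
     row_weak' := by
      intro i j1 j2 hj hc
      rw [if_pos hc, if_pos ((innerShape N T.1).up_left_mem le_rfl hj.le hc)]
      exact T.1.row_weak hj (mem_innerShape.1 hc).1
     col_strict' := by
      intro i1 i2 j hi hc
      rw [if_pos hc, if_pos ((innerShape N T.1).up_left_mem hi.le le_rfl hc)]
      exact T.1.col_strict hi (mem_innerShape.1 hc).1
     zeros' := fun hc => if_neg hc }, by
    intro i j hc
    have h1 := Finset.mem_Icc.1 (T.2 i j (mem_innerShape.1 hc).1)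
    have h2 := (mem_innerShape.1 hc).2
    refine Finset.mem_Icc.2 ?_
    change 1 ≤ (if (i, j) ∈ innerShape N T.1 then T.1 i j else 0) ∧
      (if (i, j) ∈ innerShape N T.1 then T.1 i j else 0) ≤ N
    rw [if_pos hc]
    exact ⟨h1.1, h2⟩⟩

lemma innerTableau_apply {μ : YoungDiagram} {N : ℕ} (T : SSYTN (N + 1) μ) {i j : ℕ}
    (h : (i, j) ∈ innerShape N T.1) : (innerTableau N T).1 i j = T.1 i j := if_pos h

lemma innerShape_rowLen_succ {μ : YoungDiagram} {N : ℕ} (T : SSYTN (N + 1) μ) (i : ℕ) :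
    μ.rowLen (i + 1) ≤ (innerShape N T.1).rowLen i := by
  by_contra h
  push Not at h
  set k := (innerShape N T.1).rowLen i
  have h1 : (i + 1, k) ∈ μ := YoungDiagram.mem_iff_lt_rowLen.2 h
  have h2 := T.1.col_strict (show i < i + 1 by omega) h1
  have h3 := Finset.mem_Icc.1 (T.2 _ _ h1)
  have h4 : (i, k) ∈ innerShape N T.1 :=
    mem_innerShape.2 ⟨μ.up_left_mem (Nat.le_succ i) le_rfl h1, by omega⟩
  exact lt_irrefl _ (YoungDiagram.mem_iff_lt_rowLen.1 h4)

lemma innerShape_le {μ : YoungDiagram} {N : ℕ} (T : SemistandardYoungTableau μ) :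
    innerShape N T ≤ μ := by
  rintro ⟨i, j⟩ h
  exact (mem_innerShape.1 h).1

lemma rowLen_mono {μ ν : YoungDiagram} (h : ν ≤ μ) (i : ℕ) : ν.rowLen i ≤ μ.rowLen i := by
  by_contra h2
  push Not at h2
  exact lt_irrefl _ (YoungDiagram.mem_iff_lt_rowLen.1 (h (YoungDiagram.mem_iff_lt_rowLen.2 h2)))

lemma numRows_mono {μ ν : YoungDiagram} (h : ν ≤ μ) : numRows ν ≤ numRows μ := by
  unfold numRows
  by_contra h2
  push Not at h2
  exact lt_irrefl _ (YoungDiagram.mem_iff_lt_colLen.1 (h (YoungDiagram.mem_iff_lt_colLen.2 h2)))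

lemma finite_young_le (μ : YoungDiagram) : {ν : YoungDiagram | ν ≤ μ}.Finite := by
  refine Set.Finite.of_finite_image (f := YoungDiagram.cells)
    ((μ.cells.powerset.finite_toSet).subset ?_) ?_
  · rintro _ ⟨ν, hν, rfl⟩
    simpa using hν
  · intro a _ b _ h
    exact YoungDiagram.ext h

/-- The shapes `ν ≤ μ` such that `μ / ν` is a horizontal strip. -/
def strips (μ : YoungDiagram) : Finset YoungDiagram :=
  (finite_young_le μ).toFinset.filter fun ν => ∀ i, μ.rowLen (i + 1) ≤ ν.rowLen i

lemma mem_strips {μ ν : YoungDiagram} :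
    ν ∈ strips μ ↔ ν ≤ μ ∧ ∀ i, μ.rowLen (i + 1) ≤ ν.rowLen i := by
  simp [strips]

lemma dCount_succ_le (N : ℕ) (μ : YoungDiagram) :
    dCount (N + 1) μ ≤ ∑ ν ∈ strips μ, dCount N ν := by
  rw [← Finset.sum_coe_sort]
  unfold dCount
  rw [← Nat.card_sigma]
  refine Nat.card_le_card_of_injective
    (fun T : SSYTN (N + 1) μ => (⟨⟨innerShape N T.1, mem_strips.2
      ⟨innerShape_le T.1, innerShape_rowLen_succ T⟩⟩, innerTableau N T⟩ :
        Σ ν : strips μ, SSYTN N ν.1)) ?_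
  intro T T' h
  have h1 : innerShape N T.1 = innerShape N T'.1 := congrArg (fun s => s.1.1) h
  have h2 : ((innerTableau N T).1 : ℕ → ℕ → ℕ) = (innerTableau N T').1 :=
    congrArg (fun s : (Σ ν : strips μ, SSYTN N ν.1) => (s.2.1 : ℕ → ℕ → ℕ)) h
  refine Subtype.ext (SemistandardYoungTableau.ext fun i j => ?_)
  by_cases hc : (i, j) ∈ μ
  · by_cases hs : (i, j) ∈ innerShape N T.1
    · rw [← innerTableau_apply T hs, ← innerTableau_apply T' (h1 ▸ hs), h2]
    · have hs' : (i, j) ∉ innerShape N T'.1 := h1 ▸ hs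
      rw [mem_innerShape] at hs hs'
      have a := Finset.mem_Icc.1 (T.2 _ _ hc)
      have b := Finset.mem_Icc.1 (T'.2 _ _ hc)
      simp only [hc, true_and] at hs hs'
      omega
  · rw [T.1.zeros hc, T'.1.zeros hc]

lemma dCount_zero_le (μ : YoungDiagram) : dCount 0 μ ≤ if μ = ⊥ then 1 else 0 := by
  split_ifs with h
  · subst h
    have : Subsingleton (SSYTN 0 ⊥) := ⟨fun T T' =>
      Subtype.ext (SemistandardYoungTableau.ext fun i j => by
        rw [T.1.zeros (YoungDiagram.notMem_bot _), T'.1.zeros (YoungDiagram.notMem_bot _)])⟩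
    exact Finite.card_le_one_iff_subsingleton.2 this
  · have : IsEmpty (SSYTN 0 μ) := ⟨fun T => h <| by
      ext ⟨i, j⟩
      simp only [YoungDiagram.mem_cells, YoungDiagram.notMem_bot, iff_false]
      intro hc
      simpa using T.2 i j hc⟩
    simp [dCount]

lemma particlePos_mem_branchSet {L : ℕ} {μ ν : YoungDiagram} (h : ν ∈ strips μ) :
    particlePos L ν ∈ branchSet (particlePos L μ) := by
  rw [mem_strips] at h
  rw [mem_branchSet]
  refine ⟨fun i => ?_, fun i j hij => ?_⟩
  · have := rowLen_mono h.1 (L - 1 - i)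
    simp only [particlePos]
    omega
  · have := h.2 (L - 1 - i)
    rw [show L - 1 - i + 1 = L - 1 - j by omega] at this
    simp only [particlePos]
    omega

lemma pow_card_mul_dCount_le {t : ℝ} (ht : 0 ≤ t) (N L : ℕ) {μ : YoungDiagram}
    (hμ : numRows μ ≤ L) : t ^ μ.card * dCount N μ ≤ jtDet t N (particlePos L μ) := by
  induction N generalizing μ with
  | zero =>
    have h := dCount_zero_le μ
    split_ifs at h with h0
    · subst h0
      have e : particlePos L ⊥ = fun i : Fin L => (i : ℕ) := by
        funext i
        have : (⊥ : YoungDiagram).rowLen (L - 1 - i) = 0 := by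
          by_contra h0
          exact YoungDiagram.notMem_bot _ (YoungDiagram.mem_iff_lt_rowLen.2 (Nat.pos_of_ne_zero h0))
        simp [particlePos, this]
      rw [e, jtDet_ground]
      simpa [YoungDiagram.card] using h
    · have : dCount 0 μ = 0 := by omega
      rw [this]
      simpa using jtDet_nonneg ht 0 (strictMono_particlePos L μ)
  | succ N ih =>
    rw [jtDet_succ t N (strictMono_particlePos L μ)]
    have hs : ∀ ν ∈ strips μ, numRows ν ≤ L := fun ν hν =>
      (numRows_mono (mem_strips.1 hν).1).trans hμ
    have hinj : Set.InjOn (particlePos L) (strips μ : Set YoungDiagram) := fun ν hν ν' hν' h =>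
      particlePos_injective (hs ν hν) (hs ν' hν') h
    calc t ^ μ.card * (dCount (N + 1) μ : ℝ) ≤ t ^ μ.card * ∑ ν ∈ strips μ, (dCount N ν : ℝ) := by
          gcongr
          exact_mod_cast dCount_succ_le N μ
      _ ≤ ∑ ν ∈ strips μ, t ^ (∑ i, (particlePos L μ i - particlePos L ν i)) *
            jtDet t N (particlePos L ν) := by
          rw [Finset.mul_sum]
          refine Finset.sum_le_sum fun ν hν => ?_
          have hle := (mem_branchSet.1 (particlePos_mem_branchSet (L := L) hν)).1
          have hcard : ν.card ≤ μ.card := Finset.card_le_card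
            (YoungDiagram.cells_subset_iff.2 (mem_strips.1 hν).1)
          rw [sum_sub_of_le hle, sum_particlePos hμ, sum_particlePos (hs ν hν),
            Nat.add_sub_add_right]
          calc t ^ μ.card * (dCount N ν : ℝ) = t ^ (μ.card - ν.card) * (t ^ ν.card * dCount N ν) := by
                rw [← mul_assoc, ← pow_add, Nat.sub_add_cancel hcard]
            _ ≤ _ := by
                gcongr
                exact ih (hs ν hν)
      _ = ∑ γ ∈ (strips μ).image (particlePos L), t ^ (∑ i, (particlePos L μ i - γ i)) *
            jtDet t N γ := by
          rw [Finset.sum_image hinj]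
      _ ≤ _ := by
          refine Finset.sum_le_sum_of_subset_of_nonneg ?_ fun γ hγ _ =>
            mul_nonneg (by positivity) (jtDet_nonneg ht N (strictMono_of_mem_branchSet hγ))
          intro γ hγ
          obtain ⟨ν, hν, rfl⟩ := Finset.mem_image.1 hγ
          exact particlePos_mem_branchSet hν

lemma oddCols_eq {m : ℕ} {μ : YoungDiagram} (h : numRows μ ≤ 2 * m) :
    oddCols μ = ∑ k ∈ Finset.range m, (μ.rowLen (2 * k) - μ.rowLen (2 * k + 1)) := by
  have e : ((Finset.range μ.card).filter fun j => Odd (μ.colLen j)) =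
      (Finset.range m).biUnion fun k => Finset.Ico (μ.rowLen (2 * k + 1)) (μ.rowLen (2 * k)) := by
    ext j
    simp only [Finset.mem_filter, Finset.mem_range, Finset.mem_biUnion, Finset.mem_Ico]
    constructor
    · rintro ⟨_, k, hk⟩
      have h1 : (2 * k, j) ∈ μ := YoungDiagram.mem_iff_lt_colLen.2 (by omega)
      have h2 : (2 * k + 1, j) ∉ μ := fun h => by
        have := YoungDiagram.mem_iff_lt_colLen.1 h
        omega
      rw [YoungDiagram.mem_iff_lt_rowLen] at h1 h2
      refine ⟨k, ?_, by omega, h1⟩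
      by_contra hkm
      rw [rowLen_eq_zero h (by omega)] at h1
      omega
    · rintro ⟨k, hk, h1, h2⟩
      have h3 : (2 * k, j) ∈ μ := YoungDiagram.mem_iff_lt_rowLen.2 h2
      have h4 : ¬ (2 * k + 1, j) ∈ μ := fun h => by
        have := YoungDiagram.mem_iff_lt_rowLen.1 h
        omega
      rw [YoungDiagram.mem_iff_lt_colLen] at h3 h4
      refine ⟨?_, k, by omega⟩
      have h5 : μ.rowLen (2 * k) ≤ μ.card := by
        rw [YoungDiagram.rowLen_eq_card]
        exact Finset.card_le_card (Finset.filter_subset _ _)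
      omega
  rw [oddCols, e, Finset.card_biUnion]
  · simp
  · intro a _ b _ hab
    rw [Function.onFun, Finset.disjoint_left]
    intro j h1 h2
    rw [Finset.mem_Ico] at h1 h2
    rcases lt_or_gt_of_ne hab with hlt | hlt
    · have := μ.rowLen_anti (2 * a + 1) (2 * b) (by omega)
      omega
    · have := μ.rowLen_anti (2 * b + 1) (2 * a) (by omega)
      omega

lemma hasSum_hCoef {t b : ℝ} (N : ℕ) (h0 : 0 ≤ b * t) (h1 : b * t < 1) :
    HasSum (fun k : ℕ => b ^ k * hCoef t N k) (((1 - b * t) ^ N)⁻¹) := by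
  have hn : ‖b * t‖ < 1 := by rwa [Real.norm_of_nonneg h0]
  cases N with
  | zero =>
    have : ∀ k : ℕ, k ≠ 0 → b ^ k * hCoef t 0 k = 0 := by
      intro k hk
      rw [hCoef_zero_left, if_neg (by exact_mod_cast hk), mul_zero]
    convert hasSum_single 0 this using 1
    simp [hCoef_zero_left]
  | succ M =>
    have h := (summable_choose_mul_geometric_of_norm_lt_one M hn).hasSum
    rw [tsum_choose_mul_geometric_of_norm_lt_one M hn] at h
    have e : (fun k : ℕ => b ^ k * hCoef t (M + 1) k) =
        fun k : ℕ => ((k + M).choose M : ℝ) * (b * t) ^ k := by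
      funext k
      rw [hCoef_natCast, Nat.multichoose_eq, mul_pow, show M + 1 + k - 1 = k + M by omega,
        Nat.choose_symm_add]
      ring
    rw [e, ← one_div]
    exact h

/-- The tail sum `∑ₖ bᵏ h(n + k)`. -/
def tailCoef (b t : ℝ) (N : ℕ) (n : ℤ) : ℝ :=
  b ^ (-n) * (((1 - b * t) ^ N)⁻¹ - ∑ k ∈ Finset.range n.toNat, b ^ k * hCoef t N k)

lemma tailCoef_zero (b t : ℝ) (N : ℕ) : tailCoef b t N 0 = ((1 - b * t) ^ N)⁻¹ := by
  simp [tailCoef]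

lemma tailCoef_rec {b : ℝ} (hb : b ≠ 0) (t : ℝ) (N : ℕ) (n : ℤ) :
    tailCoef b t N n = hCoef t N n + b * tailCoef b t N (n + 1) := by
  have e : b * b ^ (-(n + 1)) = b ^ (-n) := by
    rw [show -n = 1 + -(n + 1) by ring, zpow_add₀ hb, zpow_one]
  rcases lt_or_ge n 0 with h | h
  · rw [hCoef_neg t N h]
    simp only [tailCoef]
    rw [← mul_assoc, e, Int.toNat_of_nonpos h.le, Int.toNat_of_nonpos (by omega : n + 1 ≤ 0)]
    simp
  · obtain ⟨k, rfl⟩ := Int.eq_ofNat_of_zero_le h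
    simp only [tailCoef]
    rw [← mul_assoc, e]
    rw [show ((k : ℤ) + 1).toNat = k + 1 by omega, Int.toNat_natCast, Finset.sum_range_succ]
    rw [zpow_neg, zpow_natCast]
    field_simp
    ring

lemma sum_Ico_tailCoef {b : ℝ} (hb : b ≠ 0) (t : ℝ) (N : ℕ) {a c : ℕ} (hac : a ≤ c) (j : ℤ) :
    ∑ g ∈ Finset.Ico a c, b ^ (g - a) * hCoef t N (g - j) =
      tailCoef b t N (a - j) - b ^ (c - a) * tailCoef b t N (c - j) := by
  induction c, hac using Nat.le_induction with
  | base => simp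
  | succ c hc ih =>
    rw [Finset.sum_Ico_succ_top hc, ih, tailCoef_rec hb t N (c - j), Nat.sub_add_comm hc, pow_succ,
      show ((c + 1 : ℕ) : ℤ) - j = c - j + 1 by push_cast; ring]
    ring

lemma tendsto_tailCoef {b t : ℝ} (hb : 0 < b) (ht : 0 ≤ t) (h1 : b * t < 1) (N : ℕ) (a j : ℕ) :
    Filter.Tendsto (fun c : ℕ => b ^ (c - a) * tailCoef b t N (c - j)) Filter.atTop (nhds 0) := by
  have h := (hasSum_hCoef N (by positivity) h1).tendsto_sum_nat
  have h2 : Filter.Tendsto (fun c : ℕ => b ^ j / b ^ a *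
      (((1 - b * t) ^ N)⁻¹ - ∑ k ∈ Finset.range (c - j), b ^ k * hCoef t N k))
      Filter.atTop (nhds 0) := by
    have h3 := (h.comp (Filter.tendsto_sub_atTop_nat j)).const_sub (((1 - b * t) ^ N)⁻¹)
    simpa using h3.const_mul (b ^ j / b ^ a)
  refine h2.congr' ?_
  filter_upwards [Filter.eventually_ge_atTop (a + j)] with c hc
  simp only [tailCoef]
  rw [show ((c : ℤ) - j).toNat = c - j by omega, show -((c : ℤ) - j) = j - c by ring,
    zpow_sub₀ hb.ne', zpow_natCast, zpow_natCast, pow_sub₀ _ hb.ne' (by omega : a ≤ c)]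
  field_simp

lemma det_succ_of_row_zero {L : ℕ} (M : Matrix (Fin (L + 1)) (Fin (L + 1)) ℝ)
    (h : ∀ j : Fin L, M 0 j.succ = 0) :
    M.det = M 0 0 * (M.submatrix Fin.succ Fin.succ).det := by
  rw [Matrix.det_succ_row_zero, Fin.sum_univ_succ]
  simp [h, Fin.succAbove_zero]

/-- Prepending a particle at the origin. -/
def addGround {L : ℕ} (α : Fin L → ℕ) : Fin (L + 1) → ℕ := Fin.cons 0 fun i => α i + 1

lemma strictMono_addGround {L : ℕ} {α : Fin L → ℕ} (hα : StrictMono α) :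
    StrictMono (addGround α) := by
  intro i j hij
  induction i using Fin.cases with
  | zero =>
    induction j using Fin.cases with
    | zero => exact absurd hij (lt_irrefl _)
    | succ j => simp [addGround]
  | succ i =>
    induction j using Fin.cases with
    | zero => exact absurd hij (Fin.not_lt_zero _)
    | succ j => simpa [addGround] using hα (Fin.succ_lt_succ_iff.1 hij)

lemma jtDet_addGround (t : ℝ) (N : ℕ) {L : ℕ} (α : Fin L → ℕ) :
    jtDet t N (addGround α) = jtDet t N α := by
  unfold jtDet
  rw [det_succ_of_row_zero]
  · have e : ((Matrix.of fun i j : Fin (L + 1) => hCoef t N ((addGround α i : ℤ) - (j : ℕ))).submatrix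
        Fin.succ Fin.succ) = Matrix.of fun i j : Fin L => hCoef t N ((α i : ℤ) - (j : ℕ)) := by
      ext i j
      simp [addGround]
    rw [e]
    simp [addGround, hCoef_zero_right]
  · intro j
    simp only [addGround, Matrix.of_apply, Fin.cons_zero]
    exact hCoef_neg t N (by simp; omega)

/-- Configurations interlacing `μ` from above, with last particle below `K`. -/
def pieriSet (K : ℕ) {L : ℕ} (μ : Fin L → ℕ) : Finset (Fin L → ℕ) :=
  Fintype.piFinset fun i => Finset.Ico (μ i) (if h : (i : ℕ) + 1 < L then μ ⟨i + 1, h⟩ else K)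

lemma mem_pieriSet {K L : ℕ} {μ l : Fin L → ℕ} :
    l ∈ pieriSet K μ ↔ (∀ i, μ i ≤ l i) ∧ (∀ i j : Fin L, (i : ℕ) + 1 = j → l i < μ j) ∧
      ∀ i : Fin L, (i : ℕ) + 1 = L → l i < K := by
  simp only [pieriSet, Fintype.mem_piFinset, Finset.mem_Ico]
  constructor
  · intro h
    refine ⟨fun i => (h i).1, fun i j hij => ?_, fun i hi => ?_⟩
    · have h2 := (h i).2
      rw [dif_pos (by omega)] at h2
      have e : (⟨(i : ℕ) + 1, by omega⟩ : Fin L) = j := by ext; simpa using hij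
      rwa [e] at h2
    · have h2 := (h i).2
      rwa [dif_neg (by omega)] at h2
  · rintro ⟨h1, h2, h3⟩ i
    refine ⟨h1 i, ?_⟩
    split_ifs with hi
    · exact h2 i _ rfl
    · exact h3 i (by omega)

lemma strictMono_of_mem_pieriSet {K L : ℕ} {μ l : Fin L → ℕ} (h : l ∈ pieriSet K μ) :
    StrictMono l := by
  rw [mem_pieriSet] at h
  cases L with
  | zero => exact fun i => i.elim0
  | succ n =>
    refine Fin.strictMono_iff_lt_succ.2 fun i => ?_
    exact (h.2.1 i.castSucc i.succ (by simp)).trans_le (h.1 _)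

/-- The weighted sum of determinants over `pieriSet`. -/
def pieriSum (b t : ℝ) (N K : ℕ) {L : ℕ} (μ : Fin L → ℕ) : ℝ :=
  ∑ l ∈ pieriSet K μ, b ^ (∑ i, (l i - μ i)) * jtDet t N l

lemma pieriSum_eq_det (b t : ℝ) (N K : ℕ) {L : ℕ} (μ : Fin L → ℕ) :
    pieriSum b t N K μ = Matrix.det (Matrix.of fun i j : Fin L =>
      ∑ g ∈ Finset.Ico (μ i) (if h : (i : ℕ) + 1 < L then μ ⟨i + 1, h⟩ else K),
        b ^ (g - μ i) * hCoef t N ((g : ℤ) - (j : ℕ))) := by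
  rw [det_sum_rows (fun i : Fin L =>
    Finset.Ico (μ i) (if h : (i : ℕ) + 1 < L then μ ⟨i + 1, h⟩ else K)) (fun i g => b ^ (g - μ i))
    (fun i g j => hCoef t N ((g : ℤ) - (j : ℕ)))]
  simp only [Finset.prod_pow_eq_pow_sum]
  rfl

lemma det_tailCoef {b : ℝ} (hb : b ≠ 0) (t : ℝ) (N : ℕ) {L : ℕ} (μ : Fin L → ℕ) :
    Matrix.det (Matrix.of fun i j : Fin (L + 1) =>
      tailCoef b t N ((addGround μ i : ℤ) - (j : ℕ))) = ((1 - b * t) ^ N)⁻¹ * jtDet t N μ := by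
  rw [Matrix.det_eq_of_forall_col_eq_smul_add_pred (B := Matrix.of fun i j : Fin (L + 1) =>
    Fin.cases (tailCoef b t N (addGround μ i : ℤ))
      (fun j' : Fin L => hCoef t N ((addGround μ i : ℤ) - 1 - (j' : ℕ))) j) (fun _ => b)]
  · rw [det_succ_of_row_zero]
    · simp [addGround, tailCoef_zero, jtDet, Matrix.submatrix]
    · intro j
      simp only [addGround, Matrix.of_apply, Fin.cons_zero, Fin.cases_succ]
      exact hCoef_neg t N (by simp; omega)
  · simp
  · intro i j
    simp only [Matrix.of_apply, Fin.cases_succ]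
    rw [tailCoef_rec hb]
    simp only [Fin.val_succ, Fin.val_castSucc]
    push_cast
    congr 2
    · ring
    · ring_nf

lemma tendsto_pieriSum {b t : ℝ} (hb : 0 < b) (ht : 0 ≤ t) (h1 : b * t < 1) (N : ℕ) {L : ℕ}
    {μ : Fin L → ℕ} (hμ : StrictMono μ) :
    Filter.Tendsto (fun K => pieriSum b t N K (addGround μ)) Filter.atTop
      (nhds (((1 - b * t) ^ N)⁻¹ * jtDet t N μ)) := by
  set ν := addGround μ with hν
  have hνm : StrictMono ν := strictMono_addGround hμ
  set A : Matrix (Fin (L + 1)) (Fin (L + 1)) ℝ := Matrix.of fun i j =>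
    if h : (i : ℕ) + 1 < L + 1 then tailCoef b t N ((ν i : ℤ) - (j : ℕ)) -
      b ^ (ν ⟨i + 1, h⟩ - ν i) * tailCoef b t N ((ν ⟨i + 1, h⟩ : ℤ) - (j : ℕ))
    else tailCoef b t N ((ν i : ℤ) - (j : ℕ)) with hA
  have hdet : A.det = ((1 - b * t) ^ N)⁻¹ * jtDet t N μ := by
    rw [← det_tailCoef hb.ne' t N μ, ← hν]
    rw [← Matrix.det_submatrix_equiv_self Fin.revPerm,
      ← Matrix.det_submatrix_equiv_self Fin.revPerm (Matrix.of fun i j : Fin (L + 1) =>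
      tailCoef b t N ((ν i : ℤ) - (j : ℕ)))]
    symm
    refine Matrix.det_eq_of_forall_row_eq_smul_add_pred
      (fun i => b ^ (ν (Fin.rev i.castSucc) - ν (Fin.rev i.succ))) (fun j => ?_) (fun i j => ?_)
    · simp [hA]
    · simp only [hA, Matrix.submatrix_apply, Matrix.of_apply, Fin.revPerm_apply]
      have e : ((Fin.rev i.succ : Fin (L + 1)) : ℕ) + 1 < L + 1 := by
        simp only [Fin.val_rev, Fin.val_succ]
        omega
      have e2 : (⟨((Fin.rev i.succ : Fin (L + 1)) : ℕ) + 1, e⟩ : Fin (L + 1)) =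
          Fin.rev i.castSucc := by
        ext
        simp only [Fin.val_rev, Fin.val_succ, Fin.val_castSucc]
        omega
      rw [dif_pos e, e2]
      ring
  rw [← hdet]
  simp_rw [pieriSum_eq_det]
  have hc : Continuous fun M : Matrix (Fin (L + 1)) (Fin (L + 1)) ℝ => M.det :=
    continuous_id.matrix_det
  refine (hc.tendsto A).comp ?_
  refine tendsto_pi_nhds.2 fun i => tendsto_pi_nhds.2 fun j => ?_
  simp only [hA, Matrix.of_apply]
  split_ifs with hi
  · refine tendsto_const_nhds.congr fun K => ?_
    rw [sum_Ico_tailCoef hb.ne' t N (hνm.monotone (by simp [Fin.le_def]))]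
  · have h2 := (tendsto_tailCoef hb ht h1 N (ν i) j).const_sub
      (tailCoef b t N ((ν i : ℤ) - (j : ℕ)))
    rw [sub_zero] at h2
    refine h2.congr' ?_
    filter_upwards [Filter.eventually_ge_atTop (ν i)] with K hK
    rw [sum_Ico_tailCoef hb.ne' t N hK]

lemma pieriSum_mono {b t : ℝ} (hb : 0 < b) (ht : 0 ≤ t) (N : ℕ) {L : ℕ} (μ : Fin L → ℕ) :
    Monotone fun K => pieriSum b t N K μ := by
  intro K K' hK
  refine Finset.sum_le_sum_of_subset_of_nonneg (fun l hl => ?_) fun l hl _ =>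
    mul_nonneg (by positivity) (jtDet_nonneg ht N (strictMono_of_mem_pieriSet hl))
  rw [mem_pieriSet] at hl ⊢
  exact ⟨hl.1, hl.2.1, fun i hi => (hl.2.2 i hi).trans_le hK⟩

lemma pieriSum_le_addGround {b t : ℝ} (hb : 0 < b) (ht : 0 ≤ t) (N K : ℕ) {L : ℕ}
    (μ : Fin L → ℕ) :
    pieriSum b t N K μ ≤ pieriSum b t N (K + 1) (addGround μ) := by
  have hinj : Set.InjOn (addGround (L := L)) (pieriSet K μ : Set (Fin L → ℕ)) := by
    intro x _ y _ h
    funext i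
    have := congrFun h i.succ
    simpa [addGround] using this
  calc pieriSum b t N K μ = ∑ l ∈ (pieriSet K μ).image addGround,
        b ^ (∑ i, (l i - addGround μ i)) * jtDet t N l := by
        rw [Finset.sum_image hinj]
        refine Finset.sum_congr rfl fun l _ => ?_
        rw [jtDet_addGround, Fin.sum_univ_succ]
        simp [addGround]
    _ ≤ _ := by
        refine Finset.sum_le_sum_of_subset_of_nonneg (fun l hl => ?_) fun l hl _ =>
          mul_nonneg (by positivity) (jtDet_nonneg ht N (strictMono_of_mem_pieriSet hl))
        obtain ⟨x, hx, rfl⟩ := Finset.mem_image.1 hl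
        rw [mem_pieriSet] at hx ⊢
        refine ⟨fun i => ?_, fun i j hij => ?_, fun i hi => ?_⟩
        · induction i using Fin.cases with
          | zero => simp [addGround]
          | succ i => simpa [addGround] using hx.1 i
        · induction j using Fin.cases with
          | zero => simp at hij
          | succ j =>
            induction i using Fin.cases with
            | zero => simp [addGround]
            | succ i => simpa [addGround] using hx.2.1 i j (by simpa using hij)
        · induction i using Fin.cases with
          | zero => simp [addGround]
          | succ i => simpa [addGround] using hx.2.2 i (by simpa using hi)

/-- The one-variable Pieri inequality. -/
lemma pieriSum_le {b t : ℝ} (hb : 0 < b) (ht : 0 ≤ t) (h1 : b * t < 1) (N K : ℕ) {L : ℕ}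
    {μ : Fin L → ℕ} (hμ : StrictMono μ) :
    pieriSum b t N K μ ≤ ((1 - b * t) ^ N)⁻¹ * jtDet t N μ :=
  (pieriSum_le_addGround hb ht N K μ).trans
    ((pieriSum_mono hb ht N _).ge_of_tendsto (tendsto_pieriSum hb ht h1 N hμ) _)

/-- The even-indexed particle of the `k`-th pair. -/
def lo {m : ℕ} (k : Fin m) : Fin (m * 2) := ⟨2 * k, by omega⟩

/-- The odd-indexed particle of the `k`-th pair. -/
def hi {m : ℕ} (k : Fin m) : Fin (m * 2) := ⟨2 * k + 1, by omega⟩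

lemma sum_pairs {M : Type*} [AddCommMonoid M] {m : ℕ} (f : Fin (m * 2) → M) :
    ∑ i, f i = ∑ k : Fin m, (f (lo k) + f (hi k)) := by
  rw [← finProdFinEquiv.sum_comp, Fintype.sum_prod_type]
  refine Finset.sum_congr rfl fun k _ => ?_
  rw [Fin.sum_univ_two]
  congr 2
  · ext; simp [lo]
  · ext; simp [hi]; omega

lemma eq_lo_or_hi {m : ℕ} (i : Fin (m * 2)) : ∃ k : Fin m, i = lo k ∨ i = hi k := by
  refine ⟨⟨i / 2, by omega⟩, ?_⟩
  rcases Nat.even_or_odd' (i : ℕ) with ⟨c, hc | hc⟩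
  · left; ext; simp [lo]; omega
  · right; ext; simp [hi]; omega

lemma forall_pairs {m : ℕ} {p : Fin (m * 2) → Prop} (h : ∀ k, p (lo k) ∧ p (hi k)) (i) : p i := by
  obtain ⟨k, rfl | rfl⟩ := eq_lo_or_hi i
  exacts [(h k).1, (h k).2]

lemma strictMono_of_lt_next {L : ℕ} {α : Fin L → ℕ}
    (h : ∀ i j : Fin L, (i : ℕ) + 1 = j → α i < α j) : StrictMono α := by
  cases L with
  | zero => exact fun i => i.elim0
  | succ n => exact Fin.strictMono_iff_lt_succ.2 fun i => h _ _ (by simp)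

lemma next_lo {m : ℕ} {k : Fin m} {j : Fin (m * 2)} (h : ((lo k : Fin (m * 2)) : ℕ) + 1 = j) :
    j = hi k := by
  ext; rw [← h]; simp [lo, hi]

lemma next_hi {m : ℕ} {k : Fin m} {j : Fin (m * 2)} (h : ((hi k : Fin (m * 2)) : ℕ) + 1 = j) :
    ∃ k' : Fin m, (k : ℕ) + 1 = k' ∧ j = lo k' := by
  have h' : 2 * (k : ℕ) + 1 + 1 = j := h
  refine ⟨⟨k + 1, by omega⟩, rfl, ?_⟩
  ext; simp [lo]; omega

lemma strictMono_pairs {m : ℕ} {α : Fin (m * 2) → ℕ} (h1 : ∀ k, α (lo k) < α (hi k))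
    (h2 : ∀ k k' : Fin m, (k : ℕ) + 1 = k' → α (hi k) < α (lo k')) : StrictMono α := by
  refine strictMono_of_lt_next fun i j hij => ?_
  obtain ⟨k, rfl | rfl⟩ := eq_lo_or_hi i
  · rw [next_lo hij]
    exact h1 k
  · obtain ⟨k', hk, rfl⟩ := next_hi hij
    exact h2 k k' hk

lemma lo_lt_hi {m : ℕ} (k : Fin m) : (lo k : Fin (m * 2)) < hi k := by
  simp [lo, hi]

lemma hi_lt_lo {m : ℕ} {k k' : Fin m} (h : (k : ℕ) + 1 = k') : (hi k : Fin (m * 2)) < lo k' := by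
  simp only [hi, lo, Fin.mk_lt_mk]
  omega

/-- Configurations of `2m` particles below `K`. -/
def configs (m K : ℕ) : Finset (Fin (m * 2) → ℕ) :=
  (Fintype.piFinset fun _ => Finset.range K).filter StrictMono

lemma mem_configs {m K : ℕ} {α : Fin (m * 2) → ℕ} :
    α ∈ configs m K ↔ (∀ i, α i < K) ∧ StrictMono α := by
  simp [configs]

/-- Configurations made of `m` pairs of adjacent particles. -/
def dimers (m K : ℕ) : Finset (Fin (m * 2) → ℕ) :=
  (configs m K).filter fun α => ∀ k, α (hi k) = α (lo k) + 1

lemma mem_dimers {m K : ℕ} {α : Fin (m * 2) → ℕ} :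
    α ∈ dimers m K ↔ ((∀ i, α i < K) ∧ StrictMono α) ∧ ∀ k, α (hi k) = α (lo k) + 1 := by
  simp [dimers, mem_configs]

/-- Move the second particle of every pair next to the first one. -/
def pairDown {m : ℕ} (α : Fin (m * 2) → ℕ) : Fin (m * 2) → ℕ := fun i =>
  if (i : ℕ) % 2 = 0 then α i else α ⟨i - 1, by omega⟩ + 1

lemma pairDown_lo {m : ℕ} (α : Fin (m * 2) → ℕ) (k : Fin m) : pairDown α (lo k) = α (lo k) := by
  simp [pairDown, lo]

lemma pairDown_hi {m : ℕ} (α : Fin (m * 2) → ℕ) (k : Fin m) :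
    pairDown α (hi k) = α (lo k) + 1 := by
  have : ((hi k : Fin (m * 2)) : ℕ) % 2 ≠ 0 := by simp [hi]
  rw [pairDown, if_neg this]
  rfl

/-- The sum of jtDet over dimer configurations. -/
def dimerSum (t : ℝ) (N m K : ℕ) : ℝ := ∑ α ∈ dimers m K, jtDet t N α

/-- The weighted sum over all configurations. -/
def configSum (b t : ℝ) (N m K : ℕ) : ℝ :=
  ∑ α ∈ configs m K, b ^ (∑ i, (α i - pairDown α i)) * jtDet t N α

lemma pairDown_mem {m K : ℕ} {α : Fin (m * 2) → ℕ} (h : α ∈ configs m K) :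
    pairDown α ∈ dimers m K ∧ α ∈ pieriSet K (pairDown α) := by
  rw [mem_configs] at h
  rw [mem_dimers, mem_pieriSet]
  have h1 : ∀ k, α (lo k) < α (hi k) := fun k => h.2 (lo_lt_hi k)
  refine ⟨⟨⟨forall_pairs fun k => ?_, strictMono_pairs (fun k => ?_) fun k k' hk => ?_⟩,
    fun k => ?_⟩, forall_pairs fun k => ?_, fun i j hij => ?_, fun i _ => h.1 i⟩
  · have a := h.1 (hi k)
    have b := h1 k
    rw [pairDown_lo, pairDown_hi]
    omega
  · rw [pairDown_lo, pairDown_hi]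
    omega
  · rw [pairDown_lo, pairDown_hi]
    exact (Nat.succ_le_of_lt (h1 k)).trans_lt (h.2 (hi_lt_lo hk))
  · rw [pairDown_lo, pairDown_hi]
  · rw [pairDown_lo, pairDown_hi]
    exact ⟨le_rfl, h1 k⟩
  · obtain ⟨k, rfl | rfl⟩ := eq_lo_or_hi i
    · rw [next_lo hij, pairDown_hi]
      omega
    · obtain ⟨k', hk, rfl⟩ := next_hi hij
      rw [pairDown_lo]
      exact h.2 (hi_lt_lo hk)

lemma configSum_le {b t : ℝ} (hb : 0 < b) (ht : 0 ≤ t) (h1 : b * t < 1) (N m K : ℕ) :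
    configSum b t N m K ≤ ((1 - b * t) ^ N)⁻¹ * dimerSum t N m K := by
  rw [configSum, dimerSum, ← Finset.sum_fiberwise_of_maps_to (g := pairDown) (t := dimers m K)
    fun α hα => (pairDown_mem hα).1, Finset.mul_sum]
  refine Finset.sum_le_sum fun μ hμ => ?_
  refine le_trans ?_ (pieriSum_le hb ht h1 N K (mem_dimers.1 hμ).1.2)
  calc _ = ∑ l ∈ (configs m K).filter fun l => pairDown l = μ,
        b ^ (∑ i, (l i - μ i)) * jtDet t N l := by
        refine Finset.sum_congr rfl fun l hl => ?_
        rw [(Finset.mem_filter.1 hl).2]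
    _ ≤ _ := by
        refine Finset.sum_le_sum_of_subset_of_nonneg (fun l hl => ?_) fun l hl _ =>
          mul_nonneg (by positivity) (jtDet_nonneg ht N (strictMono_of_mem_pieriSet hl))
        obtain ⟨h, rfl⟩ := Finset.mem_filter.1 hl
        exact (pairDown_mem h).2

lemma branch_of_dimers {m K : ℕ} {α γ : Fin (m * 2) → ℕ} (hα : α ∈ dimers m K)
    (hγ : γ ∈ branchSet α) : (∀ k, γ (hi k) = α (hi k)) ∧ γ ∈ configs m K ∧
      ∑ i, (α i - γ i) = ∑ i, (γ i - pairDown γ i) := by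
  have hm := strictMono_of_mem_branchSet hγ
  rw [mem_dimers] at hα
  rw [mem_branchSet] at hγ
  have h1 : ∀ k, γ (hi k) = α (hi k) := fun k => by
    have a := hγ.1 (hi k)
    have b := hγ.2 (hi k) (lo k) rfl
    have c := hα.2 k
    omega
  refine ⟨h1, mem_configs.2 ⟨fun i => (hγ.1 i).trans_lt (hα.1.1 i), hm⟩, ?_⟩
  rw [sum_pairs, sum_pairs]
  refine Finset.sum_congr rfl fun k _ => ?_
  have c := hα.2 k
  have d := h1 k
  rw [pairDown_lo, pairDown_hi]
  omega

lemma dimerSum_succ_le {t : ℝ} (ht : 0 ≤ t) (N m K : ℕ) :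
    dimerSum t (N + 1) m K ≤ configSum t t N m K := by
  set F : (Fin (m * 2) → ℕ) → ℝ := fun γ => t ^ (∑ i, (γ i - pairDown γ i)) * jtDet t N γ with hF
  have h : dimerSum t (N + 1) m K = ∑ α ∈ dimers m K, ∑ γ ∈ branchSet α, F γ := by
    refine Finset.sum_congr rfl fun α hα => ?_
    rw [jtDet_succ t N (mem_dimers.1 hα).1.2]
    refine Finset.sum_congr rfl fun γ hγ => ?_
    rw [hF, (branch_of_dimers hα hγ).2.2]
  rw [h, Finset.sum_comm' (t' := configs m K)
    (s' := fun γ => (dimers m K).filter fun α => γ ∈ branchSet α)]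
  · refine Finset.sum_le_sum fun γ hγ => ?_
    rw [Finset.sum_const, nsmul_eq_mul]
    have hc : ((dimers m K).filter fun α => γ ∈ branchSet α).card ≤ 1 := by
      refine Finset.card_le_one.2 fun a ha b hb => ?_
      rw [Finset.mem_filter] at ha hb
      have ha' := (branch_of_dimers ha.1 ha.2).1
      have hb' := (branch_of_dimers hb.1 hb.2).1
      refine funext (forall_pairs fun k => ?_)
      have a2 := (mem_dimers.1 ha.1).2 k
      have b2 := (mem_dimers.1 hb.1).2 k
      have a3 := ha' k
      have b3 := hb' k
      omega
    have hF0 : 0 ≤ F γ := mul_nonneg (by positivity) (jtDet_nonneg ht N (mem_configs.1 hγ).2)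
    calc _ ≤ (1 : ℝ) * F γ := by
          gcongr
          exact_mod_cast hc
      _ = _ := one_mul _
  · intro α γ
    rw [Finset.mem_filter]
    exact ⟨fun h => ⟨h, (branch_of_dimers h.1 h.2).2.1⟩, fun h => h.1⟩

lemma le_of_strictMono_fin {L : ℕ} {α : Fin L → ℕ} (hα : StrictMono α) (i : Fin L) :
    (i : ℕ) ≤ α i := by
  obtain ⟨k, hk⟩ := i
  induction k with
  | zero => simp
  | succ k ih =>
    have := ih (by omega)
    have h2 : α ⟨k, by omega⟩ < α ⟨k + 1, hk⟩ := hα (by simp [Fin.lt_def])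
    simp at *
    omega

lemma jtDet_zero (t : ℝ) {L : ℕ} {α : Fin L → ℕ} (hα : StrictMono α) :
    jtDet t 0 α = if α = fun i : Fin L => (i : ℕ) then 1 else 0 := by
  split_ifs with h
  · rw [h, jtDet_ground]
  · unfold jtDet
    obtain ⟨i, hi⟩ : ∃ i, α i ≠ i := by
      by_contra hc
      push Not at hc
      exact h (funext hc)
    rw [Matrix.det_of_isUpperTriangular]
    · refine Finset.prod_eq_zero (Finset.mem_univ i) ?_
      rw [Matrix.of_apply, hCoef_zero_left, if_neg (by omega)]
    · intro i j hij
      have := le_of_strictMono_fin hα i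
      have h3 : (j : ℕ) < i := hij
      rw [Matrix.of_apply, hCoef_zero_left, if_neg (by omega)]

lemma dimerSum_le {t : ℝ} (ht : 0 < t) (ht1 : t < 1) (N m K : ℕ) :
    dimerSum t N m K ≤ ((1 - t ^ 2) ^ (N * (N - 1) / 2))⁻¹ := by
  have hp : 0 < 1 - t ^ 2 := by nlinarith
  induction N with
  | zero =>
    rw [dimerSum, Finset.sum_congr rfl fun α hα => jtDet_zero t (mem_dimers.1 hα).1.2,
      Finset.sum_ite_eq']
    simp
    split_ifs <;> norm_num
  | succ N ih =>
    have e : (N + 1) * (N + 1 - 1) / 2 = N + N * (N - 1) / 2 := by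
      rw [← Finset.sum_range_id_mul_two, ← Finset.sum_range_id_mul_two, Finset.sum_range_succ]
      omega
    calc dimerSum t (N + 1) m K ≤ configSum t t N m K := dimerSum_succ_le ht.le N m K
      _ ≤ ((1 - t * t) ^ N)⁻¹ * dimerSum t N m K := configSum_le ht ht.le (by nlinarith) N m K
      _ ≤ ((1 - t ^ 2) ^ N)⁻¹ * ((1 - t ^ 2) ^ (N * (N - 1) / 2))⁻¹ := by
          rw [← sq]
          gcongr
      _ = _ := by rw [e, pow_add, mul_inv]

lemma dimerSum_mono {t : ℝ} (ht : 0 ≤ t) (N m : ℕ) : Monotone fun K => dimerSum t N m K := by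
  intro K K' hK
  refine Finset.sum_le_sum_of_subset_of_nonneg (fun α hα => ?_) fun α hα _ =>
    jtDet_nonneg ht N (mem_dimers.1 hα).1.2
  rw [mem_dimers] at hα ⊢
  exact ⟨⟨fun i => (hα.1.1 i).trans_le hK, hα.1.2⟩, hα.2⟩

lemma one_le_dimerSum {t : ℝ} (ht : 0 ≤ t) (N m : ℕ) {K : ℕ} (hK : m * 2 ≤ K) :
    1 ≤ dimerSum t N m K := by
  rw [← jtDet_ground t N (m * 2)]
  refine Finset.single_le_sum (f := fun α => jtDet t N α)
    (fun α hα => jtDet_nonneg ht N (mem_dimers.1 hα).1.2) ?_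
  rw [mem_dimers]
  refine ⟨⟨fun i => i.2.trans_le hK, fun i j h => h⟩, fun k => ?_⟩
  simp [lo, hi]

lemma oddCols_eq_particlePos {m : ℕ} {μ : YoungDiagram} (h : numRows μ ≤ m * 2) :
    oddCols μ = ∑ i, (particlePos (m * 2) μ i - pairDown (particlePos (m * 2) μ) i) := by
  rw [oddCols_eq (by omega : numRows μ ≤ 2 * m), sum_pairs, ← Finset.sum_range_reflect,
    ← Fin.sum_univ_eq_sum_range (fun k => μ.rowLen (2 * (m - 1 - k)) -
      μ.rowLen (2 * (m - 1 - k) + 1))]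
  refine Finset.sum_congr rfl fun k _ => ?_
  rw [pairDown_lo, pairDown_hi]
  have e1 : m * 2 - 1 - ((lo k : Fin (m * 2)) : ℕ) = 2 * (m - 1 - k) + 1 := by
    simp [lo]; omega
  have e2 : m * 2 - 1 - ((hi k : Fin (m * 2)) : ℕ) = 2 * (m - 1 - k) := by
    simp [hi]; omega
  have e3 : ((hi k : Fin (m * 2)) : ℕ) = (lo k : Fin (m * 2)) + 1 := rfl
  simp only [particlePos]
  rw [e1, e2, e3]
  omega

lemma phiGF_le {t β : ℝ} (ht : 0 < t) (ht1 : t < 1) (hβ : 0 < β) (hβt : β * t < 1) {N l m : ℕ}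
    (hl : l ≤ m * 2) {B : ℝ} (hB : ∀ K, dimerSum t N m K ≤ B) :
    phiGF N l t β ≤ (1 - t ^ 2) ^ (N * (N - 1) / 2) * B := by
  have hp : 0 < 1 - t ^ 2 := by nlinarith
  have hq : 0 < 1 - β * t := by linarith
  have key : ∑' μ : {μ : YoungDiagram // numRows μ ≤ l},
      t ^ (μ.1.card) * β ^ (oddCols μ.1) * (dCount N μ.1 : ℝ) ≤ ((1 - β * t) ^ N)⁻¹ * B := by
    refine Real.tsum_le_of_sum_le (fun μ => by positivity) fun s => ?_
    obtain ⟨K, hK⟩ : ∃ K, ∀ μ ∈ s, ∀ i, particlePos (m * 2) μ.1 i < K := by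
      refine ⟨∑ μ ∈ s, ∑ i, particlePos (m * 2) μ.1 i + 1, fun μ hμ i => Nat.lt_succ_of_le ?_⟩
      exact (Finset.single_le_sum (f := fun i => particlePos (m * 2) μ.1 i)
        (fun _ _ => Nat.zero_le _) (Finset.mem_univ i)).trans
        (Finset.single_le_sum (f := fun μ : {μ : YoungDiagram // numRows μ ≤ l} =>
          ∑ i, particlePos (m * 2) μ.1 i) (fun _ _ => Nat.zero_le _) hμ)
    have hr : ∀ μ : {μ : YoungDiagram // numRows μ ≤ l}, numRows μ.1 ≤ m * 2 :=
      fun μ => μ.2.trans hl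
    have hinj : Set.InjOn (fun μ : {μ : YoungDiagram // numRows μ ≤ l} =>
        particlePos (m * 2) μ.1) s := fun μ _ ν _ h =>
      Subtype.ext (particlePos_injective (hr μ) (hr ν) h)
    calc _ ≤ ∑ μ ∈ s, β ^ (∑ i, (particlePos (m * 2) μ.1 i -
            pairDown (particlePos (m * 2) μ.1) i)) * jtDet t N (particlePos (m * 2) μ.1) := by
          refine Finset.sum_le_sum fun μ _ => ?_
          rw [← oddCols_eq_particlePos (hr μ), mul_right_comm, mul_comm]
          gcongr
          exact pow_card_mul_dCount_le ht.le N (m * 2) (hr μ)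
      _ = ∑ α ∈ s.image fun μ => particlePos (m * 2) μ.1,
            β ^ (∑ i, (α i - pairDown α i)) * jtDet t N α := by
          rw [Finset.sum_image hinj]
      _ ≤ configSum β t N m K := by
          refine Finset.sum_le_sum_of_subset_of_nonneg (fun α hα => ?_) fun α hα _ =>
            mul_nonneg (by positivity) (jtDet_nonneg ht.le N (mem_configs.1 hα).2)
          obtain ⟨μ, hμ, rfl⟩ := Finset.mem_image.1 hα
          exact mem_configs.2 ⟨hK μ hμ, strictMono_particlePos _ _⟩
      _ ≤ ((1 - β * t) ^ N)⁻¹ * dimerSum t N m K := configSum_le hβ ht.le hβt N m K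
      _ ≤ _ := by
          gcongr
          exact hB K
  calc phiGF N l t β ≤ (1 - t ^ 2) ^ (N * (N - 1) / 2) * (1 - β * t) ^ N *
        (((1 - β * t) ^ N)⁻¹ * B) := by
        unfold phiGF
        gcongr
    _ = _ := by
        rw [mul_assoc, mul_inv_cancel_left₀ (pow_pos hq N).ne']

lemma phiGF_nonneg {t β : ℝ} (ht : 0 < t) (ht1 : t < 1) (hβ : 0 < β) (hβt : β * t < 1) (N l : ℕ) :
    0 ≤ phiGF N l t β := by
  have hp : 0 < 1 - t ^ 2 := by nlinarith
  have hq : 0 < 1 - β * t := by linarith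
  exact mul_nonneg (by positivity) (tsum_nonneg fun μ => by positivity)

/-- A symmetric function vanishing on non-injective tuples is summed by sorting. -/
lemma sum_piFinset_eq_factorial_mul {m : ℕ} (s : Finset ℕ) (F : (Fin m → ℕ) → ℝ)
    (hsymm : ∀ (σ : Equiv.Perm (Fin m)) a, F (a ∘ σ) = F a)
    (hinj : ∀ a, ¬ Function.Injective a → F a = 0) :
    ∑ a ∈ Fintype.piFinset fun _ => s, F a =
      m.factorial * ∑ a ∈ (Fintype.piFinset fun _ => s).filter StrictMono, F a := by
  have h : ∑ p ∈ (Finset.univ : Finset (Equiv.Perm (Fin m))) ×ˢ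
      (Fintype.piFinset fun _ => s).filter StrictMono, F p.2 =
      ∑ a ∈ Fintype.piFinset fun _ => s, F a := by
    refine Finset.sum_of_injOn (fun p => p.2 ∘ p.1) ?_ ?_ ?_ ?_
    · rintro ⟨σ, a⟩ ha ⟨τ, b⟩ hb hab
      simp only [Finset.coe_product, Set.mem_prod, Finset.mem_coe, Finset.mem_filter] at ha hb
      have hab' : a ∘ σ = b ∘ τ := hab
      have e : a = b := by
        refine (StrictMono.range_inj ha.2.2 hb.2.2).1 ?_
        rw [← σ.surjective.range_comp a, hab', τ.surjective.range_comp b]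
      subst e
      refine Prod.ext (Equiv.ext fun i => ha.2.2.injective (congrFun hab' i)) rfl
    · rintro ⟨σ, a⟩ ha
      simp only [Finset.coe_product, Set.mem_prod, Finset.mem_coe, Finset.mem_filter,
        Fintype.mem_piFinset] at ha ⊢
      exact fun i => ha.2.1 _
    · intro a ha hna
      refine hinj a fun hi => hna ⟨((Tuple.sort a)⁻¹, a ∘ Tuple.sort a), ?_, ?_⟩
      · simp only [Finset.coe_product, Set.mem_prod, Finset.mem_coe, Finset.mem_filter,
          Fintype.mem_piFinset, Finset.mem_univ, true_and] at ha ⊢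
        exact ⟨fun i => ha _, (Tuple.monotone_sort a).strictMono_of_injective
          (hi.comp (Equiv.injective _))⟩
      · funext i
        simp
    · rintro ⟨σ, a⟩ _
      exact (hsymm σ a).symm
  rw [← h, Finset.sum_product]
  simp [Fintype.card_perm]

/-- The de Bruijn sum, a multiple of the Pfaffian of the antisymmetric part of `B`. -/
def pfSum {m : ℕ} (B : Fin m ⊕ Fin m → Fin m ⊕ Fin m → ℝ) : ℝ :=
  ∑ σ : Equiv.Perm (Fin m ⊕ Fin m), ((Equiv.Perm.sign σ : ℤ) : ℝ) *
    ∏ k : Fin m, B (σ (Sum.inl k)) (σ (Sum.inr k))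

/-- De Bruijn's integration formula for finite sums. -/
lemma sum_det_eq_pfSum {m : ℕ} (s : Finset ℕ) (f₀ f₁ : ℕ → Fin m ⊕ Fin m → ℝ) :
    ∑ a ∈ Fintype.piFinset fun _ : Fin m => s,
      Matrix.det (Matrix.of fun r p : Fin m ⊕ Fin m =>
        Sum.elim (fun k => f₀ (a k) p) (fun k => f₁ (a k) p) r) =
      pfSum fun p q => ∑ x ∈ s, f₀ x p * f₁ x q := by
  have h : ∀ a : Fin m → ℕ, Matrix.det (Matrix.of fun r p : Fin m ⊕ Fin m =>
        Sum.elim (fun k => f₀ (a k) p) (fun k => f₁ (a k) p) r) =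
      ∑ σ : Equiv.Perm (Fin m ⊕ Fin m), ((Equiv.Perm.sign σ : ℤ) : ℝ) *
        ∏ k : Fin m, f₀ (a k) (σ (Sum.inl k)) * f₁ (a k) (σ (Sum.inr k)) := by
    intro a
    rw [← Matrix.det_transpose, Matrix.det_apply']
    refine Finset.sum_congr rfl fun σ _ => ?_
    rw [Fintype.prod_sum_type, Finset.prod_mul_distrib]
    rfl
  simp_rw [h]
  rw [Finset.sum_comm, pfSum]
  refine Finset.sum_congr rfl fun σ _ => ?_
  rw [← Finset.mul_sum, Finset.prod_univ_sum]

lemma pfSum_slot_zero {m : ℕ} (k : Fin m) (D : Fin m ⊕ Fin m → Fin m ⊕ Fin m → ℝ)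
    (hD : ∀ p q, D p q = D q p) (R : Fin m → Fin m ⊕ Fin m → Fin m ⊕ Fin m → ℝ) :
    ∑ σ : Equiv.Perm (Fin m ⊕ Fin m), ((Equiv.Perm.sign σ : ℤ) : ℝ) *
      (D (σ (Sum.inl k)) (σ (Sum.inr k)) *
        ∏ j ∈ Finset.univ.erase k, R j (σ (Sum.inl j)) (σ (Sum.inr j))) = 0 := by
  set S := ∑ σ : Equiv.Perm (Fin m ⊕ Fin m), ((Equiv.Perm.sign σ : ℤ) : ℝ) *
      (D (σ (Sum.inl k)) (σ (Sum.inr k)) *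
        ∏ j ∈ Finset.univ.erase k, R j (σ (Sum.inl j)) (σ (Sum.inr j))) with hS
  have h : S = -S := by
    conv_lhs => rw [hS, ← Equiv.sum_comp (Equiv.mulRight
      (Equiv.swap (Sum.inl k) (Sum.inr k) : Equiv.Perm (Fin m ⊕ Fin m)))]
    rw [hS, ← Finset.sum_neg_distrib]
    refine Finset.sum_congr rfl fun σ _ => ?_
    simp only [Equiv.coe_mulRight, Equiv.Perm.sign_mul, Equiv.Perm.coe_mul, Function.comp_apply,
      Equiv.swap_apply_left, Equiv.swap_apply_right]
    rw [Equiv.Perm.sign_swap (by simp), hD]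
    have e : ∏ j ∈ Finset.univ.erase k,
        R j (σ (Equiv.swap (Sum.inl k) (Sum.inr k) (Sum.inl j)))
          (σ (Equiv.swap (Sum.inl k) (Sum.inr k) (Sum.inr j))) =
        ∏ j ∈ Finset.univ.erase k, R j (σ (Sum.inl j)) (σ (Sum.inr j)) := by
      refine Finset.prod_congr rfl fun j hj => ?_
      have hjk : j ≠ k := (Finset.mem_erase.1 hj).1
      rw [Equiv.swap_apply_of_ne_of_ne (by simpa using hjk) (by simp),
        Equiv.swap_apply_of_ne_of_ne (by simp) (by simpa using hjk)]
    rw [e]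
    push_cast
    ring
  linarith

/-- `pfSum` depends only on the antisymmetric part. -/
lemma pfSum_congr {m : ℕ} {B B' : Fin m ⊕ Fin m → Fin m ⊕ Fin m → ℝ}
    (h : ∀ p q, B p q - B' p q = B q p - B' q p) : pfSum B = pfSum B' := by
  have key : ∀ T : Finset (Fin m), ∑ σ : Equiv.Perm (Fin m ⊕ Fin m),
      ((Equiv.Perm.sign σ : ℤ) : ℝ) * ∏ k : Fin m,
        (if k ∈ T then B' else B) (σ (Sum.inl k)) (σ (Sum.inr k)) = pfSum B := by
    intro T
    induction T using Finset.induction_on with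
    | empty => simp [pfSum]
    | insert k T hk ih =>
      rw [← ih, ← sub_eq_zero, ← Finset.sum_sub_distrib,
        ← pfSum_slot_zero k (fun p q => B' p q - B p q) (fun p q => by linarith [h p q])
          (fun j => if j ∈ T then B' else B)]
      refine Finset.sum_congr rfl fun σ _ => ?_
      rw [← Finset.mul_prod_erase _ _ (Finset.mem_univ k),
        ← Finset.mul_prod_erase Finset.univ (fun j => (if j ∈ T then B' else B) (σ (Sum.inl j))
          (σ (Sum.inr j))) (Finset.mem_univ k)]
      have e : ∏ j ∈ Finset.univ.erase k,
          (if j ∈ insert k T then B' else B) (σ (Sum.inl j)) (σ (Sum.inr j)) =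
          ∏ j ∈ Finset.univ.erase k, (if j ∈ T then B' else B) (σ (Sum.inl j))
            (σ (Sum.inr j)) := by
        refine Finset.prod_congr rfl fun j hj => ?_
        simp [(Finset.mem_erase.1 hj).1]
      rw [e]
      simp only [Finset.mem_insert_self, if_true, hk, if_false]
      ring
  rw [← key Finset.univ]
  simp [pfSum]

lemma pfSum_of_block {m : ℕ} {B : Fin m ⊕ Fin m → Fin m ⊕ Fin m → ℝ}
    (h : ∀ j q, B (Sum.inr j) q = 0) :
    pfSum B = m.factorial *
      Matrix.det (Matrix.of fun i j => B (Sum.inl i) (Sum.inr j)) := by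
  set C : Matrix (Fin m) (Fin m) ℝ := Matrix.of fun i j => B (Sum.inl i) (Sum.inr j) with hC
  have h1 : pfSum B = ∑ p : Equiv.Perm (Fin m) × Equiv.Perm (Fin m),
      ((Equiv.Perm.sign p.1 : ℤ) : ℝ) * ((Equiv.Perm.sign p.2 : ℤ) : ℝ) *
        ∏ k, C (p.1 k) (p.2 k) := by
    symm
    refine Finset.sum_of_injOn (fun p => Equiv.sumCongr p.1 p.2) ?_ (by simp) ?_ ?_
    · intro p _ q _ hpq
      have hpq' : Equiv.sumCongr p.1 p.2 = Equiv.sumCongr q.1 q.2 := hpq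
      refine Prod.ext (Equiv.ext fun i => ?_) (Equiv.ext fun i => ?_)
      · simpa using DFunLike.congr_fun hpq' (Sum.inl i)
      · simpa using DFunLike.congr_fun hpq' (Sum.inr i)
    · intro σ _ hσ
      by_cases hm : Set.MapsTo σ (Set.range Sum.inl) (Set.range Sum.inl)
      · exfalso
        obtain ⟨p, hp⟩ := Equiv.Perm.mem_sumCongrHom_range_of_perm_mapsTo_inl hm
        exact hσ ⟨p, by simp, by simpa using hp⟩
      · rw [Set.MapsTo] at hm
        push Not at hm
        obtain ⟨_, ⟨k, rfl⟩, hk⟩ := hm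
        refine mul_eq_zero_of_right _ (Finset.prod_eq_zero (Finset.mem_univ k) ?_)
        rcases hx : σ (Sum.inl k) with x | x
        · exact absurd ⟨x, hx.symm⟩ hk
        · exact h x _
    · intro p _
      simp [hC]
  rw [h1, Fintype.sum_prod_type, Finset.sum_comm]
  have h2 : ∀ ρ : Equiv.Perm (Fin m), ∑ τ : Equiv.Perm (Fin m),
      ((Equiv.Perm.sign τ : ℤ) : ℝ) * ((Equiv.Perm.sign ρ : ℤ) : ℝ) * ∏ k, C (τ k) (ρ k) =
      C.det := by
    intro ρ
    have h3 := Matrix.det_permute' ρ C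
    have hs : ((Equiv.Perm.sign ρ : ℤ) : ℝ) * ((Equiv.Perm.sign ρ : ℤ) : ℝ) = 1 := by
      rw [← Int.cast_mul, ← Units.val_mul, Int.units_mul_self]
      simp
    rw [Matrix.det_apply'] at h3
    simp only [Matrix.submatrix_apply, id] at h3
    calc _ = ((Equiv.Perm.sign ρ : ℤ) : ℝ) * ∑ τ : Equiv.Perm (Fin m),
        ((Equiv.Perm.sign τ : ℤ) : ℝ) * ∏ k, C (τ k) (ρ k) := by
          rw [Finset.mul_sum]
          exact Finset.sum_congr rfl fun τ _ => by ring
      _ = _ := by rw [h3, ← mul_assoc, hs, one_mul]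
  simp_rw [h2]
  simp [Fintype.card_perm]

/-- Row labels of the dimer determinant. -/
def rowPos {m : ℕ} (a : Fin m → ℕ) : Fin m ⊕ Fin m → ℤ :=
  Sum.elim (fun k => (a k : ℤ)) fun k => (a k : ℤ) + 1

/-- Column labels of the dimer determinant. -/
def colPos (m : ℕ) : Fin m ⊕ Fin m → ℤ :=
  Sum.elim (fun i => (m : ℤ) + (i : ℕ)) fun i => (m : ℤ) - 1 - (i : ℕ)

/-- The Jacobi-Trudi matrix of a dimer configuration, rows grouped in pairs. -/
def dimerMat (t : ℝ) (N : ℕ) {m : ℕ} (a : Fin m → ℕ) : Matrix (Fin m ⊕ Fin m) (Fin m ⊕ Fin m) ℝ :=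
  Matrix.of fun r p => hCoef t N (rowPos a r - colPos m p)

/-- Rows `2k` and `2k+1`. -/
def rowEquiv (m : ℕ) : Fin m ⊕ Fin m ≃ Fin (m * 2) :=
  Equiv.ofBijective (Sum.elim lo hi) (by
    constructor
    · rintro (i | i) (j | j) h <;> simp [lo, hi, Fin.ext_iff] at h ⊢ <;> omega
    · intro i
      obtain ⟨k, h | h⟩ := eq_lo_or_hi i
      · exact ⟨Sum.inl k, h.symm⟩
      · exact ⟨Sum.inr k, h.symm⟩)

/-- Columns `m+i` and `m-1-i`. -/
def colEquiv (m : ℕ) : Fin m ⊕ Fin m ≃ Fin (m * 2) :=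
  Equiv.ofBijective (Sum.elim (fun i => ⟨m + i, by omega⟩) fun i => ⟨m - 1 - i, by omega⟩) (by
    constructor
    · rintro (i | i) (j | j) h <;> simp [Fin.ext_iff] at h ⊢ <;> omega
    · intro i
      by_cases h : (i : ℕ) < m
      · exact ⟨Sum.inr ⟨m - 1 - i, by omega⟩, by simp [Fin.ext_iff]; omega⟩
      · exact ⟨Sum.inl ⟨i - m, by omega⟩, by simp [Fin.ext_iff]; omega⟩)

lemma det_dimerMat_eq (t : ℝ) (N m : ℕ) : ∃ ε : ℤˣ, ∀ α : Fin (m * 2) → ℕ,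
    (∀ k, α (hi k) = α (lo k) + 1) →
      jtDet t N α = ((ε : ℤ) : ℝ) * (dimerMat t N (α ∘ lo)).det := by
  refine ⟨Equiv.Perm.sign ((rowEquiv m).trans (colEquiv m).symm), fun α hα => ?_⟩
  have h := Matrix.det_permute' ((rowEquiv m).trans (colEquiv m).symm) (dimerMat t N (α ∘ lo))
  rw [← h, jtDet, ← Matrix.det_submatrix_equiv_self (rowEquiv m)]
  congr 1
  ext r p
  simp only [Matrix.submatrix_apply, Matrix.of_apply, dimerMat, id, Equiv.trans_apply]
  congr 1
  have h1 : ((α (rowEquiv m r) : ℕ) : ℤ) = rowPos (α ∘ lo) r := by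
    rcases r with k | k
    · rfl
    · change ((α (hi k) : ℕ) : ℤ) = _
      rw [hα]
      simp [rowPos]
  have h2 : ∀ q, ((colEquiv m q : ℕ) : ℤ) = colPos m q := by
    rintro (i | i)
    · change ((m + (i : ℕ) : ℕ) : ℤ) = (m : ℤ) + (i : ℕ)
      omega
    · change ((m - 1 - (i : ℕ) : ℕ) : ℤ) = (m : ℤ) - 1 - (i : ℕ)
      omega
  rw [h1, ← h2, Equiv.apply_symm_apply]

lemma det_dimerMat_comp (t : ℝ) (N : ℕ) {m : ℕ} (σ : Equiv.Perm (Fin m)) (a : Fin m → ℕ) :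
    (dimerMat t N (a ∘ σ)).det = (dimerMat t N a).det := by
  have h := Matrix.det_permute (Equiv.sumCongr σ σ) (dimerMat t N a)
  rw [show Equiv.sumCongr σ σ = Equiv.Perm.sumCongr σ σ from rfl,
    Equiv.Perm.sign_sumCongr, Int.units_mul_self] at h
  simp only [Units.val_one, Int.cast_one, one_mul] at h
  rw [← h]
  congr 1
  ext r p
  rcases r with k | k <;> simp [dimerMat, rowPos]

lemma det_dimerMat_of_rowPos_eq (t : ℝ) (N : ℕ) {m : ℕ} {a : Fin m → ℕ} {r s : Fin m ⊕ Fin m}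
    (h : r ≠ s) (h' : rowPos a r = rowPos a s) : (dimerMat t N a).det = 0 :=
  Matrix.det_zero_of_row_eq h (by funext p; simp [dimerMat, h'])

lemma det_dimerMat_of_not_injective (t : ℝ) (N : ℕ) {m : ℕ} {a : Fin m → ℕ}
    (ha : ¬ Function.Injective a) : (dimerMat t N a).det = 0 := by
  simp only [Function.Injective, not_forall] at ha
  obtain ⟨i, j, h, hij⟩ := ha
  exact det_dimerMat_of_rowPos_eq t N (r := Sum.inl i) (s := Sum.inl j) (by simpa using hij)
    (by simp [rowPos, h])

lemma dimerSum_succ_eq (t : ℝ) (N m K : ℕ) {ε : ℤˣ}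
    (hε : ∀ α : Fin (m * 2) → ℕ, (∀ k, α (hi k) = α (lo k) + 1) →
      jtDet t N α = ((ε : ℤ) : ℝ) * (dimerMat t N (α ∘ lo)).det) :
    dimerSum t N m (K + 1) = ((ε : ℤ) : ℝ) *
      ∑ a ∈ (Fintype.piFinset fun _ : Fin m => Finset.range K).filter StrictMono,
        (dimerMat t N a).det := by
  rw [Finset.mul_sum, dimerSum]
  refine Finset.sum_of_injOn (fun α => α ∘ lo) ?_ ?_ ?_ ?_
  · intro α hα γ hγ h
    rw [Finset.mem_coe, mem_dimers] at hα hγ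
    funext i
    have h' : ∀ k, α (lo k) = γ (lo k) := fun k => congrFun h k
    obtain ⟨k, rfl | rfl⟩ := eq_lo_or_hi i
    · exact h' k
    · rw [hα.2, hγ.2, h']
  · intro α hα
    rw [Finset.mem_coe, mem_dimers] at hα
    simp only [Finset.mem_coe, Finset.mem_filter, Fintype.mem_piFinset, Finset.mem_range]
    refine ⟨fun k => ?_, fun i j hij => hα.1.2 (Fin.lt_def.2 (by
      have := Fin.lt_def.1 hij
      simp only [lo]
      omega))⟩
    have h1 := hα.1.1 (hi k)
    have h2 := hα.2 k
    simp only [Function.comp_apply]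
    omega
  · intro a ha hna
    simp only [Finset.mem_filter, Fintype.mem_piFinset, Finset.mem_range] at ha
    refine mul_eq_zero_of_right _ ?_
    set α : Fin (m * 2) → ℕ := fun i => Sum.elim a (fun k => a k + 1) ((rowEquiv m).symm i)
      with hα
    have hlo : ∀ k, α (lo k) = a k := fun k => by
      rw [hα, show (lo k : Fin (m * 2)) = rowEquiv m (Sum.inl k) from rfl]
      simp
    have hhi : ∀ k, α (hi k) = a k + 1 := fun k => by
      rw [hα, show (hi k : Fin (m * 2)) = rowEquiv m (Sum.inr k) from rfl]
      simp
    by_cases hm : ∀ k k' : Fin m, (k : ℕ) + 1 = k' → a k + 1 < a k'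
    · refine absurd ⟨α, ?_, funext hlo⟩ hna
      rw [Finset.mem_coe, mem_dimers]
      refine ⟨⟨forall_pairs fun k => ?_, strictMono_pairs (fun k => ?_) fun k k' h => ?_⟩,
        fun k => ?_⟩
      · rw [hlo, hhi]
        have := ha.1 k
        omega
      · rw [hlo, hhi]
        omega
      · rw [hlo, hhi]
        exact hm k k' h
      · rw [hlo, hhi]
    · push Not at hm
      obtain ⟨k, k', hk, hle⟩ := hm
      have hlt := ha.2 (show k < k' by rw [Fin.lt_def]; omega)
      refine det_dimerMat_of_rowPos_eq t N (r := Sum.inr k) (s := Sum.inl k') (by simp) ?_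
      simp only [rowPos, Sum.elim_inl, Sum.elim_inr]
      omega
  · intro α hα
    rw [mem_dimers] at hα
    exact hε α hα.2

/-- The reduced columns of the dimer determinant. -/
def dimerCol (t : ℝ) (N m : ℕ) (x : ℕ) : Fin m ⊕ Fin m → ℝ :=
  Sum.elim (fun i => hCoef t N (x - ((m : ℤ) + (i : ℕ))))
    fun j => hCoef t N (x - ((m : ℤ) + (j : ℕ))) - hCoef t N (x - ((m : ℤ) - 1 - (j : ℕ)))

lemma det_dimerMat_reduce (t : ℝ) (N : ℕ) {m : ℕ} (a : Fin m → ℕ) :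
    Matrix.det (Matrix.of fun r p : Fin m ⊕ Fin m =>
        Sum.elim (fun k => dimerCol t N m (a k) p) (fun k => dimerCol t N m (a k + 1) p) r) =
      (dimerMat t N a).det * (-1) ^ m := by
  have h : (Matrix.fromBlocks 1 1 0 (-1) : Matrix (Fin m ⊕ Fin m) (Fin m ⊕ Fin m) ℝ).det =
      (-1) ^ m := by
    rw [Matrix.det_fromBlocks_zero₂₁, Matrix.det_one, Matrix.det_neg]
    simp
  rw [← h, ← Matrix.det_mul]
  congr 1
  ext r p
  rw [Matrix.mul_apply, Fintype.sum_sum_type]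
  rcases r with k | k <;> rcases p with i | i <;>
    simp [dimerMat, dimerCol, rowPos, colPos, Matrix.one_apply] <;> ring

lemma factorial_mul_dimerSum {t : ℝ} (ht : 0 ≤ t) (N m K : ℕ) :
    m.factorial * dimerSum t N m (K + 1) = |pfSum fun p q =>
      ∑ x ∈ Finset.range K, dimerCol t N m x p * dimerCol t N m (x + 1) q| := by
  obtain ⟨ε, hε⟩ := det_dimerMat_eq t N m
  have h0 : 0 ≤ dimerSum t N m (K + 1) :=
    Finset.sum_nonneg fun α hα => jtDet_nonneg ht N (mem_dimers.1 hα).1.2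
  have h1 : |((ε : ℤ) : ℝ)| = 1 := by
    rcases Int.units_eq_one_or ε with h | h <;> simp [h]
  rw [← abs_of_nonneg (mul_nonneg (Nat.cast_nonneg _) h0), dimerSum_succ_eq t N m K hε,
    mul_left_comm, ← sum_piFinset_eq_factorial_mul _ _ (det_dimerMat_comp t N)
      (fun a ha => det_dimerMat_of_not_injective t N ha), abs_mul, h1, one_mul,
    ← sum_det_eq_pfSum (Finset.range K) (dimerCol t N m) fun x => dimerCol t N m (x + 1)]
  simp_rw [det_dimerMat_reduce]
  rw [← Finset.sum_mul, abs_mul, abs_pow, abs_neg, abs_one, one_pow, mul_one]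

lemma hasSum_hCoef_int {t : ℝ} (ht : 0 ≤ t) (ht1 : t < 1) (N : ℕ) :
    HasSum (fun x : ℤ => hCoef t N x) (((1 - t) ^ N)⁻¹) := by
  have h := hasSum_hCoef (t := t) (b := 1) N (by simpa) (by simpa)
  simp only [one_pow, one_mul] at h
  refine (Function.Injective.hasSum_iff Nat.cast_injective fun x hx => ?_).1 h
  refine hCoef_neg t N (not_le.1 fun h0 => hx ⟨x.toNat, ?_⟩)
  simp [h0]

lemma hCoef_le {t : ℝ} (ht : 0 ≤ t) (ht1 : t < 1) (N : ℕ) (x : ℤ) :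
    hCoef t N x ≤ ((1 - t) ^ N)⁻¹ :=
  le_hasSum (hasSum_hCoef_int ht ht1 N) x fun y _ => hCoef_nonneg ht N y

lemma summable_hCoef_mul {t : ℝ} (ht : 0 ≤ t) (ht1 : t < 1) (N : ℕ) (j : ℤ) :
    Summable fun x : ℤ => hCoef t N x * hCoef t N (x + j) := by
  refine Summable.of_nonneg_of_le
    (fun x => mul_nonneg (hCoef_nonneg ht N _) (hCoef_nonneg ht N _))
    (fun x => mul_le_mul_of_nonneg_left (hCoef_le ht ht1 N (x + j)) (hCoef_nonneg ht N x))
    ((hasSum_hCoef_int ht ht1 N).summable.mul_right _)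

/-- The autocorrelation of the sequence `hCoef`. -/
def acf (t : ℝ) (N : ℕ) (j : ℤ) : ℝ := ∑' x : ℤ, hCoef t N x * hCoef t N (x + j)

lemma acf_neg (t : ℝ) (N : ℕ) (j : ℤ) : acf t N (-j) = acf t N j := by
  rw [acf, acf, ← (Equiv.addRight j).tsum_eq]
  refine tsum_congr fun x => ?_
  simp [mul_comm]

lemma hasSum_acf_nat {t : ℝ} (ht : 0 ≤ t) (ht1 : t < 1) (N : ℕ) {u : ℤ} (hu : 0 ≤ u) (v : ℤ) :
    HasSum (fun x : ℕ => hCoef t N (x - u) * hCoef t N (((x + 1 : ℕ) : ℤ) - v))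
      (acf t N (u + 1 - v)) := by
  have h := (summable_hCoef_mul ht ht1 N (u + 1 - v)).hasSum
  rw [← (Equiv.subRight u).hasSum_iff] at h
  have h2 := (Function.Injective.hasSum_iff (g := ((↑) : ℕ → ℤ)) Nat.cast_injective
    (f := (fun x : ℤ => hCoef t N x * hCoef t N (x + (u + 1 - v))) ∘ Equiv.subRight u)
    (a := acf t N (u + 1 - v)) fun x hx => ?_).2 h
  · convert h2 using 2 with x
    simp only [Function.comp_apply, Equiv.subRight_apply]
    congr 2
    push_cast
    ring
  · have hx0 : x < 0 := not_le.1 fun h0 => hx ⟨x.toNat, by simp [h0]⟩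
    simp only [Function.comp_apply, Equiv.subRight_apply]
    rw [hCoef_neg t N (by omega), zero_mul]

/-- The limiting pairing of the reduced columns. -/
def dimerPairing (A : ℤ → ℝ) {m : ℕ} : Fin m ⊕ Fin m → Fin m ⊕ Fin m → ℝ
  | Sum.inl i, Sum.inl j => A ((i : ℕ) - (j : ℕ) + 1)
  | Sum.inl i, Sum.inr j => A ((i : ℕ) - (j : ℕ) + 1) - A ((i : ℕ) + (j : ℕ) + 2)
  | Sum.inr i, Sum.inl j => A ((i : ℕ) - (j : ℕ) + 1) - A (-(i : ℕ) - (j : ℕ))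
  | Sum.inr i, Sum.inr j => A ((i : ℕ) - (j : ℕ) + 1) - A (-(i : ℕ) - (j : ℕ))
      - (A ((i : ℕ) + (j : ℕ) + 2) - A ((j : ℕ) - (i : ℕ) + 1))

lemma hasSum_dimerPairing {t : ℝ} (ht : 0 ≤ t) (ht1 : t < 1) (N : ℕ) {m : ℕ}
    (p q : Fin m ⊕ Fin m) :
    HasSum (fun x : ℕ => dimerCol t N m x p * dimerCol t N m (x + 1) q)
      (dimerPairing (acf t N) p q) := by
  have key : ∀ {u : ℤ}, 0 ≤ u → ∀ {v j : ℤ}, u + 1 - v = j →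
    HasSum (fun x : ℕ => hCoef t N (x - u) * hCoef t N (((x + 1 : ℕ) : ℤ) - v)) (acf t N j) := by
    intro u hu v j h
    rw [← h]
    exact hasSum_acf_nat ht ht1 N hu v
  rcases p with i | i <;> rcases q with j | j <;>
    simp only [dimerCol, dimerPairing, Sum.elim_inl, Sum.elim_inr, mul_sub, sub_mul]
  · exact key (by omega) (by ring)
  · exact (key (by omega) (by ring)).sub (key (by omega) (by ring))
  · exact (key (by omega) (by ring)).sub (key (by omega) (by ring))
  · exact ((key (by omega) (by ring)).sub (key (by omega) (by ring))).sub
      ((key (by omega) (by ring)).sub (key (by omega) (by ring)))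

/-- The matrix whose determinant counts dimer configurations. -/
def gMat (A : ℤ → ℝ) (m : ℕ) : Matrix (Fin m) (Fin m) ℝ :=
  Matrix.of fun i j => A ((i : ℕ) - (j : ℕ)) - A ((i : ℕ) + (j : ℕ) + 2)

lemma det_dimer_block {A : ℤ → ℝ} (hA : ∀ j, A (-j) = A j) (m : ℕ) :
    Matrix.det (Matrix.of fun i j : Fin m => A ((i : ℕ) - (j : ℕ) + 1) - A ((i : ℕ) - (j : ℕ) - 1)
      + A ((i : ℕ) + (j : ℕ)) - A ((i : ℕ) + (j : ℕ) + 2)) = (gMat A m).det := by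
  rcases m with _ | m
  · simp
  set D : Matrix (Fin (m + 1)) (Fin (m + 1)) ℝ := Matrix.of fun i j =>
    A ((i : ℕ) - (j : ℕ) + 1) - A ((i : ℕ) + (j : ℕ) + 1) + A ((i : ℕ) - (j : ℕ))
      - A ((i : ℕ) + (j : ℕ) + 2) with hD
  refine (Matrix.det_eq_of_forall_row_eq_smul_add_pred (A := D) (fun _ => 1) ?_ ?_).symm.trans ?_
  · intro j
    simp only [hD, Matrix.of_apply, Fin.val_zero, Nat.cast_zero]
    rw [← hA (0 - (j : ℕ) - 1), ← hA (0 - (j : ℕ))]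
    ring_nf
  · intro i j
    simp only [hD, Matrix.of_apply, Fin.val_succ, Fin.val_castSucc]
    push_cast
    ring_nf
  · refine (Matrix.det_eq_of_forall_col_eq_smul_add_pred (fun _ => -1) ?_ ?_).symm
    · intro i
      simp only [hD, gMat, Matrix.of_apply, Fin.val_zero, Nat.cast_zero]
      ring_nf
    · intro i j
      simp only [hD, gMat, Matrix.of_apply, Fin.val_succ, Fin.val_castSucc]
      push_cast
      ring_nf

lemma pfSum_dimerPairing {A : ℤ → ℝ} (hA : ∀ j, A (-j) = A j) (m : ℕ) :
    pfSum (dimerPairing A (m := m)) = m.factorial * (gMat A m).det := by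
  rw [← det_dimer_block hA]
  set B' : Fin m ⊕ Fin m → Fin m ⊕ Fin m → ℝ := fun p q => Sum.elim
    (fun i => Sum.elim (fun j : Fin m => dimerPairing A (Sum.inl i) (Sum.inl j))
      (fun j : Fin m => A ((i : ℕ) - (j : ℕ) + 1) - A ((i : ℕ) - (j : ℕ) - 1)
        + A ((i : ℕ) + (j : ℕ)) - A ((i : ℕ) + (j : ℕ) + 2)) q) (fun _ => 0) p with hB'
  rw [pfSum_congr (B' := B')]
  · rw [pfSum_of_block fun j q => by simp [hB']]
    rfl
  · rintro (i | i) (j | j) <;> simp only [hB', dimerPairing, Sum.elim_inl, Sum.elim_inr]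
    · simp
    · rw [← hA ((i : ℕ) - (j : ℕ) - 1), ← hA ((i : ℕ) + (j : ℕ))]
      ring_nf
    · rw [← hA ((j : ℕ) - (i : ℕ) - 1), ← hA ((j : ℕ) + (i : ℕ))]
      ring_nf
    · ring_nf

lemma tendsto_dimerSum {t : ℝ} (ht : 0 ≤ t) (ht1 : t < 1) (N m : ℕ) :
    Filter.Tendsto (fun K => dimerSum t N m (K + 1)) Filter.atTop
      (nhds |(gMat (acf t N) m).det|) := by
  have hm : (m.factorial : ℝ) ≠ 0 := by positivity
  have h : Filter.Tendsto (fun K => |pfSum fun p q => ∑ x ∈ Finset.range K,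
      dimerCol t N m x p * dimerCol t N m (x + 1) q|) Filter.atTop
      (nhds |pfSum (dimerPairing (acf t N) (m := m))|) := by
    refine Filter.Tendsto.abs (tendsto_finsetSum _ fun σ _ => Filter.Tendsto.const_mul _
      (tendsto_finsetProd _ fun k _ => ?_))
    exact (hasSum_dimerPairing ht ht1 N _ _).tendsto_sum_nat
  rw [pfSum_dimerPairing (acf_neg t N), abs_mul, abs_of_pos (by positivity)] at h
  simp_rw [← factorial_mul_dimerSum ht] at h
  have h2 := h.const_mul ((m.factorial : ℝ)⁻¹)
  simpa only [inv_mul_cancel_left₀ hm] using h2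

lemma dimerSum_le_abs_det {t : ℝ} (ht : 0 ≤ t) (ht1 : t < 1) (N m K : ℕ) :
    dimerSum t N m K ≤ |(gMat (acf t N) m).det| :=
  ge_of_tendsto (tendsto_dimerSum ht ht1 N m) (Filter.eventually_atTop.2
    ⟨K, fun _ hk => dimerSum_mono ht N m (by omega)⟩)

lemma one_le_abs_det {t : ℝ} (ht : 0 ≤ t) (ht1 : t < 1) (N m : ℕ) :
    1 ≤ |(gMat (acf t N) m).det| :=
  (one_le_dimerSum ht N m le_rfl).trans (dimerSum_le_abs_det ht ht1 N m _)

lemma abs_det_le {t : ℝ} (ht : 0 < t) (ht1 : t < 1) (N m : ℕ) :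
    |(gMat (acf t N) m).det| ≤ ((1 - t ^ 2) ^ (N * (N - 1) / 2))⁻¹ :=
  le_of_tendsto' (tendsto_dimerSum ht.le ht1 N m) fun _ => dimerSum_le ht ht1 N m _

/-- The `n × n` Toeplitz matrix with symbol coefficients `A`. -/
def toep (A : ℤ → ℝ) (n : ℕ) : Matrix (Fin n) (Fin n) ℝ :=
  Matrix.of fun i j => A ((i : ℕ) - (j : ℕ))

/-- The antisymmetric extension of `U` about the centre `m + 1`. -/
def antiExt (m : ℕ) (U : ℕ → ℝ) (k : ℕ) : ℝ :=
  if k ≤ m then -U (m - k) else if k = m + 1 then 0 else U (k - (m + 2))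

lemma sum_mul_antiExt (A : ℤ → ℝ) (m : ℕ) (U : ℕ → ℝ) (p : ℤ) :
    ∑ k ∈ Finset.range (2 * m + 3), A (p - k) * antiExt m U k =
      ∑ j ∈ Finset.range (m + 1), (A (p - (m + 2 + j)) - A (p - (m - j))) * U j := by
  have h0 : 2 * m + 3 = (m + 1) + 1 + (m + 1) := by ring
  rw [h0, Finset.sum_range_add, Finset.sum_range_succ, ← Finset.sum_range_reflect]
  have h1 : antiExt m U (m + 1) = 0 := by simp [antiExt]
  rw [h1, mul_zero, add_zero, ← Finset.sum_add_distrib]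
  refine Finset.sum_congr rfl fun j hj => ?_
  have hj' : j ≤ m := by simpa [Nat.lt_succ_iff] using hj
  have h2 : antiExt m U (m + 1 - 1 - j) = -U j := by
    rw [antiExt, if_pos (by omega)]
    congr 2
    omega
  have h3 : antiExt m U (m + 1 + 1 + j) = U j := by
    rw [antiExt, if_neg (by omega), if_neg (by omega)]
    congr 1
    omega
  have h4 : ((m + 1 - 1 - j : ℕ) : ℤ) = m - j := by omega
  rw [h2, h3, h4]
  push_cast
  ring_nf

lemma toep_mulVec_antiExt {A : ℤ → ℝ} (hA : ∀ j, A (-j) = A j) (m : ℕ) {U : ℕ → ℝ} {d : ℝ}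
    (hU : ∀ i ≤ m, ∑ j ∈ Finset.range (m + 1),
      (A ((i : ℤ) - j) - A ((i : ℤ) + j + 2)) * U j = if i = m then d else 0)
    (i : Fin (2 * m + 3)) :
    (toep A (2 * m + 3)).mulVec (fun k => antiExt m U k) i =
      (if (i : ℕ) = 2 * m + 2 then d else 0) - if (i : ℕ) = 0 then d else 0 := by
  have h0 : (toep A (2 * m + 3)).mulVec (fun k => antiExt m U k) i =
      ∑ k ∈ Finset.range (2 * m + 3), A ((i : ℕ) - k) * antiExt m U k := by
    rw [Finset.sum_range]
    rfl
  rw [h0, sum_mul_antiExt]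
  have hi := i.isLt
  rcases lt_trichotomy (i : ℕ) (m + 1) with h | h | h
  · have h1 := hU (m - i) (by omega)
    rw [if_neg (by omega), zero_sub]
    have h2 : (if (i : ℕ) = 0 then d else 0) = if m - (i : ℕ) = m then d else 0 := by
      congr 1
      simp only [eq_iff_iff]
      omega
    rw [h2, ← h1, ← Finset.sum_neg_distrib]
    refine Finset.sum_congr rfl fun j _ => ?_
    rw [← hA ((i : ℕ) - _), ← hA ((i : ℕ) - (m - (j : ℤ))), Nat.cast_sub (by omega)]
    ring_nf
  · rw [if_neg (by omega), if_neg (by omega), sub_zero]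
    refine Finset.sum_eq_zero fun j _ => ?_
    rw [h, ← hA (((m + 1 : ℕ) : ℤ) - _)]
    push_cast
    ring_nf
  · have h1 := hU (i - (m + 2)) (by omega)
    rw [if_neg (by omega : ¬ (i : ℕ) = 0), sub_zero]
    have h2 : (if (i : ℕ) = 2 * m + 2 then d else 0) = if (i : ℕ) - (m + 2) = m then d else 0 := by
      congr 1
      simp only [eq_iff_iff]
      omega
    rw [h2, ← h1]
    refine Finset.sum_congr rfl fun j _ => ?_
    rw [Nat.cast_sub (by omega)]
    push_cast
    ring_nf

lemma abs_det_gMat_mul_le {A : ℤ → ℝ} (hA : ∀ j, A (-j) = A j) (m : ℕ) {κ : ℝ}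
    (hd : (gMat A (m + 1)).det ≠ 0)
    (hpos : ∀ v : Fin (2 * m + 3) → ℝ, v ≠ 0 → 0 < v ⬝ᵥ (toep A (2 * m + 3)).mulVec v)
    (hlow : ∀ v : Fin (2 * m + 3) → ℝ,
      v (Fin.last _) ^ 2 * κ ≤ v ⬝ᵥ (toep A (2 * m + 3)).mulVec v)
    (hshift : 0 ≤ Matrix.det
      (Matrix.of fun i j : Fin (2 * m + 2) => A ((i : ℕ) + 1 - (j : ℕ)))) :
    |(gMat A m).det| * κ ≤ |(gMat A (m + 1)).det| := by
  set d := (gMat A (m + 1)).det with hd'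
  set T := toep A (2 * m + 3) with hT
  have hTsymm : T.transpose = T := by
    ext i j
    simp only [hT, toep, Matrix.transpose_apply, Matrix.of_apply]
    rw [← hA]
    ring_nf
  have hTdet : 0 < T.det := by
    refine (Matrix.PosDef.of_dotProduct_mulVec_pos ?_ fun x hx => ?_).det_pos
    · rw [Matrix.IsHermitian, Matrix.conjTranspose_eq_transpose_of_trivial, hTsymm]
    · simpa using hpos x hx
  -- the solution of `G u = d e`
  set u : Fin (m + 1) → ℝ := fun i => (gMat A (m + 1)).adjugate i (Fin.last m) with hu
  have hGu : ∀ i, ∑ j, gMat A (m + 1) i j * u j = if i = Fin.last m then d else 0 := by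
    intro i
    have := congrFun (congrFun (Matrix.mul_adjugate (gMat A (m + 1))) i) (Fin.last m)
    rw [Matrix.mul_apply] at this
    rw [this]
    simp [Matrix.one_apply, hd']
  have hul : u (Fin.last m) = (gMat A m).det := by
    rw [hu]
    simp only
    rw [Matrix.adjugate_fin_succ_eq_det_submatrix, ← two_mul, pow_mul]
    simp only [even_two, Even.neg_pow, one_pow, Fin.succAbove_last, one_mul]
    rfl
  set U : ℕ → ℝ := fun k => if h : k < m + 1 then u ⟨k, h⟩ else 0 with hU
  have hTu := toep_mulVec_antiExt hA m (U := U) (d := d) (fun i hi => by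
    have := hGu ⟨i, by omega⟩
    simp only [Fin.ext_iff, Fin.val_last] at this
    rw [← this, Finset.sum_range]
    refine Finset.sum_congr rfl fun j _ => ?_
    rw [gMat, Matrix.of_apply, hU]
    simp only
    rw [dif_pos j.isLt])
  set w : Fin (2 * m + 3) → ℝ := fun k => antiExt m U k with hw
  have hUm : U m = (gMat A m).det := by
    rw [← hul]
    simp [hU, Fin.last]
  have hwn : w (Fin.last _) = (gMat A m).det := by
    rw [← hUm]
    simp only [hw, Fin.val_last, antiExt]
    rw [if_neg (by omega), if_neg (by omega)]
    congr 1
    omega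
  have hw0 : w 0 = -(gMat A m).det := by
    simp [hw, antiExt, hUm]
  have hdot : ∀ x : Fin (2 * m + 3) → ℝ, x ⬝ᵥ T.mulVec w = d * (x (Fin.last _) - x 0) := by
    intro x
    have h1 : ∀ i, T.mulVec w i = d * ((if i = Fin.last _ then 1 else 0) - if i = 0 then 1 else 0) := by
      intro i
      rw [hTu]
      simp only [Fin.ext_iff, Fin.val_last, Fin.val_zero]
      split_ifs <;> ring
    simp only [dotProduct, h1]
    simp only [mul_sub, Finset.sum_sub_distrib, mul_ite, mul_one, mul_zero,
      Finset.sum_ite_eq', Finset.mem_univ, if_true]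
    ring
  -- the last column of the inverse Toeplitz matrix
  set v : Fin (2 * m + 3) → ℝ := fun i => T.det⁻¹ * T.adjugate i (Fin.last _) with hv
  have hTv : ∀ i, T.mulVec v i = if i = Fin.last _ then 1 else 0 := by
    intro i
    have h1 := congrFun (congrFun (Matrix.mul_adjugate T) i) (Fin.last _)
    rw [Matrix.mul_apply] at h1
    have h2 : ∑ j, T i j * T.adjugate j (Fin.last _) = if i = Fin.last _ then T.det else 0 := by
      rw [h1]
      simp [Matrix.one_apply]
    change ∑ j, T i j * (T.det⁻¹ * T.adjugate j (Fin.last _)) = _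
    rw [Finset.sum_congr rfl fun j _ => mul_left_comm (T i j) T.det⁻¹ _]
    rw [← Finset.mul_sum, h2, mul_ite, inv_mul_cancel₀ hTdet.ne', mul_zero]
  have hdotv : ∀ x : Fin (2 * m + 3) → ℝ, x ⬝ᵥ T.mulVec v = x (Fin.last _) := by
    intro x
    simp [dotProduct, hTv]
  have hv0 : 0 ≤ v 0 := by
    simp only [hv]
    refine mul_nonneg (inv_nonneg.2 hTdet.le) ?_
    rw [Matrix.adjugate_fin_succ_eq_det_submatrix, Fin.succAbove_last, Fin.succAbove_zero,
      Even.neg_one_pow (by simp [parity_simps]), one_mul, ← Matrix.det_transpose]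
    have h1 : (T.submatrix Fin.castSucc Fin.succ).transpose =
        Matrix.of fun i j : Fin (2 * m + 2) => A ((i : ℕ) + 1 - (j : ℕ)) := by
      ext i j
      change A (((j.castSucc : Fin (2 * m + 3)) : ℕ) - ((i.succ : Fin (2 * m + 3)) : ℕ)) =
        A ((i : ℕ) + 1 - (j : ℕ))
      rw [← hA, Fin.val_castSucc, Fin.val_succ]
      push_cast
      ring_nf
    rw [h1]
    exact hshift
  have hvn : v (Fin.last _) * κ ≤ 1 := by
    have h1 := hlow v
    rw [hdotv] at h1
    have h2 : 0 ≤ v (Fin.last _) := by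
      rw [← hdotv v]
      rcases eq_or_ne v 0 with h | h
      · rw [h]; simp
      · exact (hpos v h).le
    rcases h2.eq_or_lt with h | h
    · rw [← h]; simp
    · nlinarith
  have hsw : v ⬝ᵥ T.mulVec w = w ⬝ᵥ T.mulVec v := by
    rw [Matrix.dotProduct_mulVec, ← Matrix.mulVec_transpose, hTsymm, dotProduct_comm]
  rw [hdot, hdotv, hwn] at hsw
  have hww : 0 ≤ w ⬝ᵥ T.mulVec w := by
    rcases eq_or_ne w 0 with h | h
    · rw [h]; simp
    · exact (hpos w h).le
  rw [hdot, hwn, hw0, ← hsw] at hww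
  have hdd : 0 < d * d := mul_self_pos.2 hd
  have h5 : 0 ≤ v (Fin.last _) - v 0 := by
    by_contra hneg
    nlinarith
  rw [← hsw, abs_mul, abs_of_nonneg h5, mul_assoc]
  have h6 : (v (Fin.last _) - v 0) * κ ≤ 1 := by
    rcases le_or_gt 0 κ with hκ | hκ
    · nlinarith
    · nlinarith [mul_nonneg_of_nonpos_of_nonpos (neg_nonpos.2 h5) hκ.le]
  exact (mul_le_mul_of_nonneg_left h6 (abs_nonneg d)).trans_eq (mul_one _)

/-- Andréief's identity for finite sums. -/
lemma sum_det_mul_det {n : ℕ} (s : Finset ℕ) (f g : ℕ → Fin n → ℝ) :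
    ∑ a ∈ Fintype.piFinset fun _ : Fin n => s,
      Matrix.det (Matrix.of fun k i => f (a k) i) * Matrix.det (Matrix.of fun k j => g (a k) j) =
      n.factorial * Matrix.det (Matrix.of fun i j => ∑ x ∈ s, f x i * g x j) := by
  have h1 : Matrix.det (Matrix.of fun i j => ∑ x ∈ s, f x i * g x j) =
      ∑ a ∈ Fintype.piFinset fun _ : Fin n => s,
        (∏ i, f (a i) i) * Matrix.det (Matrix.of fun k j => g (a k) j) :=
    det_sum_rows (fun _ => s) (fun i x => f x i) fun _ x j => g x j
  have h2 : ∀ σ : Equiv.Perm (Fin n), ∑ a ∈ Fintype.piFinset fun _ : Fin n => s,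
        (∏ i, f (a i) i) * Matrix.det (Matrix.of fun k j => g (a k) j) =
      ∑ a ∈ Fintype.piFinset fun _ : Fin n => s, ((Equiv.Perm.sign σ : ℤ) : ℝ) *
        (∏ i, f (a (σ i)) i) * Matrix.det (Matrix.of fun k j => g (a k) j) := by
    intro σ
    symm
    refine Finset.sum_bij' (fun a _ => a ∘ σ) (fun a _ => a ∘ σ.symm) ?_ ?_ ?_ ?_ ?_
    · simpa using fun a ha i => ha (σ i)
    · simpa using fun a ha i => ha (σ.symm i)
    · intro a _
      funext i
      simp
    · intro a _
      funext i
      simp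
    · intro a _
      have h3 := Matrix.det_permute σ (Matrix.of fun k j => g (a k) j)
      rw [show (Matrix.of fun k j => g ((a ∘ σ) k) j) =
        (Matrix.of fun k j => g (a k) j).submatrix σ id from rfl, h3]
      simp only [Function.comp_apply]
      ring
  have h4 : (n.factorial : ℝ) * Matrix.det (Matrix.of fun i j => ∑ x ∈ s, f x i * g x j) =
      ∑ σ : Equiv.Perm (Fin n), ∑ a ∈ Fintype.piFinset fun _ : Fin n => s,
        ((Equiv.Perm.sign σ : ℤ) : ℝ) *
        (∏ i, f (a (σ i)) i) * Matrix.det (Matrix.of fun k j => g (a k) j) := by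
    rw [← Finset.sum_congr rfl fun σ _ => h2 σ, ← h1]
    simp [Fintype.card_perm]
  rw [h4, Finset.sum_comm]
  refine Finset.sum_congr rfl fun a _ => ?_
  rw [← Finset.sum_mul, Matrix.det_apply']
  rfl

lemma det_acf_shift_nonneg {t : ℝ} (ht : 0 ≤ t) (ht1 : t < 1) (N n : ℕ) :
    0 ≤ Matrix.det (Matrix.of fun i j : Fin n => acf t N ((i : ℕ) + 1 - (j : ℕ))) := by
  have h : Filter.Tendsto (fun K => Matrix.det (Matrix.of fun i j : Fin n =>
      ∑ x ∈ Finset.range K, hCoef t N (x - (i : ℕ)) * hCoef t N (((x + 1 : ℕ) : ℤ) - (j : ℕ))))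
      Filter.atTop (nhds (Matrix.det (Matrix.of fun i j : Fin n =>
        acf t N ((i : ℕ) + 1 - (j : ℕ))))) := by
    simp only [Matrix.det_apply']
    refine tendsto_finsetSum _ fun σ _ => Filter.Tendsto.const_mul _
      (tendsto_finsetProd _ fun k _ => ?_)
    exact (hasSum_acf_nat ht ht1 N (by positivity) _).tendsto_sum_nat
  refine ge_of_tendsto' h fun K => ?_
  have hn : (0 : ℝ) < n.factorial := by positivity
  refine nonneg_of_mul_nonneg_right ?_ hn
  rw [← sum_det_mul_det (Finset.range K) (fun x i => hCoef t N (x - (i : ℕ)))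
    fun x j => hCoef t N (((x + 1 : ℕ) : ℤ) - (j : ℕ)), sum_piFinset_eq_factorial_mul]
  · refine mul_nonneg hn.le (Finset.sum_nonneg fun a ha => ?_)
    have ha' := (Finset.mem_filter.1 ha).2
    exact mul_nonneg (jtDet_nonneg ht N ha')
      (jtDet_nonneg (α := fun k => a k + 1) ht N fun i j hij => Nat.succ_lt_succ (ha' hij))
  · intro σ a
    have h1 := Matrix.det_permute σ (Matrix.of fun k (i : Fin n) => hCoef t N (a k - (i : ℕ)))
    have h2 := Matrix.det_permute σ
      (Matrix.of fun k (i : Fin n) => hCoef t N (((a k + 1 : ℕ) : ℤ) - (i : ℕ)))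
    have hs : ((Equiv.Perm.sign σ : ℤ) : ℝ) * ((Equiv.Perm.sign σ : ℤ) : ℝ) = 1 := by
      rw [← Int.cast_mul, ← Units.val_mul, Int.units_mul_self]
      simp
    refine (congrArg₂ (· * ·) h1 h2).trans ?_
    rw [mul_mul_mul_comm, hs, one_mul]
  · intro a ha
    simp only [Function.Injective, not_forall] at ha
    obtain ⟨i, j, h, hij⟩ := ha
    rw [Matrix.det_zero_of_row_eq hij (by funext p; simp [h]), zero_mul]

lemma hasSum_hCoef_exp {t : ℝ} (ht : 0 ≤ t) (ht1 : t < 1) (N : ℕ) {z : ℂ} (hz : ‖z‖ = 1) :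
    HasSum (fun x : ℤ => (hCoef t N x : ℂ) * z ^ x) (((1 - t * z) ^ N)⁻¹) := by
  have hz0 : z ≠ 0 := by
    rintro rfl
    simp at hz
  have hn : ‖(t : ℂ) * z‖ < 1 := by
    rwa [norm_mul, hz, mul_one, Complex.norm_real, Real.norm_of_nonneg ht]
  have key : HasSum (fun k : ℕ => (hCoef t N k : ℂ) * z ^ k) (((1 - t * z) ^ N)⁻¹) := by
    cases N with
    | zero =>
      have : ∀ k : ℕ, k ≠ 0 → (hCoef t 0 k : ℂ) * z ^ k = 0 := by
        intro k hk
        rw [hCoef_zero_left, if_neg (by exact_mod_cast hk)]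
        simp
      convert hasSum_single 0 this using 1
      simp [hCoef_zero_left]
    | succ M =>
      have h := (summable_choose_mul_geometric_of_norm_lt_one M hn).hasSum
      rw [tsum_choose_mul_geometric_of_norm_lt_one M hn] at h
      have e : (fun k : ℕ => (hCoef t (M + 1) k : ℂ) * z ^ k) =
          fun k : ℕ => ((k + M).choose M : ℂ) * (t * z) ^ k := by
        funext k
        rw [hCoef_natCast, Nat.multichoose_eq, mul_pow, show M + 1 + k - 1 = k + M by omega,
          Nat.choose_symm_add]
        push_cast
        ring
      rw [e, ← one_div]
      exact h
  refine (Function.Injective.hasSum_iff (g := ((↑) : ℕ → ℤ)) Nat.cast_injective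
    fun x hx => ?_).1 ?_
  · rw [hCoef_neg t N (not_le.1 fun h0 => hx ⟨x.toNat, by simp [h0]⟩)]
    simp
  · simpa [Function.comp_def] using key

lemma integral_exp_int (k : ℤ) :
    ∫ θ in (-Real.pi)..Real.pi, Complex.exp (θ * Complex.I) ^ k =
      if k = 0 then (2 * Real.pi : ℂ) else 0 := by
  split_ifs with h
  · subst h
    simp
    ring
  · have hc : (k : ℂ) * Complex.I ≠ 0 := by simp [h]
    have e : ∀ θ : ℝ, Complex.exp (θ * Complex.I) ^ k = Complex.exp (k * Complex.I * θ) := by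
      intro θ
      rw [← Complex.exp_int_mul]
      ring_nf
    simp_rw [e]
    rw [integral_exp_mul_complex hc, div_eq_zero_iff]
    left
    rw [sub_eq_zero, Complex.exp_eq_exp_iff_exists_int]
    refine ⟨k, ?_⟩
    push_cast
    ring

lemma hasSum_hCoef_mul_zpow {t : ℝ} (ht : 0 ≤ t) (ht1 : t < 1) (N : ℕ) (j : ℤ) {z : ℂ}
    (hz1 : ‖z‖ = 1) :
    HasSum (fun p : ℤ × ℤ => ((hCoef t N p.1 * hCoef t N p.2 : ℝ) : ℂ) * z ^ (p.1 - p.2 + j))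
      (z ^ j * ((‖1 - t * z‖ ^ (2 * N))⁻¹ : ℝ)) := by
  have hs := hasSum_hCoef_int ht ht1 N
  have hz0 : z ≠ 0 := by
    rintro rfl
    simp at hz1
  have hz2 : ‖z⁻¹‖ = 1 := by rw [norm_inv, hz1, inv_one]
  have h0 : Summable fun p : ℤ × ℤ =>
      (hCoef t N p.1 : ℂ) * z ^ p.1 * ((hCoef t N p.2 : ℂ) * z⁻¹ ^ p.2) := by
    refine summable_mul_of_summable_norm (f := fun x : ℤ => (hCoef t N x : ℂ) * z ^ x)
      (g := fun x : ℤ => (hCoef t N x : ℂ) * z⁻¹ ^ x) ?_ ?_ <;>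
    · simp only [norm_mul, norm_zpow, hz1, hz2, one_zpow, mul_one, Complex.norm_real]
      exact hs.summable.norm
  have h3 := ((hasSum_hCoef_exp ht ht1 N hz1).mul (hasSum_hCoef_exp ht ht1 N hz2) h0).mul_left
    (z ^ j)
  have e1 : (fun p : ℤ × ℤ => ((hCoef t N p.1 * hCoef t N p.2 : ℝ) : ℂ) *
      z ^ (p.1 - p.2 + j)) = fun p : ℤ × ℤ =>
      z ^ j * ((hCoef t N p.1 : ℂ) * z ^ p.1 * ((hCoef t N p.2 : ℂ) * z⁻¹ ^ p.2)) := by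
    funext p
    rw [zpow_add₀ hz0, zpow_sub₀ hz0, inv_zpow]
    push_cast
    ring
  have h4 : 1 - (t : ℂ) * z⁻¹ = (starRingEnd ℂ) (1 - t * z) := by
    rw [map_sub, map_mul, map_one, Complex.conj_ofReal, Complex.inv_def,
      Complex.normSq_eq_norm_sq, hz1]
    simp
  have e2 : (((‖1 - t * z‖ ^ (2 * N))⁻¹ : ℝ) : ℂ) =
      ((1 - t * z) ^ N)⁻¹ * ((1 - t * z⁻¹) ^ N)⁻¹ := by
    rw [← mul_inv, ← mul_pow, h4, Complex.mul_conj, Complex.normSq_eq_norm_sq, pow_mul]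
    push_cast
    rfl
  rw [e1, e2]
  exact h3

lemma acf_eq_integral {t : ℝ} (ht : 0 ≤ t) (ht1 : t < 1) (N : ℕ) (j : ℤ) :
    ∫ θ in (-Real.pi)..Real.pi, Complex.exp (θ * Complex.I) ^ j *
      ((‖1 - t * Complex.exp (θ * Complex.I)‖ ^ (2 * N))⁻¹ : ℝ) = 2 * Real.pi * acf t N j := by
  have hs := hasSum_hCoef_int ht ht1 N
  have hsum : Summable fun p : ℤ × ℤ => hCoef t N p.1 * hCoef t N p.2 :=
    hs.summable.mul_of_nonneg hs.summable (hCoef_nonneg ht N) (hCoef_nonneg ht N)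
  have h1 : HasSum (fun p : ℤ × ℤ => ∫ θ in (-Real.pi)..Real.pi,
      ((hCoef t N p.1 * hCoef t N p.2 : ℝ) : ℂ) *
        Complex.exp (θ * Complex.I) ^ (p.1 - p.2 + j))
      (∫ θ in (-Real.pi)..Real.pi, Complex.exp (θ * Complex.I) ^ j *
      ((‖1 - t * Complex.exp (θ * Complex.I)‖ ^ (2 * N))⁻¹ : ℝ)) := by
    refine intervalIntegral.hasSum_integral_of_dominated_convergence
      (fun p _ => hCoef t N p.1 * hCoef t N p.2) ?_ ?_ ?_ ?_ ?_
    · intro p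
      refine Continuous.aestronglyMeasurable ?_
      refine continuous_const.mul (Continuous.zpow₀ (by fun_prop) _ fun θ => ?_)
      exact Or.inl (Complex.exp_ne_zero _)
    · intro p
      refine Filter.Eventually.of_forall fun θ _ => ?_
      rw [norm_mul, norm_zpow, Complex.norm_exp_ofReal_mul_I, one_zpow, mul_one,
        Complex.norm_real, Real.norm_of_nonneg
          (mul_nonneg (hCoef_nonneg ht N _) (hCoef_nonneg ht N _))]
    · exact Filter.Eventually.of_forall fun _ _ => hsum
    · simp
    · refine Filter.Eventually.of_forall fun θ _ => ?_
      exact hasSum_hCoef_mul_zpow ht ht1 N j (Complex.norm_exp_ofReal_mul_I θ)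
  simp_rw [intervalIntegral.integral_const_mul, integral_exp_int] at h1
  have h2 : HasSum (fun x : ℤ => 2 * Real.pi *
      ((hCoef t N x * hCoef t N (x + j) : ℝ) : ℂ)) (2 * Real.pi * acf t N j) := by
    exact (Complex.hasSum_ofReal.2 (summable_hCoef_mul ht ht1 N j).hasSum).mul_left _
  refine h1.unique ?_
  refine (Function.Injective.hasSum_iff (g := fun x : ℤ => (x, x + j)) ?_ ?_).1 ?_
  · intro x y h
    exact (Prod.ext_iff.1 h).1
  · rintro ⟨a, b⟩ hx
    rw [if_neg, mul_zero]
    intro h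
    refine hx ⟨a, ?_⟩
    simp only [Prod.mk.injEq, true_and] at h ⊢
    omega
  · have e3 : (fun x : ℤ => 2 * Real.pi *
        ((hCoef t N x * hCoef t N (x + j) : ℝ) : ℂ)) = (fun p : ℤ × ℤ =>
        ((hCoef t N p.1 * hCoef t N p.2 : ℝ) : ℂ) *
          if p.1 - p.2 + j = 0 then (2 * Real.pi : ℂ) else 0) ∘ fun x : ℤ => (x, x + j) := by
      funext x
      simp only [Function.comp_apply]
      rw [if_pos (by ring), mul_comm]
    rw [← e3]
    exact h2

lemma sum_mul_zpow_sub_eq_norm_sq {n : ℕ} (v : Fin n → ℝ) {z : ℂ} (hz : ‖z‖ = 1) :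
    ∑ i, ∑ j, ((v i * v j : ℝ) : ℂ) * z ^ (((i : ℕ) : ℤ) - ((j : ℕ) : ℤ)) =
      ((‖∑ i, (v i : ℂ) * z ^ (i : ℕ)‖ ^ 2 : ℝ) : ℂ) := by
  have hz0 : z ≠ 0 := by
    rintro rfl
    simp at hz
  have hc : (starRingEnd ℂ) z = z⁻¹ := by
    rw [Complex.inv_def, Complex.normSq_eq_norm_sq, hz]
    simp
  rw [← Complex.normSq_eq_norm_sq, ← Complex.mul_conj, map_sum, Finset.sum_mul_sum]
  refine Finset.sum_congr rfl fun i _ => Finset.sum_congr rfl fun j _ => ?_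
  rw [map_mul, map_pow, hc, Complex.conj_ofReal, zpow_sub₀ hz0, zpow_natCast, zpow_natCast,
    inv_pow]
  push_cast
  ring

lemma toep_acf_quadratic_form {t : ℝ} (ht : 0 ≤ t) (ht1 : t < 1) (N n : ℕ) (v : Fin n → ℝ) :
    ∫ θ in (-Real.pi)..Real.pi, ‖∑ i, (v i : ℂ) * Complex.exp (θ * Complex.I) ^ (i : ℕ)‖ ^ 2 *
      (‖1 - t * Complex.exp (θ * Complex.I)‖ ^ (2 * N))⁻¹ =
      2 * Real.pi * (v ⬝ᵥ (toep (acf t N) n).mulVec v) := by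
  have hne : ∀ θ : ℝ, ‖1 - t * Complex.exp (θ * Complex.I)‖ ^ (2 * N) ≠ 0 := by
    intro θ h
    have h1 := norm_eq_zero.1 (eq_zero_of_pow_eq_zero h)
    have h2 : ‖(t : ℂ) * Complex.exp (θ * Complex.I)‖ = 1 := by
      rw [← sub_eq_zero.1 h1, norm_one]
    rw [norm_mul, Complex.norm_exp_ofReal_mul_I, mul_one, Complex.norm_real,
      Real.norm_of_nonneg ht] at h2
    linarith
  have hcont : ∀ j : ℤ, Continuous fun θ : ℝ => Complex.exp (θ * Complex.I) ^ j *
      (((‖1 - t * Complex.exp (θ * Complex.I)‖ ^ (2 * N))⁻¹ : ℝ) : ℂ) := by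
    intro j
    refine (Continuous.zpow₀ (by fun_prop) _ fun θ => Or.inl (Complex.exp_ne_zero _)).mul
      (Complex.continuous_ofReal.comp (Continuous.inv₀ (by fun_prop) hne))
  have h : (∫ θ in (-Real.pi)..Real.pi,
      ((‖∑ i, (v i : ℂ) * Complex.exp (θ * Complex.I) ^ (i : ℕ)‖ ^ 2 *
      (‖1 - t * Complex.exp (θ * Complex.I)‖ ^ (2 * N))⁻¹ : ℝ) : ℂ)) =
      ((2 * Real.pi * (v ⬝ᵥ (toep (acf t N) n).mulVec v) : ℝ) : ℂ) := by
    have e : ∀ θ : ℝ, ((‖∑ i, (v i : ℂ) * Complex.exp (θ * Complex.I) ^ (i : ℕ)‖ ^ 2 *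
      (‖1 - t * Complex.exp (θ * Complex.I)‖ ^ (2 * N))⁻¹ : ℝ) : ℂ) =
        ∑ i, ∑ j, ((v i * v j : ℝ) : ℂ) *
          (Complex.exp (θ * Complex.I) ^ (((i : ℕ) : ℤ) - ((j : ℕ) : ℤ)) *
          (((‖1 - t * Complex.exp (θ * Complex.I)‖ ^ (2 * N))⁻¹ : ℝ) : ℂ)) := by
      intro θ
      rw [Complex.ofReal_mul,
        ← sum_mul_zpow_sub_eq_norm_sq v (Complex.norm_exp_ofReal_mul_I θ), Finset.sum_mul]
      refine Finset.sum_congr rfl fun i _ => ?_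
      rw [Finset.sum_mul]
      exact Finset.sum_congr rfl fun j _ => mul_assoc _ _ _
    simp_rw [e]
    rw [intervalIntegral.integral_finsetSum]
    · rw [dotProduct, Finset.mul_sum, Complex.ofReal_sum]
      refine Finset.sum_congr rfl fun i _ => ?_
      rw [intervalIntegral.integral_finsetSum]
      · rw [Matrix.mulVec, dotProduct, Finset.mul_sum, Finset.mul_sum, Complex.ofReal_sum]
        refine Finset.sum_congr rfl fun j _ => ?_
        rw [intervalIntegral.integral_const_mul, acf_eq_integral ht ht1, toep, Matrix.of_apply]
        push_cast
        ring
      · intro j _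
        exact (continuous_const.mul (hcont _)).intervalIntegrable _ _
    · intro i _
      exact (continuous_finsetSum _ fun j _ =>
        continuous_const.mul (hcont _)).intervalIntegrable _ _
  rw [intervalIntegral.integral_ofReal] at h
  exact_mod_cast h

/-- Off a countable set, `f` is on the unit circle the exponential of an integrable function
of mean `c`. -/
def HasLogMean (f : ℂ → ℝ) (c : ℝ) : Prop :=
  ∃ L : ℂ → ℝ, CircleIntegrable L 0 1 ∧ Real.circleAverage L 0 1 = c ∧
    ∃ S : Set ℂ, S.Countable ∧ ∀ z : ℂ, ‖z‖ = 1 → z ∉ S → Real.exp (L z) = f z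

lemma HasLogMean.congr {f g : ℂ → ℝ} {c : ℝ} (h : HasLogMean f c)
    (hfg : ∀ z : ℂ, ‖z‖ = 1 → f z = g z) : HasLogMean g c := by
  obtain ⟨L, h1, h2, S, h3, h4⟩ := h
  exact ⟨L, h1, h2, S, h3, fun z hz hS => (h4 z hz hS).trans (hfg z hz)⟩

lemma HasLogMean.mul {f g : ℂ → ℝ} {a b : ℝ} (hf : HasLogMean f a) (hg : HasLogMean g b) :
    HasLogMean (fun z => f z * g z) (a + b) := by
  obtain ⟨L, h1, h2, S, h3, h4⟩ := hf
  obtain ⟨L', h1', h2', S', h3', h4'⟩ := hg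
  refine ⟨fun z => L z + L' z, h1.add h1', ?_, S ∪ S', h3.union h3', fun z hz hS => ?_⟩
  · rw [Real.circleAverage_fun_add h1 h1', h2, h2']
  · rw [Real.exp_add, h4 z hz fun h => hS (Or.inl h), h4' z hz fun h => hS (Or.inr h)]

lemma HasLogMean.rpow {f : ℂ → ℝ} {a : ℝ} (hf : HasLogMean f a) (r : ℝ) :
    HasLogMean (fun z => f z ^ r) (r * a) := by
  obtain ⟨L, h1, h2, S, h3, h4⟩ := hf
  refine ⟨fun z => r • L z, h1.const_smul, ?_, S, h3, fun z hz hS => ?_⟩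
  · rw [Real.circleAverage_fun_smul, h2, smul_eq_mul]
  · change Real.exp (r * L z) = f z ^ r
    rw [← h4 z hz hS, ← Real.exp_mul, mul_comm]

lemma hasLogMean_const {a : ℝ} (ha : 0 < a) : HasLogMean (fun _ => a) (Real.log a) :=
  ⟨fun _ => Real.log a, circleIntegrable_const _ _ _, Real.circleAverage_const _ _ _, ∅,
    Set.countable_empty, fun _ _ _ => Real.exp_log ha⟩

lemma hasLogMean_multiset_prod {ι : Type*} {f : ι → ℂ → ℝ} {b : ℝ}
    (h : ∀ i, ∃ c, b ≤ c ∧ HasLogMean (f i) c) (s : Multiset ι) :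
    ∃ c, Multiset.card s * b ≤ c ∧ HasLogMean (fun z => (s.map fun i => f i z).prod) c := by
  induction s using Multiset.induction with
  | empty => exact ⟨0, by simp, by simpa using hasLogMean_const one_pos⟩
  | cons i s ih =>
    obtain ⟨c, hc, h1⟩ := ih
    obtain ⟨d, hd, h2⟩ := h i
    refine ⟨d + c, ?_, ?_⟩
    · rw [Multiset.card_cons]
      push_cast
      linarith
    · simpa using h2.mul h1

lemma hasLogMean_linear {p q : ℂ} (h : p ≠ 0 ∨ q ≠ 0) :
    HasLogMean (fun z => ‖p - q * z‖) (Real.log (max ‖p‖ ‖q‖)) := by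
  by_cases hq : q = 0
  · subst hq
    have hp : 0 < ‖p‖ := by simpa using h
    simpa [max_eq_left] using hasLogMean_const hp
  · have hq' : 0 < ‖q‖ := norm_pos_iff.2 hq
    have h1 : HasLogMean (fun z => ‖z - p / q‖) (Real.posLog ‖p / q‖) :=
      ⟨fun z => Real.log ‖z - p / q‖, circleIntegrable_log_norm_sub_const 1,
        circleAverage_log_norm_sub_const_eq_posLog, {p / q}, Set.countable_singleton _,
        fun z _ hz => Real.exp_log (norm_pos_iff.2 (sub_ne_zero.2 hz))⟩
    have h2 := (hasLogMean_const hq').mul h1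
    have e : Real.log ‖q‖ + Real.posLog ‖p / q‖ = Real.log (max ‖p‖ ‖q‖) := by
      rw [Real.posLog_eq_log_max_one (norm_nonneg _),
        ← Real.log_mul hq'.ne' (by positivity), mul_max_of_nonneg _ _ hq'.le, norm_div,
        mul_div_cancel₀ _ hq'.ne', mul_one, max_comm]
    rw [e] at h2
    refine h2.congr fun z _ => ?_
    rw [← norm_mul, norm_sub_rev]
    congr 1
    field_simp

/-- Jensen's inequality for the exponential. -/
lemma HasLogMean.exp_le_integral {f : ℂ → ℝ} {c : ℝ} (hf : HasLogMean f c) {g : ℝ → ℝ}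
    (hg : IntervalIntegrable g MeasureTheory.volume 0 (2 * Real.pi))
    (hfg : ∀ x ∈ Set.Icc 0 (2 * Real.pi), f (circleMap 0 1 x) = g x) :
    2 * Real.pi * Real.exp c ≤ ∫ x in (0 : ℝ)..(2 * Real.pi), g x := by
  obtain ⟨L, h1, h2, S, h3, h4⟩ := hf
  have hpi := Real.two_pi_pos
  have hL : IntervalIntegrable (fun x => L (circleMap 0 1 x)) MeasureTheory.volume 0
    (2 * Real.pi) := h1
  have hI : ∫ x in (0 : ℝ)..(2 * Real.pi), L (circleMap 0 1 x) = 2 * Real.pi * c := by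
    rw [← h2, Real.circleAverage_def, smul_eq_mul, mul_inv_cancel_left₀ hpi.ne']
  have hlin : IntervalIntegrable (fun x => Real.exp c * (1 - c) + Real.exp c *
      L (circleMap 0 1 x)) MeasureTheory.volume 0 (2 * Real.pi) :=
    intervalIntegrable_const.add (hL.const_mul _)
  have key : ∫ x in (0 : ℝ)..(2 * Real.pi), (Real.exp c * (1 - c) + Real.exp c *
      L (circleMap 0 1 x)) ≤ ∫ x in (0 : ℝ)..(2 * Real.pi), g x := by
    refine intervalIntegral.integral_mono_ae_restrict hpi.le hlin hg ?_
    have hbad : MeasureTheory.volume (circleMap 0 1 ⁻¹' S) = 0 :=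
      (h3.preimage_circleMap 0 one_ne_zero).measure_zero _
    have hae : ∀ᵐ x : ℝ, circleMap 0 1 x ∉ S := by
      rw [MeasureTheory.ae_iff]
      simp only [not_not]
      exact hbad
    refine (MeasureTheory.ae_restrict_iff' measurableSet_Icc).2 ?_
    filter_upwards [hae] with x hx hx2
    have e := h4 (circleMap 0 1 x) (by simp) hx
    rw [← hfg x hx2, ← e]
    have h5 := Real.add_one_le_exp (L (circleMap 0 1 x) - c)
    have h6 : Real.exp (L (circleMap 0 1 x)) =
        Real.exp c * Real.exp (L (circleMap 0 1 x) - c) := by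
      rw [← Real.exp_add]
      ring_nf
    rw [h6]
    have h7 := mul_le_mul_of_nonneg_left h5 (Real.exp_pos c).le
    linarith
  rw [intervalIntegral.integral_add intervalIntegrable_const (hL.const_mul _),
    intervalIntegral.integral_const, intervalIntegral.integral_const_mul, hI] at key
  rw [smul_eq_mul] at key
  linarith

/-- The value of `(u - e^{iθ}) (u - e^{-iθ})` where `1 - cos θ = s² (1 + cos ψ)` and
`z = e^{iψ}`. -/
def arcFactor (s : ℝ) (u z : ℂ) : ℂ := (1 - u) ^ 2 + u * s ^ 2 * (2 + z + z⁻¹)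

lemma hasLogMean_arcFactor {s : ℝ} {u p q : ℂ} (h1 : p + q = 1 - u) (h2 : p * q = -(u * s ^ 2))
    (h : p ≠ 0 ∨ q ≠ 0) :
    HasLogMean (fun z => ‖arcFactor s u z‖) (2 * Real.log (max ‖p‖ ‖q‖)) := by
  have h3 := (hasLogMean_linear h).mul (hasLogMean_linear (p := -q) (q := -p) (by
    rcases h with h | h
    · exact Or.inr (neg_ne_zero.2 h)
    · exact Or.inl (neg_ne_zero.2 h)))
  rw [norm_neg, norm_neg, max_comm ‖q‖, ← two_mul] at h3
  refine h3.congr fun z hz => ?_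
  have hz0 : z ≠ 0 := by
    rintro rfl
    simp at hz
  have e : arcFactor s u z * z = (p - q * z) * (-q - -p * z) := by
    rw [arcFactor, ← h1, show u * (s : ℂ) ^ 2 = -(p * q) by rw [h2, neg_neg]]
    field_simp
    ring
  rw [← norm_mul, ← e, norm_mul, hz, mul_one]

lemma le_max_norm_of_quadratic {s : ℝ} (hs : 0 < s) (hs1 : s < 1) {u p q : ℂ}
    (h1 : p + q = 1 - u) (h2 : p * q = -(u * s ^ 2)) : s ≤ max ‖p‖ ‖q‖ := by
  by_contra! hlt
  obtain ⟨hp, hq⟩ := max_lt_iff.1 hlt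
  have e : q * (s ^ 2 - p) = s ^ 2 * (1 - p) := by
    linear_combination -h2 + (s : ℂ) ^ 2 * h1
  have h3 : ‖(s : ℂ) ^ 2 - p‖ < s * ‖1 - p‖ := by
    refine lt_of_pow_lt_pow_left₀ 2 (by positivity) ?_
    have hp2 : ‖p‖ ^ 2 < s ^ 2 := pow_lt_pow_left₀ hp (norm_nonneg _) two_ne_zero
    rw [mul_pow, ← Complex.normSq_eq_norm_sq, ← Complex.normSq_eq_norm_sq,
      ← Complex.ofReal_pow, Complex.normSq_apply, Complex.normSq_apply]
    rw [← Complex.normSq_eq_norm_sq, Complex.normSq_apply] at hp2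
    simp only [Complex.sub_re, Complex.sub_im, Complex.ofReal_re, Complex.ofReal_im,
      Complex.one_re, Complex.one_im]
    have hs2 : 0 < 1 - s ^ 2 := by nlinarith
    nlinarith [mul_pos hs2 (sub_pos.2 hp2)]
  have h4 : ‖q‖ * ‖(s : ℂ) ^ 2 - p‖ = s ^ 2 * ‖1 - p‖ := by
    rw [← norm_mul, e, norm_mul, norm_pow, Complex.norm_real, Real.norm_of_nonneg hs.le]
  have h5 : ‖q‖ * ‖(s : ℂ) ^ 2 - p‖ ≤ s * ‖(s : ℂ) ^ 2 - p‖ := by gcongr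
  nlinarith [mul_lt_mul_of_pos_left h3 hs]

lemma exists_hasLogMean_arcFactor {s : ℝ} (hs : 0 < s) (hs1 : s < 1) (u : ℂ) :
    ∃ c, 2 * Real.log s ≤ c ∧ HasLogMean (fun z => ‖arcFactor s u z‖) c := by
  obtain ⟨d, hd⟩ := IsAlgClosed.exists_pow_nat_eq ((1 - u) ^ 2 + 4 * u * s ^ 2) zero_lt_two
  have h1 : (1 - u + d) / 2 + (1 - u - d) / 2 = 1 - u := by ring
  have h2 : (1 - u + d) / 2 * ((1 - u - d) / 2) = -(u * s ^ 2) := by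
    linear_combination -hd / 4
  have h3 := le_max_norm_of_quadratic hs hs1 h1 h2
  refine ⟨_, ?_, hasLogMean_arcFactor h1 h2 ?_⟩
  · gcongr
  · by_contra! h
    rw [h.1, h.2] at h3
    simp at h3
    linarith

lemma hasLogMean_arcFactor_of_pos {s t : ℝ} (ht : 0 < t) (ht1 : t < 1) :
    HasLogMean (fun z => ‖arcFactor s t z‖)
      (2 * Real.log ((1 - t + √((1 - t) ^ 2 + 4 * t * s ^ 2)) / 2)) := by
  set r := √((1 - t) ^ 2 + 4 * t * s ^ 2) with hr
  have hr2 : r ^ 2 = (1 - t) ^ 2 + 4 * t * s ^ 2 := Real.sq_sqrt (by positivity)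
  have hr0 : 0 ≤ r := Real.sqrt_nonneg _
  have hp : 0 < (1 - t + r) / 2 := by linarith
  have h := hasLogMean_arcFactor (s := s) (u := t) (p := (((1 - t + r) / 2 : ℝ) : ℂ))
    (q := (((1 - t - r) / 2 : ℝ) : ℂ)) (by push_cast; ring) ?_ ?_
  · rwa [max_eq_left, Complex.norm_real, Real.norm_of_nonneg hp.le] at h
    rw [Complex.norm_real, Complex.norm_real, Real.norm_of_nonneg hp.le, Real.norm_eq_abs, abs_le]
    constructor <;> linarith
  · rw [← Complex.ofReal_mul, show (1 - t + r) / 2 * ((1 - t - r) / 2) = -(t * s ^ 2) by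
      linear_combination -hr2 / 4]
    push_cast
    rfl
  · left
    exact_mod_cast hp.ne'

lemma hasLogMean_arcFactor_neg_one {s : ℝ} (hs1 : s ^ 2 ≤ 1) :
    HasLogMean (fun z => ‖arcFactor s (-1) z‖) (2 * Real.log (1 + √(1 - s ^ 2))) := by
  set r := √(1 - s ^ 2) with hr
  have hr2 : r ^ 2 = 1 - s ^ 2 := Real.sq_sqrt (by linarith)
  have hr0 : 0 ≤ r := Real.sqrt_nonneg _
  have hp : 0 < 1 + r := by linarith
  have h := hasLogMean_arcFactor (s := s) (u := -1) (p := ((1 + r : ℝ) : ℂ))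
    (q := ((1 - r : ℝ) : ℂ)) (by push_cast; ring) ?_ ?_
  · rwa [max_eq_left, Complex.norm_real, Real.norm_of_nonneg hp.le] at h
    rw [Complex.norm_real, Complex.norm_real, Real.norm_of_nonneg hp.le, Real.norm_eq_abs, abs_le]
    constructor <;> linarith
  · rw [← Complex.ofReal_mul, show (1 + r) * (1 - r) = s ^ 2 by linear_combination -hr2]
    push_cast
    ring
  · left
    exact_mod_cast hp.ne'

section

open Polynomial

/-- A parametrisation of the arc of angles `θ` with `|sin (θ / 2)| ≤ s`. -/
def arcAngle (s ψ : ℝ) : ℝ := -2 * Real.arcsin (s * Real.cos (ψ / 2))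

/-- The derivative of `arcAngle`. -/
def arcSpeed (s ψ : ℝ) : ℝ := s * Real.sin (ψ / 2) / √(1 - (s * Real.cos (ψ / 2)) ^ 2)

lemma mul_cos_sq_lt_one {s : ℝ} (hs : 0 < s) (hs1 : s < 1) (ψ : ℝ) :
    (s * Real.cos (ψ / 2)) ^ 2 < 1 := by
  have h := Real.cos_sq_le_one (ψ / 2)
  nlinarith [mul_pow s (Real.cos (ψ / 2)) 2, sq_nonneg (Real.cos (ψ / 2))]

lemma hasDerivAt_arcAngle {s : ℝ} (hs : 0 < s) (hs1 : s < 1) (ψ : ℝ) :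
    HasDerivAt (arcAngle s) (arcSpeed s ψ) ψ := by
  have h1 := (sq_lt_one_iff_abs_lt_one _).1 (mul_cos_sq_lt_one hs hs1 ψ)
  obtain ⟨h2, h3⟩ := abs_lt.1 h1
  have h4 : HasDerivAt (fun x : ℝ => s * Real.cos (x / 2)) (s * (-Real.sin (ψ / 2) * (1 / 2))) ψ :=
    (((hasDerivAt_id ψ).div_const 2).cos).const_mul s
  have h5 := ((Real.hasDerivAt_arcsin h2.ne' h3.ne).comp ψ h4).const_mul (-2)
  refine h5.congr_deriv ?_
  rw [arcSpeed]
  ring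

lemma cos_arcAngle {s : ℝ} (hs : 0 < s) (hs1 : s < 1) (ψ : ℝ) :
    Real.cos (arcAngle s ψ) = 1 - s ^ 2 * (1 + Real.cos ψ) := by
  have h1 := (sq_lt_one_iff_abs_lt_one _).1 (mul_cos_sq_lt_one hs hs1 ψ)
  obtain ⟨h2, h3⟩ := abs_lt.1 h1
  have h4 := Real.sin_arcsin h2.le h3.le
  have h5 : Real.cos ψ = 2 * Real.cos (ψ / 2) ^ 2 - 1 := by
    rw [← Real.cos_two_mul]
    ring_nf
  rw [arcAngle, neg_mul, Real.cos_neg, Real.cos_two_mul', h5]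
  have h6 := Real.sin_sq_add_cos_sq (Real.arcsin (s * Real.cos (ψ / 2)))
  rw [h4] at h6 ⊢
  linear_combination h6

lemma exp_add_inv_exp (θ : ℝ) : Complex.exp (θ * Complex.I) + (Complex.exp (θ * Complex.I))⁻¹ =
    ((2 * Real.cos θ : ℝ) : ℂ) := by
  rw [← Complex.exp_neg, ← neg_mul]
  push_cast
  rw [Complex.two_cos]

lemma arcFactor_circleMap {s : ℝ} (hs : 0 < s) (hs1 : s < 1) (u : ℂ) (ψ : ℝ) :
    arcFactor s u (circleMap 0 1 ψ) = (u - Complex.exp (arcAngle s ψ * Complex.I)) *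
      (u - (Complex.exp (arcAngle s ψ * Complex.I))⁻¹) := by
  have h1 := exp_add_inv_exp (arcAngle s ψ)
  have h2 := exp_add_inv_exp ψ
  have h3 : Complex.exp (arcAngle s ψ * Complex.I) *
    (Complex.exp (arcAngle s ψ * Complex.I))⁻¹ = 1 := mul_inv_cancel₀ (Complex.exp_ne_zero _)
  rw [cos_arcAngle hs hs1] at h1
  push_cast at h1 h2
  rw [arcFactor, circleMap, zero_add, Complex.ofReal_one, one_mul]
  linear_combination u * s ^ 2 * h2 + u * h1 - h3

lemma arcSpeed_eq {s : ℝ} (hs : 0 < s) (hs1 : s < 1) {ψ : ℝ}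
    (hψ : ψ ∈ Set.Icc 0 (2 * Real.pi)) : arcSpeed s ψ =
      s * ‖1 - 1 * circleMap 0 1 ψ‖ * ‖arcFactor s (-1) (circleMap 0 1 ψ)‖ ^ (-(1 / 2) : ℝ) := by
  have hpos := sub_pos.2 (mul_cos_sq_lt_one hs hs1 ψ)
  have h5 : Real.cos ψ = 2 * Real.cos (ψ / 2) ^ 2 - 1 := by
    rw [← Real.cos_two_mul]
    ring_nf
  have hsin : 0 ≤ Real.sin (ψ / 2) :=
    Real.sin_nonneg_of_nonneg_of_le_pi (by linarith [hψ.1]) (by linarith [hψ.2])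
  have e1 : arcFactor s (-1) (circleMap 0 1 ψ) =
      ((4 * (1 - (s * Real.cos (ψ / 2)) ^ 2) : ℝ) : ℂ) := by
    have h2 := exp_add_inv_exp ψ
    rw [h5] at h2
    push_cast at h2
    rw [arcFactor, circleMap, zero_add, Complex.ofReal_one, one_mul]
    push_cast
    linear_combination -s ^ 2 * h2
  have e2 : ‖1 - 1 * circleMap 0 1 ψ‖ = 2 * Real.sin (ψ / 2) := by
    refine (pow_left_inj₀ (norm_nonneg _) (by positivity) two_ne_zero).1 ?_
    rw [← Complex.normSq_eq_norm_sq, Complex.normSq_apply, circleMap]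
    simp only [Complex.exp_mul_I, ← Complex.ofReal_cos, ← Complex.ofReal_sin, zero_add,
      Complex.ofReal_one, one_mul, Complex.sub_re, Complex.sub_im, Complex.add_re, Complex.add_im,
      Complex.ofReal_re, Complex.ofReal_im, Complex.mul_re, Complex.mul_im, Complex.I_re,
      Complex.I_im, Complex.one_re, Complex.one_im]
    have h6 := Real.sin_sq_add_cos_sq ψ
    have h7 := Real.sin_sq_add_cos_sq (ψ / 2)
    linear_combination h6 - 2 * h5 - 4 * h7
  rw [e1, e2, Complex.norm_real, Real.norm_of_nonneg (by positivity), Real.rpow_neg (by positivity),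
    ← Real.sqrt_eq_rpow, Real.sqrt_mul (by norm_num), show (4 : ℝ) = 2 ^ 2 by norm_num,
    Real.sqrt_sq (by norm_num), arcSpeed]
  field_simp

lemma norm_eval_sq_eq_prod_roots (P : ℝ[X]) {z : ℂ} (hz : ‖z‖ = 1) :
    ‖aeval z P‖ ^ 2 = P.leadingCoeff ^ 2 *
      ((P.map (algebraMap ℝ ℂ)).roots.map fun r => ‖(r - z) * (r - z⁻¹)‖).prod := by
  have hc : (starRingEnd ℂ) z = z⁻¹ := by
    rw [Complex.inv_def, Complex.normSq_eq_norm_sq, hz]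
    simp
  have h1 : ∀ w : ℂ, aeval w P = P.leadingCoeff *
      ((P.map (algebraMap ℝ ℂ)).roots.map fun r => w - r).prod := by
    intro w
    rw [← eval_map_algebraMap, (IsAlgClosed.splits _).eval_eq_prod_roots, leadingCoeff_map]
    rfl
  have h2 : ‖aeval z P‖ = ‖aeval z⁻¹ P‖ := by
    rw [← hc, aeval_conj, RCLike.norm_conj]
  rw [sq, show ‖aeval z P‖ * ‖aeval z P‖ = ‖aeval z P * aeval z⁻¹ P‖ by rw [norm_mul, ← h2],
    h1, h1, mul_mul_mul_comm, ← Multiset.prod_map_mul, norm_mul, norm_mul, Complex.norm_real,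
    Real.norm_eq_abs, abs_mul_abs_self, sq]
  congr 1
  generalize (P.map (algebraMap ℝ ℂ)).roots = R
  induction R using Multiset.induction with
  | empty => simp
  | cons r R ih =>
    rw [Multiset.map_cons, Multiset.map_cons, Multiset.prod_cons, Multiset.prod_cons, norm_mul, ih]
    congr 2
    ring

end

section

open Polynomial

/-- Exponential rate of the lower bound for weighted integrals over a symmetric arc. -/
def arcExponent (t s : ℝ) (N k : ℕ) : ℝ :=
  2 * k * Real.log s - 2 * N * Real.log ((1 - t + √((1 - t) ^ 2 + 4 * t * s ^ 2)) / 2) +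
    Real.log s - Real.log (1 + √(1 - s ^ 2))

lemma norm_one_sub_mul_exp_pos {t : ℝ} (ht : 0 < t) (ht1 : t < 1) (θ : ℝ) :
    0 < ‖1 - t * Complex.exp (θ * Complex.I)‖ := by
  rw [norm_pos_iff, sub_ne_zero]
  intro h
  have h2 := congrArg norm h
  rw [norm_one, norm_mul, Complex.norm_exp_ofReal_mul_I, mul_one, Complex.norm_real,
    Real.norm_of_nonneg ht.le] at h2
  linarith

lemma continuous_arcSpeed {s : ℝ} (hs : 0 < s) (hs1 : s < 1) : Continuous (arcSpeed s) := by
  unfold arcSpeed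
  refine Continuous.div (by fun_prop) (by fun_prop) fun ψ => ?_
  exact (Real.sqrt_pos.2 (sub_pos.2 (mul_cos_sq_lt_one hs hs1 ψ))).ne'

lemma norm_one_sub_mul_exp_sq {t : ℝ} (z : ℂ) (hz : ‖z‖ = 1) :
    ‖1 - t * z‖ ^ 2 = ‖((t : ℂ) - z) * (t - z⁻¹)‖ := by
  have hz0 : z ≠ 0 := by
    rintro rfl
    simp at hz
  have hc : (starRingEnd ℂ) z = z⁻¹ := by
    rw [Complex.inv_def, Complex.normSq_eq_norm_sq, hz]
    simp
  have e1 : ‖(t : ℂ) - z⁻¹‖ = ‖1 - t * z‖ := by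
    rw [← norm_neg, show -((t : ℂ) - z⁻¹) = (1 - t * z) * z⁻¹ by field_simp; ring, norm_mul,
      norm_inv, hz, inv_one, mul_one]
  have e2 : ‖(t : ℂ) - z‖ = ‖(t : ℂ) - z⁻¹‖ := by
    rw [← hc, ← RCLike.norm_conj, map_sub, Complex.conj_ofReal]
  rw [norm_mul, e2, e1, sq]

lemma exp_arcExponent_le_integral {t s : ℝ} (ht : 0 < t) (ht1 : t < 1) (hs : 0 < s) (hs1 : s < 1)
    (N : ℕ) {P : ℝ[X]} (hP : P ≠ 0) :
    2 * Real.pi * (P.leadingCoeff ^ 2 * Real.exp (arcExponent t s N P.natDegree)) ≤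
      ∫ θ in (-Real.pi)..Real.pi, ‖aeval (Complex.exp (θ * Complex.I)) P‖ ^ 2 *
        (‖1 - t * Complex.exp (θ * Complex.I)‖ ^ (2 * N))⁻¹ := by
  set G : ℝ → ℝ := fun θ => ‖aeval (Complex.exp (θ * Complex.I)) P‖ ^ 2 *
        (‖1 - t * Complex.exp (θ * Complex.I)‖ ^ (2 * N))⁻¹ with hG
  have hGc : Continuous G := by
    refine Continuous.mul ?_ (Continuous.inv₀ (by fun_prop) fun θ =>
      (pow_pos (norm_one_sub_mul_exp_pos ht ht1 θ) _).ne')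
    exact ((P.continuous_aeval).comp (by fun_prop)).norm.pow 2
  have hG0 : ∀ θ, 0 ≤ G θ := fun θ => by positivity
  have hl : 0 < P.leadingCoeff ^ 2 := by
    have := leadingCoeff_ne_zero.2 hP
    positivity
  obtain ⟨c, hc, hm⟩ := hasLogMean_multiset_prod (exists_hasLogMean_arcFactor hs hs1)
    (P.map (algebraMap ℝ ℂ)).roots
  have hcard : Multiset.card (P.map (algebraMap ℝ ℂ)).roots = P.natDegree := by
    rw [← (IsAlgClosed.splits (P.map (algebraMap ℝ ℂ))).natDegree_eq_card_roots, natDegree_map]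
  rw [hcard] at hc
  have hM := (((hasLogMean_const hl).mul hm).mul
    ((hasLogMean_arcFactor_of_pos (s := s) ht ht1).rpow (-(N : ℝ)))).mul
    (((hasLogMean_const hs).mul (hasLogMean_linear (p := 1) (q := 1) (Or.inl one_ne_zero))).mul
      ((hasLogMean_arcFactor_neg_one (s := s) (by nlinarith)).rpow (-(1 / 2) : ℝ)))
  have h1 := hM.exp_le_integral (g := fun ψ => G (arcAngle s ψ) * arcSpeed s ψ) ?_ ?_
  · have hsub : ∫ ψ in (0 : ℝ)..(2 * Real.pi), G (arcAngle s ψ) * arcSpeed s ψ =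
        ∫ θ in (arcAngle s 0)..(arcAngle s (2 * Real.pi)), G θ :=
      intervalIntegral.integral_comp_mul_deriv (f := arcAngle s) (f' := arcSpeed s)
        (fun x _ => hasDerivAt_arcAngle hs hs1 x) (continuous_arcSpeed hs hs1).continuousOn hGc
    have ha0 : arcAngle s 0 = -(2 * Real.arcsin s) := by
      simp [arcAngle]
    have ha1 : arcAngle s (2 * Real.pi) = 2 * Real.arcsin s := by
      rw [arcAngle, mul_div_cancel_left₀ _ two_ne_zero, Real.cos_pi, mul_neg_one,
        Real.arcsin_neg]
      ring
    have hb := Real.arcsin_le_pi_div_two s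
    have hb0 := Real.arcsin_nonneg.2 hs.le
    rw [hsub, ha0, ha1] at h1
    have h2 : ∫ θ in (-(2 * Real.arcsin s))..(2 * Real.arcsin s), G θ ≤
        ∫ θ in (-Real.pi)..Real.pi, G θ :=
      intervalIntegral.integral_mono_interval (by linarith) (by linarith) (by linarith)
        (Filter.Eventually.of_forall hG0) (hGc.intervalIntegrable _ _)
    refine le_trans ?_ (h1.trans h2)
    rw [← Real.exp_log hl, ← Real.exp_add, Real.exp_log hl]
    refine mul_le_mul_of_nonneg_left (Real.exp_le_exp.2 ?_) Real.two_pi_pos.le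
    rw [norm_one, max_self, Real.log_one, arcExponent]
    linarith
  · refine Continuous.intervalIntegrable ?_ _ _
    refine (hGc.comp ?_).mul (continuous_arcSpeed hs hs1)
    exact continuous_iff_continuousAt.2 fun ψ => (hasDerivAt_arcAngle hs hs1 ψ).continuousAt
  · intro ψ hψ
    have hz := Complex.norm_exp_ofReal_mul_I (arcAngle s ψ)
    rw [arcSpeed_eq hs hs1 hψ]
    congr 1
    simp only [arcFactor_circleMap hs hs1, hG]
    rw [norm_eval_sq_eq_prod_roots P hz, pow_mul, norm_one_sub_mul_exp_sq _ hz,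
      Real.rpow_neg (norm_nonneg _), Real.rpow_natCast]

end

section

open Polynomial

lemma coeff_sum_C_mul_X_pow {n : ℕ} (v : Fin n → ℝ) (i : Fin n) :
    (∑ j, C (v j) * X ^ (j : ℕ)).coeff (i : ℕ) = v i := by
  rw [finsetSum_coeff, Finset.sum_eq_single i]
  · simp
  · intro j _ hj
    rw [coeff_C_mul_X_pow, if_neg fun h => hj (Fin.ext h.symm)]
  · simp

lemma toep_acf_ge {t s : ℝ} (ht : 0 < t) (ht1 : t < 1) (hs : 0 < s) (hs1 : s < 1)
    (N : ℕ) {n : ℕ} (v : Fin n → ℝ) (hv : ∑ j, C (v j) * X ^ (j : ℕ) ≠ 0) :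
    (∑ j, C (v j) * X ^ (j : ℕ)).leadingCoeff ^ 2 *
      Real.exp (arcExponent t s N (∑ j, C (v j) * X ^ (j : ℕ)).natDegree) ≤
      v ⬝ᵥ (toep (acf t N) n).mulVec v := by
  have h := exp_arcExponent_le_integral ht ht1 hs hs1 N hv
  have e : ∀ z : ℂ, aeval z (∑ j, C (v j) * X ^ (j : ℕ)) = ∑ i, (v i : ℂ) * z ^ (i : ℕ) := by
    intro z
    rw [map_sum]
    refine Finset.sum_congr rfl fun i _ => ?_
    rw [map_mul, map_pow, aeval_X, aeval_C]
    rfl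
  simp_rw [e] at h
  rw [toep_acf_quadratic_form ht.le ht1] at h
  exact le_of_mul_le_mul_left h Real.two_pi_pos

lemma abs_det_gMat_acf_mul_le {t s : ℝ} (ht : 0 < t) (ht1 : t < 1) (hs : 0 < s) (hs1 : s < 1)
    (N m : ℕ) : |(gMat (acf t N) m).det| * Real.exp (arcExponent t s N (2 * m + 2)) ≤
      |(gMat (acf t N) (m + 1)).det| := by
  have hne : ∀ {n : ℕ} (v : Fin n → ℝ) (i : Fin n), v i ≠ 0 →
      ∑ j, C (v j) * X ^ (j : ℕ) ≠ 0 := by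
    intro n v i hi h
    have h1 := coeff_sum_C_mul_X_pow v i
    rw [h, coeff_zero] at h1
    exact hi h1.symm
  have hpos : ∀ v : Fin (2 * m + 3) → ℝ, v ≠ 0 →
      0 < v ⬝ᵥ (toep (acf t N) (2 * m + 3)).mulVec v := by
    intro v hv
    obtain ⟨i, hi⟩ := Function.ne_iff.1 hv
    have h1 := toep_acf_ge ht ht1 hs hs1 N v (hne v i hi)
    have h2 := leadingCoeff_ne_zero.2 (hne v i hi)
    exact lt_of_lt_of_le (by positivity) h1
  refine abs_det_gMat_mul_le (acf_neg t N) m ?_ hpos ?_ (det_acf_shift_nonneg ht.le ht1 N _)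
  · have h := one_le_abs_det ht.le ht1 N (m + 1)
    intro h0
    rw [h0, abs_zero] at h
    linarith
  · intro v
    by_cases hl : v (Fin.last _) = 0
    · rw [hl]
      by_cases hv : v = 0
      · simp [hv]
      · have := (hpos v hv).le
        simpa using this
    · have h1 := toep_acf_ge ht ht1 hs hs1 N v (hne v _ hl)
      have h2 : (∑ j, C (v j) * X ^ (j : ℕ)).natDegree = 2 * m + 2 := by
        refine natDegree_eq_of_le_of_coeff_ne_zero ?_ ?_
        · refine natDegree_sum_le_of_forall_le _ _ fun j _ => ?_
          exact (natDegree_C_mul_X_pow_le _ _).trans (by omega)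
        · have h3 := coeff_sum_C_mul_X_pow v (Fin.last _)
          rw [Fin.val_last] at h3
          rwa [h3]
      have h4 : (∑ j, C (v j) * X ^ (j : ℕ)).leadingCoeff = v (Fin.last _) := by
        rw [leadingCoeff, h2]
        exact coeff_sum_C_mul_X_pow v (Fin.last _)
      rwa [h2, h4] at h1

end

lemma neg_sub_two_mul_sq_le_log {w : ℝ} (h1 : w ≤ 1 / 2) :
    -(w + 2 * w ^ 2) ≤ Real.log (1 - w) := by
  have h := Real.one_sub_inv_le_log_of_pos (show 0 < 1 - w by linarith)
  refine le_trans ?_ h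
  rw [show 1 - (1 - w)⁻¹ = -(w / (1 - w)) by
    have : 1 - w ≠ 0 := by linarith
    field_simp
    ring, neg_le_neg_iff, div_le_iff₀ (by linarith)]
  nlinarith [sq_nonneg w]

lemma le_arcExponent {t : ℝ} (ht : 0 < t) {N k : ℕ} (hk : k < N) {y : ℝ}
    (hy : y = etaT t * N - k) (hy0 : 0 < y) (hyN : 256 * N ≤ y ^ 3) (hyN' : y ≤ N) :
    y ^ 2 / (16 * N) ≤ arcExponent t √(1 - y / (4 * N)) N k := by
  have hN : (0 : ℝ) < N := by
    have : 0 < N := by omega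
    exact_mod_cast this
  set w := y / (4 * N) with hw
  have hwy : y = 4 * N * w := by
    rw [hw]
    field_simp
  have hw0 : 0 < w := by positivity
  have hw1 : w ≤ 1 / 4 := by
    rw [hw, div_le_iff₀ (by positivity)]
    linarith
  have hlog := neg_sub_two_mul_sq_le_log (w := w) (by linarith)
  have hs2 : √(1 - w) ^ 2 = 1 - w := Real.sq_sqrt (by linarith)
  have hls : Real.log √(1 - w) = Real.log (1 - w) / 2 := Real.log_sqrt (by linarith)
  rw [arcExponent, hs2, hls, sub_sub_cancel]
  set σ := √w with hσ
  have hσ0 : 0 < σ := Real.sqrt_pos.2 hw0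
  have hσ2 : σ ^ 2 = w := Real.sq_sqrt hw0.le
  have hσ1 : σ ≤ 1 / 2 := by
    refine abs_le_of_sq_le_sq' ?_ (by norm_num) |>.2
    rw [hσ2]
    linarith
  have h1 : Real.log (1 + σ) ≤ σ := by
    have := Real.log_le_sub_one_of_pos (show 0 < 1 + σ by linarith)
    linarith
  have hp : (1 - t + √((1 - t) ^ 2 + 4 * t * (1 - w))) / 2 ≤ 1 - etaT t * w / 2 := by
    have h2 : √((1 - t) ^ 2 + 4 * t * (1 - w)) ≤ 1 + t - etaT t * w := by
      rw [Real.sqrt_le_left]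
      · have e : etaT t * (1 + t) = 2 * t := by
          rw [etaT]
          field_simp
        nlinarith [sq_nonneg (etaT t * w)]
      · have : etaT t ≤ 2 * t := by
          rw [etaT]
          exact div_le_self (by positivity) (by linarith)
        nlinarith
    linarith
  have h3 : Real.log ((1 - t + √((1 - t) ^ 2 + 4 * t * (1 - w))) / 2) ≤ -(etaT t * w / 2) := by
    have hpos : 0 < (1 - t + √((1 - t) ^ 2 + 4 * t * (1 - w))) / 2 := by
      have h5 : |1 - t| < √((1 - t) ^ 2 + 4 * t * (1 - w)) := by
        rw [← Real.sqrt_sq_eq_abs]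
        refine Real.sqrt_lt_sqrt (sq_nonneg _) ?_
        have : 0 < 4 * t * (1 - w) := by
          have : 0 < 1 - w := by linarith
          positivity
        linarith
      linarith [neg_abs_le (1 - t)]
    have := Real.log_le_sub_one_of_pos hpos
    linarith
  have hk' : (2 * k + 1 : ℝ) ≤ 2 * N := by
    have : 2 * k + 1 ≤ 2 * N := by omega
    exact_mod_cast this
  have h8 : 8 ≤ y * σ := by
    refine abs_le_of_sq_le_sq' ?_ (by positivity) |>.2
    rw [mul_pow, hσ2, hw, mul_div_assoc', le_div_iff₀ (by positivity)]
    nlinarith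
  have h9 : 8 * σ ≤ y * w := by
    rw [← hσ2]
    nlinarith
  have h10 : y ^ 2 / (16 * N) = y * w / 4 := by
    rw [hw]
    field_simp
    ring
  have h11 : (2 * k + 1) / 2 * -(w + 2 * w ^ 2) ≤ (2 * k + 1) / 2 * Real.log (1 - w) := by
    gcongr
  have h12 : 2 * (N : ℝ) * Real.log ((1 - t + √((1 - t) ^ 2 + 4 * t * (1 - w))) / 2) ≤
      2 * N * -(etaT t * w / 2) := by
    gcongr
  have h13 : (2 * k + 1 : ℝ) * w ^ 2 ≤ 2 * N * w ^ 2 := by gcongr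
  have h14 : 2 * N * w ^ 2 = y * w / 2 := by
    rw [hwy]
    ring
  have h15 : w ≤ σ / 2 := by
    rw [← hσ2]
    nlinarith
  have h16 : y * w = etaT t * N * w - k * w := by
    rw [hy]
    ring
  rw [h10]
  nlinarith

lemma etaT_lt_one {t : ℝ} (ht : 0 < t) (ht1 : t < 1) : etaT t < 1 := by
  rw [etaT, div_lt_one (by linarith)]
  linarith

lemma abs_det_gMat_acf_mul_exp_le {t : ℝ} (ht : 0 < t) (ht1 : t < 1) {N : ℕ} {Z : ℝ} (hZ : 0 < Z)
    (hZN : 256 * N ≤ Z ^ 3) (J : ℕ) : ∀ m : ℕ, Z ≤ etaT t * N - 2 * (m + J) →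
      |(gMat (acf t N) m).det| * Real.exp (J * (Z ^ 2 / (16 * N))) ≤
        |(gMat (acf t N) (m + J)).det| := by
  induction J with
  | zero =>
    intro m _
    simp
  | succ J ih =>
    intro m hm
    push_cast at hm
    have hη : etaT t * N ≤ N := mul_le_of_le_one_left (Nat.cast_nonneg N) (etaT_lt_one ht ht1).le
    have h1 := ih m (by linarith)
    set y : ℝ := etaT t * N - ((2 * (m + J) + 2 : ℕ) : ℝ) with hy
    have hZy : Z ≤ y := by
      rw [hy]
      push_cast
      linarith
    have hk : 2 * (m + J) + 2 < N := by
      have : ((2 * (m + J) + 2 : ℕ) : ℝ) < N := by linarith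
      exact_mod_cast this
    have hN : (0 : ℝ) < N := by
      have : 0 < N := by omega
      exact_mod_cast this
    have hyN : y ≤ N := by
      have : (0 : ℝ) ≤ ((2 * (m + J) + 2 : ℕ) : ℝ) := Nat.cast_nonneg _
      linarith
    have hyN4 : y / (4 * N) ≤ 1 / 4 := by
      rw [div_le_iff₀ (by positivity)]
      linarith
    have h2 := le_arcExponent ht hk hy (hZ.trans_le hZy) (hZN.trans (by gcongr)) hyN
    have hy0 : 0 < y / (4 * N) := div_pos (hZ.trans_le hZy) (by positivity)
    have h3 := abs_det_gMat_acf_mul_le (s := √(1 - y / (4 * N))) ht ht1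
      (Real.sqrt_pos.2 (by linarith)) ((Real.sqrt_lt' one_pos).2 (by linarith)) N (m + J)
    have h4 : Z ^ 2 / (16 * N) ≤ y ^ 2 / (16 * N) := by gcongr
    calc |(gMat (acf t N) m).det| * Real.exp ((J + 1 : ℕ) * (Z ^ 2 / (16 * N)))
        = |(gMat (acf t N) m).det| * Real.exp (J * (Z ^ 2 / (16 * N))) *
            Real.exp (Z ^ 2 / (16 * N)) := by
          rw [mul_assoc, ← Real.exp_add]
          push_cast
          ring_nf
      _ ≤ |(gMat (acf t N) (m + J)).det| *
            Real.exp (arcExponent t √(1 - y / (4 * N)) N (2 * (m + J) + 2)) :=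
          mul_le_mul h1 (Real.exp_le_exp.2 (h4.trans h2)) (Real.exp_pos _).le (abs_nonneg _)
      _ ≤ _ := h3

lemma phiGF_le_exp {t β : ℝ} (ht : 0 < t) (ht1 : t < 1) (hβ : 0 < β) (hβt : β * t < 1)
    {N l : ℕ} {Y : ℝ} (hY : Y = etaT t * N - l) (hY0 : 12 ≤ Y) (hYN : 2048 * N ≤ Y ^ 3) :
    phiGF N l t β ≤ Real.exp (-(Y ^ 3 / (512 * N))) := by
  have hp : 0 < 1 - t ^ 2 := by nlinarith
  have hD : 0 < (1 - t ^ 2) ^ (N * (N - 1) / 2) := by positivity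
  obtain ⟨m, hm1, hm2⟩ : ∃ m : ℕ, l ≤ m * 2 ∧ m * 2 ≤ l + 1 := ⟨(l + 1) / 2, by omega, by omega⟩
  have hm3 : (m : ℝ) * 2 ≤ l + 1 := by exact_mod_cast hm2
  have h1 := phiGF_le ht ht1 hβ hβt hm1 (dimerSum_le_abs_det ht.le ht1 N m)
  have hJ1 : Y / 8 ≤ ⌈Y / 8⌉₊ := Nat.le_ceil _
  have hJ2 := Nat.ceil_lt_add_one (show 0 ≤ Y / 8 by linarith)
  set J := ⌈Y / 8⌉₊ with hJ
  have h2 := abs_det_gMat_acf_mul_exp_le (Z := Y / 2) ht ht1 (N := N) (by linarith)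
    (by linarith [show (Y / 2) ^ 3 = Y ^ 3 / 8 by ring]) J m (by linarith)
  have h3 := abs_det_le ht ht1 N (m + J)
  have h4 : Y ^ 3 / (512 * N) ≤ J * ((Y / 2) ^ 2 / (16 * N)) := by
    calc Y ^ 3 / (512 * N) = Y / 8 * ((Y / 2) ^ 2 / (16 * N)) := by ring
      _ ≤ _ := by gcongr
  refine h1.trans ?_
  rw [Real.exp_neg, ← one_div, le_div_iff₀ (Real.exp_pos _), mul_assoc]
  calc (1 - t ^ 2) ^ (N * (N - 1) / 2) *
        (|(gMat (acf t N) m).det| * Real.exp (Y ^ 3 / (512 * N)))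
      ≤ (1 - t ^ 2) ^ (N * (N - 1) / 2) *
        (|(gMat (acf t N) m).det| * Real.exp (J * ((Y / 2) ^ 2 / (16 * N)))) := by gcongr
    _ ≤ (1 - t ^ 2) ^ (N * (N - 1) / 2) * ((1 - t ^ 2) ^ (N * (N - 1) / 2))⁻¹ := by
        gcongr
        exact h2.trans h3
    _ = 1 := mul_inv_cancel₀ hD.ne'

/-- Left-tail estimate: if `x = (l - η(t)N)/(ρ(t)N^{1/3}) ≤ -M₀` then
`0 ≤ φ(N,l,t,β) ≤ C e^{-c |x|³}`. -/
theorem phi_left_tail (t β : ℝ) (ht : 0 < t) (ht1 : t < 1)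
    (hβ : 0 < β) (hβt : β * t < 1) :
    ∃ M₀ > (0 : ℝ), ∃ C > (0 : ℝ), ∃ c > (0 : ℝ), ∀ N l : ℕ, 0 < N → 0 < l →
      ∀ x : ℝ, x = ((l : ℝ) - etaT t * N) / (rhoT t * (N : ℝ) ^ ((1 : ℝ) / 3)) →
      x ≤ -M₀ →
      0 ≤ phiGF N l t β ∧ phiGF N l t β ≤ C * Real.exp (-c * |x| ^ 3) := by
  have hρ : 0 < rhoT t := by
    have : 0 < 1 - t := by linarith
    rw [rhoT]
    positivity
  refine ⟨13 / rhoT t, by positivity, 1, one_pos, rhoT t ^ 3 / 512, by positivity, ?_⟩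
  intro N l hN _ x hx hxM
  refine ⟨phiGF_nonneg ht ht1 hβ hβt N l, ?_⟩
  have hN1 : (1 : ℝ) ≤ N := by exact_mod_cast hN
  set a : ℝ := (N : ℝ) ^ ((1 : ℝ) / 3) with ha
  have ha1 : 1 ≤ a := Real.one_le_rpow hN1 (by norm_num)
  have ha3 : a ^ 3 = N := by
    rw [ha, ← Real.rpow_natCast, ← Real.rpow_mul (by positivity)]
    norm_num
  have hM : 13 / rhoT t ≤ |x| := by
    have := neg_le_abs x
    linarith
  have hx0 : x < 0 := by
    have : 0 < 13 / rhoT t := by positivity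
    linarith
  have hY : |x| * (rhoT t * a) = etaT t * N - l := by
    rw [abs_of_neg hx0, hx]
    field_simp
    ring
  have h13 : 13 * a ≤ |x| * (rhoT t * a) := by
    rw [← mul_assoc]
    gcongr
    exact (div_le_iff₀ hρ).1 hM
  have h := phiGF_le_exp ht ht1 hβ hβt hY (by linarith) ?_
  · rw [one_mul]
    refine h.trans_eq ?_
    congr 1
    rw [← ha3]
    field_simp
  · calc 2048 * (N : ℝ) ≤ (13 * a) ^ 3 := by
          rw [mul_pow, ha3]
          linarith
      _ ≤ _ := by gcongr
end
end

section
/- Fix real numbers t and γ with 0 < t < 1 and γ > (1+t)/(2t). Let θ_c ∈ (0, π) be defined by sin²(θ_c/2) = (1-t)²(2γ-1)/(4t(γ-1)²), and for |θ| ≤ θ_c define ψ(θ) := 4(γ-1) cos(θ/2) √(sin²(θ_c/2) - sin²(θ/2)) / ((1-t)²/t + 4 sin²(θ/2)). Then ψ(θ) ≥ 0 on [-θ_c, θ_c] and (1/2π) ∫_{-θ_c}^{θ_c} ψ(θ) dθ = 1. -/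
noncomputable section

/-- An antiderivative of `√(s² - u²) / (u² + b²)` on `(-s, s)` that stays continuous up to the
endpoints. -/
def sqrtDivAntideriv (b s u : ℝ) : ℝ :=
  √(b ^ 2 + s ^ 2) / b * Real.arcsin (√(b ^ 2 + s ^ 2) * u / (s * √(u ^ 2 + b ^ 2))) -
    Real.arcsin (u / s)

theorem continuous_sqrtDivAntideriv {b s : ℝ} (hb : 0 < b) (hs : 0 < s) :
    Continuous (sqrtDivAntideriv b s) := by
  have hne : ∀ u : ℝ, s * √(u ^ 2 + b ^ 2) ≠ 0 := fun u => by positivity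
  unfold sqrtDivAntideriv
  refine (continuous_const.mul (Real.continuous_arcsin.comp ?_)).sub
    (Real.continuous_arcsin.comp (by fun_prop))
  exact Continuous.div (by fun_prop) (by fun_prop) hne

theorem hasDerivAt_sqrtDivAntideriv {b s u : ℝ} (hb : 0 < b) (hu : u ∈ Set.Ioo (-s) s) :
    HasDerivAt (sqrtDivAntideriv b s) (√(s ^ 2 - u ^ 2) / (u ^ 2 + b ^ 2)) u := by
  obtain ⟨hu1, hu2⟩ := hu
  have hs : 0 < s := by linarith
  have hpos : 0 < s ^ 2 - u ^ 2 := by nlinarith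
  set r := √(s ^ 2 - u ^ 2) with hr
  set c := √(b ^ 2 + s ^ 2) with hc
  set q := √(u ^ 2 + b ^ 2) with hq
  have hr0 : 0 < r := Real.sqrt_pos.2 hpos
  have hc0 : 0 < c := Real.sqrt_pos.2 (by positivity)
  have hq0 : 0 < q := Real.sqrt_pos.2 (by positivity)
  have hr2 : r ^ 2 = s ^ 2 - u ^ 2 := Real.sq_sqrt hpos.le
  have hc2 : c ^ 2 = b ^ 2 + s ^ 2 := Real.sq_sqrt (by positivity)
  have hq2 : q ^ 2 = u ^ 2 + b ^ 2 := Real.sq_sqrt (by positivity)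
  have one_sub_sq_first : 1 - (c * u / (s * q)) ^ 2 = (b * r / (s * q)) ^ 2 := by
    field_simp
    rw [hr2, hc2, hq2]
    ring
  have one_sub_sq_second : 1 - (u / s) ^ 2 = (r / s) ^ 2 := by
    field_simp
    rw [hr2]
  have ne_of_sq_lt : ∀ x : ℝ, 0 < 1 - x ^ 2 → x ≠ -1 ∧ x ≠ 1 := by
    intro x hx
    constructor <;> rintro rfl <;> norm_num at hx
  obtain ⟨h1, h2⟩ := ne_of_sq_lt (c * u / (s * q)) (by rw [one_sub_sq_first]; positivity)
  obtain ⟨h3, h4⟩ := ne_of_sq_lt (u / s) (by rw [one_sub_sq_second]; positivity)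
  have hsqrt : HasDerivAt (fun x : ℝ => √(x ^ 2 + b ^ 2)) (u / q) u := by
    have h := ((hasDerivAt_pow 2 u).add_const (b ^ 2)).sqrt (by positivity)
    refine h.congr_deriv ?_
    rw [← hq]
    push_cast
    field_simp
  have hquot : HasDerivAt (fun x : ℝ => c * x / (s * √(x ^ 2 + b ^ 2)))
      (c * b ^ 2 / (s * q ^ 3)) u := by
    have h := ((hasDerivAt_id u).const_mul c).div (hsqrt.const_mul s)
      (by rw [← hq]; positivity)
    refine h.congr_deriv ?_
    simp only [id, ← hq]
    field_simp
    linear_combination hq2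
  have hfirst := (((Real.hasDerivAt_arcsin h1 h2).comp u hquot).const_mul (c / b))
  have hsecond := (Real.hasDerivAt_arcsin h3 h4).comp u ((hasDerivAt_id u).div_const s)
  refine (hfirst.sub hsecond).congr_deriv ?_
  rw [one_sub_sq_first, one_sub_sq_second, Real.sqrt_sq (by positivity),
    Real.sqrt_sq (by positivity), ← hq2]
  field_simp
  rw [hr2, hc2, hq2]
  ring

theorem sqrtDivAntideriv_neg (b s u : ℝ) :
    sqrtDivAntideriv b s (-u) = -sqrtDivAntideriv b s u := by
  simp only [sqrtDivAntideriv, neg_sq, mul_neg, neg_div, Real.arcsin_neg]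
  ring

theorem sqrtDivAntideriv_self {b s : ℝ} (hs : 0 < s) :
    sqrtDivAntideriv b s s = (√(b ^ 2 + s ^ 2) / b - 1) * (Real.pi / 2) := by
  have hc : √(b ^ 2 + s ^ 2) ≠ 0 := by positivity
  have h : √(b ^ 2 + s ^ 2) * s / (s * √(s ^ 2 + b ^ 2)) = 1 := by
    rw [add_comm (s ^ 2)]
    field_simp
  rw [sqrtDivAntideriv, h, div_self hs.ne', Real.arcsin_one]
  ring

theorem integral_cos_half_mul_sqrt_div {b θc : ℝ} (hb : 0 < b) (hθc : θc ∈ Set.Ioo 0 Real.pi) :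
    ∫ θ in (-θc)..θc, Real.cos (θ / 2) *
        √(Real.sin (θc / 2) ^ 2 - Real.sin (θ / 2) ^ 2) / (Real.sin (θ / 2) ^ 2 + b ^ 2) =
      2 * Real.pi * (√(b ^ 2 + Real.sin (θc / 2) ^ 2) / b - 1) := by
  obtain ⟨h0, hpi⟩ := hθc
  set s := Real.sin (θc / 2) with hs
  have hs0 : 0 < s := Real.sin_pos_of_pos_of_lt_pi (by linarith) (by linarith)
  have hcont : Continuous fun θ : ℝ => 2 * sqrtDivAntideriv b s (Real.sin (θ / 2)) :=
    continuous_const.mul ((continuous_sqrtDivAntideriv hb hs0).comp (by fun_prop))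
  have hden : ∀ θ : ℝ, Real.sin (θ / 2) ^ 2 + b ^ 2 ≠ 0 := fun θ => by positivity
  rw [intervalIntegral.integral_eq_sub_of_hasDerivAt_of_le
    (f := fun θ : ℝ => 2 * sqrtDivAntideriv b s (Real.sin (θ / 2))) (by linarith)
    hcont.continuousOn]
  · simp only [neg_div, Real.sin_neg, sqrtDivAntideriv_neg, ← hs, sqrtDivAntideriv_self hs0]
    ring
  · rintro θ ⟨hθ1, hθ2⟩
    have hmem : Real.sin (θ / 2) ∈ Set.Ioo (-s) s := by
      constructor
      · rw [hs, ← Real.sin_neg]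
        exact Real.sin_lt_sin_of_lt_of_le_pi_div_two (by linarith) (by linarith) (by linarith)
      · exact Real.sin_lt_sin_of_lt_of_le_pi_div_two (by linarith) (by linarith) (by linarith)
    have hsin : HasDerivAt (fun x : ℝ => Real.sin (x / 2)) (Real.cos (θ / 2) * (1 / 2)) θ :=
      ((hasDerivAt_id θ).div_const 2).sin
    refine (((hasDerivAt_sqrtDivAntideriv hb hmem).comp θ hsin).const_mul 2).congr_deriv ?_
    ring
  · exact (Continuous.div (by fun_prop) (by fun_prop) hden).intervalIntegrable _ _

/-- In the supercritical case `γ > (1+t)/(2t)`, with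
`sin²(θ_c/2) = (1-t)²(2γ-1)/(4t(γ-1)²)` and
`ψ(θ) = 4(γ-1)cos(θ/2)√(sin²(θ_c/2)-sin²(θ/2)) / ((1-t)²/t + 4sin²(θ/2))`,
the density `ψ` is nonnegative on `[-θ_c, θ_c]` and `ψ(θ)dθ/(2π)` is a
probability measure. -/
theorem equilibrium_measure_supercritical_prob (t γ : ℝ) (ht : 0 < t) (ht1 : t < 1)
    (hγ : (1 + t) / (2 * t) < γ)
    (θc : ℝ) (hθc : θc ∈ Set.Ioo 0 Real.pi)
    (hθc2 : Real.sin (θc / 2) ^ 2 = (1 - t) ^ 2 * (2 * γ - 1) / (4 * t * (γ - 1) ^ 2)) :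
    (∀ θ ∈ Set.Icc (-θc) θc,
        0 ≤ 4 * (γ - 1) * Real.cos (θ / 2) *
            Real.sqrt (Real.sin (θc / 2) ^ 2 - Real.sin (θ / 2) ^ 2) /
            ((1 - t) ^ 2 / t + 4 * Real.sin (θ / 2) ^ 2)) ∧
    (1 / (2 * Real.pi)) *
        (∫ θ in (-θc)..θc,
          4 * (γ - 1) * Real.cos (θ / 2) *
              Real.sqrt (Real.sin (θc / 2) ^ 2 - Real.sin (θ / 2) ^ 2) /
              ((1 - t) ^ 2 / t + 4 * Real.sin (θ / 2) ^ 2)) = 1 := by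
  have hγ1 : 0 < γ - 1 := by
    rw [div_lt_iff₀ (by positivity)] at hγ
    nlinarith
  refine ⟨fun θ ⟨h1, h2⟩ => ?_, ?_⟩
  · have hcos : 0 ≤ Real.cos (θ / 2) :=
      Real.cos_nonneg_of_mem_Icc ⟨by linarith [hθc.2], by linarith [hθc.2]⟩
    positivity
  set b := (1 - t) / (2 * √t) with hb
  have hb0 : 0 < b := div_pos (by linarith) (by positivity)
  have hb2 : b ^ 2 = (1 - t) ^ 2 / (4 * t) := by
    rw [hb, div_pow, mul_pow, Real.sq_sqrt ht.le]
    norm_num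
  have hc : √(b ^ 2 + Real.sin (θc / 2) ^ 2) = b * (γ / (γ - 1)) := by
    rw [Real.sqrt_eq_iff_mul_self_eq (by positivity)
      (mul_nonneg hb0.le (div_nonneg (by linarith) hγ1.le)), hθc2, ← sq, mul_pow, hb2]
    field_simp
    ring
  have hint : ∀ θ : ℝ, 4 * (γ - 1) * Real.cos (θ / 2) *
      √(Real.sin (θc / 2) ^ 2 - Real.sin (θ / 2) ^ 2) /
        ((1 - t) ^ 2 / t + 4 * Real.sin (θ / 2) ^ 2) =
      (γ - 1) * (Real.cos (θ / 2) * √(Real.sin (θc / 2) ^ 2 - Real.sin (θ / 2) ^ 2) /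
        (Real.sin (θ / 2) ^ 2 + b ^ 2)) := by
    intro θ
    have hden : (1 - t) ^ 2 / t + 4 * Real.sin (θ / 2) ^ 2 =
        4 * (Real.sin (θ / 2) ^ 2 + b ^ 2) := by
      rw [hb2]
      field_simp
      ring
    rw [hden]
    field_simp
  simp_rw [hint]
  rw [intervalIntegral.integral_const_mul, integral_cos_half_mul_sqrt_div hb0 hθc, hc]
  field_simp
  ring
end
end

section
/- For every real number p > 0: ∫₀¹ log(x) / ((x² + p²)√(1 - x²)) dx = -(π/2) ∫₁^{∞} dx / ((x² + p²)√(x² - 1)) + π log(p) / (2p√(1 + p²)). (Both integrals converge: the left-hand integrand has integrable singularities at x = 0 and x = 1, and the right-hand integrand has an integrable singularity at x = 1 and decays like x^{-3} at infinity.) -/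
open MeasureTheory

noncomputable section

open Set Filter Topology

/-- `∫₁^∞ dx/((x²+p²)√(x²-1)) = log(p+√(1+p²)) / (p√(1+p²))`. -/
lemma integral_Ioi_one_div_sq_add_sq_mul_sqrt (p : ℝ) (hp : 0 < p) :
    ∫ x in Ioi (1 : ℝ), 1 / ((x ^ 2 + p ^ 2) * √(x ^ 2 - 1))
      = Real.log (p + √(1 + p ^ 2)) / (p * √(1 + p ^ 2)) := by
  set q := √(1 + p ^ 2) with hq
  have hq2 : q ^ 2 = 1 + p ^ 2 := Real.sq_sqrt (by positivity)
  have hq0 : 0 < q := Real.sqrt_pos.2 (by positivity)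
  have hpq : p < q := by nlinarith
  set A : ℝ → ℝ := fun u ↦ (Real.log (q + p * u) - Real.log (q - p * u)) / (2 * p * q) with hA
  have hA_cont (u : ℝ) (h0 : 0 ≤ u) (h1 : u ≤ 1) : ContinuousAt A u := by
    have h₁ : q + p * u ≠ 0 := by positivity
    have h₂ : q - p * u ≠ 0 := by nlinarith
    have c₁ : ContinuousAt (fun u ↦ q + p * u) u := by fun_prop
    have c₂ : ContinuousAt (fun u ↦ q - p * u) u := by fun_prop
    exact ((c₁.log h₁).sub (c₂.log h₂)).div_const _
  have hderiv (x : ℝ) (hx : x ∈ Ioi (1 : ℝ)) :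
      HasDerivAt (fun x ↦ A (√(1 - (x ^ 2)⁻¹))) (1 / ((x ^ 2 + p ^ 2) * √(x ^ 2 - 1))) x := by
    have hx1 : 1 < x := hx
    have hx0 : 0 < x := by linarith
    have hx2 : 1 < x ^ 2 := by nlinarith
    have hv : 0 < 1 - (x ^ 2)⁻¹ := sub_pos.2 (inv_lt_one_of_one_lt₀ hx2)
    set u := √(1 - (x ^ 2)⁻¹) with hu
    have hu0 : 0 < u := Real.sqrt_pos.2 hv
    have hu2 : u ^ 2 = 1 - (x ^ 2)⁻¹ := Real.sq_sqrt hv.le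
    have hu1 : u < 1 := by
      have : 0 < (x ^ 2)⁻¹ := by positivity
      nlinarith
    have hxu : √(x ^ 2 - 1) = x * u := by
      rw [Real.sqrt_eq_iff_mul_self_eq_of_pos (by positivity)]
      have : x * u * (x * u) = x ^ 2 * u ^ 2 := by ring
      rw [this, hu2]
      field_simp
    have h₁ : q + p * u ≠ 0 := by positivity
    have h₂ : q - p * u ≠ 0 := by nlinarith
    have d₁ : HasDerivAt (fun x : ℝ ↦ √(1 - (x ^ 2)⁻¹)) (1 / (x ^ 3 * u)) x := by
      refine ((((hasDerivAt_pow 2 x).fun_inv (by positivity)).const_sub 1).sqrt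
        hv.ne').congr_deriv ?_
      rw [← hu]
      field_simp
      simp [mul_comm]
    have d₂ := (((d₁.const_mul p).const_add q).log h₁).sub
      (((d₁.const_mul p).const_sub q).log h₂)
    refine (d₂.div_const (2 * p * q)).congr_deriv ?_
    rw [← hu, hxu]
    have hxp : x ^ 2 + p ^ 2 = x ^ 2 * ((q + p * u) * (q - p * u)) := by
      have : (q + p * u) * (q - p * u) = q ^ 2 - p ^ 2 * u ^ 2 := by ring
      rw [this, hq2, hu2]
      field_simp
      ring
    rw [hxp]
    field_simp
    ring
  have hlim : Tendsto (fun x : ℝ ↦ A (√(1 - (x ^ 2)⁻¹))) atTop (𝓝 (A 1)) := by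
    refine (hA_cont 1 zero_le_one le_rfl).tendsto.comp ?_
    have h : Tendsto (fun x : ℝ ↦ √(1 - (x ^ 2)⁻¹)) atTop (𝓝 √(1 - 0)) :=
      ((tendsto_inv_atTop_zero.comp (tendsto_pow_atTop two_ne_zero)).const_sub 1).sqrt
    simpa using h
  have hcont : ContinuousWithinAt (fun x : ℝ ↦ A (√(1 - (x ^ 2)⁻¹))) (Ici 1) 1 := by
    refine ContinuousAt.continuousWithinAt ?_
    refine ContinuousAt.comp (f := fun x : ℝ ↦ √(1 - (x ^ 2)⁻¹)) (g := A)
      (hA_cont _ (Real.sqrt_nonneg _) (by simp)) ?_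
    have : ContinuousAt (fun x : ℝ ↦ (x ^ 2)⁻¹) 1 :=
      ContinuousAt.inv₀ (by fun_prop) (by norm_num)
    fun_prop
  rw [integral_Ioi_of_hasDerivAt_of_nonneg hcont hderiv (fun x hx ↦ by positivity) hlim]
  have hlog : Real.log (q - p) = -Real.log (p + q) := by
    rw [← Real.log_inv]
    congr 1
    refine eq_inv_of_mul_eq_one_left ?_
    linear_combination hq2
  simp only [hA, one_pow, inv_one, sub_self, Real.sqrt_zero, mul_zero, add_zero, sub_zero,
    zero_div, mul_one, hlog, add_comm q p]
  field_simp
  ring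

lemma integrableOn_and_integral_Ioi_rational (s b : ℝ) (hs : 0 < s) (hb : 0 < b)
    (hsb : s * b ≠ 1) :
    IntegrableOn (fun u : ℝ ↦ 2 * s * u ^ 2 / ((1 + s ^ 2 * u ^ 2) * (b ^ 2 + u ^ 2))) (Ioi 0) ∧
    ∫ u in Ioi (0 : ℝ), 2 * s * u ^ 2 / ((1 + s ^ 2 * u ^ 2) * (b ^ 2 + u ^ 2))
      = Real.pi / (1 + b * s) := by
  have h1 : 1 - s * b ≠ 0 := sub_ne_zero.2 hsb.symm
  have h2 : 1 + s * b ≠ 0 := by positivity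
  set G : ℝ → ℝ := fun u ↦
    2 * s / ((1 - s * b) * (1 + s * b)) * (Real.arctan (s * u) / s - b * Real.arctan (u / b))
  have hderiv (u : ℝ) :
      HasDerivAt G (2 * s * u ^ 2 / ((1 + s ^ 2 * u ^ 2) * (b ^ 2 + u ^ 2))) u := by
    have d := (((((hasDerivAt_id u).const_mul s).arctan).div_const s).sub
      (((hasDerivAt_id u).div_const b).arctan.const_mul b)).const_mul
        (2 * s / ((1 - s * b) * (1 + s * b)))
    refine d.congr_deriv ?_
    have e1 : 1 + s ^ 2 * u ^ 2 ≠ 0 := by positivity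
    have e2 : b ^ 2 + u ^ 2 ≠ 0 := by positivity
    have e3 : 1 + (s * u) ^ 2 = 1 + s ^ 2 * u ^ 2 := by ring
    have e4 : 1 + (u / b) ^ 2 = (b ^ 2 + u ^ 2) / b ^ 2 := by field_simp
    rw [id, e3, e4]
    field_simp
    ring
  have hlim : Tendsto G atTop (𝓝 (Real.pi / (1 + b * s))) := by
    have hat := Real.tendsto_arctan_atTop.mono_right nhdsWithin_le_nhds
    have l1 := (hat.comp (tendsto_id.const_mul_atTop hs)).div_const s
    have l2 := (hat.comp (tendsto_id.atTop_div_const hb)).const_mul b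
    have hval : Real.pi / (1 + b * s) = 2 * s / ((1 - s * b) * (1 + s * b)) *
        (Real.pi / 2 / s - b * (Real.pi / 2)) := by
      rw [mul_comm b s]
      field_simp
    rw [hval]
    exact (l1.sub l2).const_mul _
  have hnonneg (u : ℝ) (_ : u ∈ Ioi (0 : ℝ)) :
      0 ≤ 2 * s * u ^ 2 / ((1 + s ^ 2 * u ^ 2) * (b ^ 2 + u ^ 2)) := by positivity
  refine ⟨integrableOn_Ioi_deriv_of_nonneg' (fun u _ ↦ hderiv u) hnonneg hlim, ?_⟩
  rw [integral_Ioi_of_hasDerivAt_of_nonneg' (fun u _ ↦ hderiv u) hnonneg hlim]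
  simp [G]

lemma integral_log_one_add_sq_eq (u : ℝ) :
    ∫ s in (0 : ℝ)..1, 2 * s * u ^ 2 / (1 + s ^ 2 * u ^ 2) = Real.log (1 + u ^ 2) := by
  have hpos (s : ℝ) : 1 + s ^ 2 * u ^ 2 ≠ 0 := by positivity
  have hderiv (s : ℝ) : HasDerivAt (fun s ↦ Real.log (1 + s ^ 2 * u ^ 2))
      (2 * s * u ^ 2 / (1 + s ^ 2 * u ^ 2)) s := by
    refine ((((hasDerivAt_pow 2 s).mul_const (u ^ 2)).const_add 1).log (hpos s)).congr_deriv ?_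
    simp
  rw [intervalIntegral.integral_eq_sub_of_hasDerivAt (fun s _ ↦ hderiv s)]
  · simp
  · exact Continuous.intervalIntegrable
      (Continuous.div (by fun_prop) (by fun_prop) hpos) _ _

lemma integral_pi_div_one_add_mul (b : ℝ) (hb : 0 < b) :
    ∫ s in (0 : ℝ)..1, Real.pi / (1 + b * s) = Real.pi / b * Real.log (1 + b) := by
  have hpos (s : ℝ) (hs : s ∈ uIcc (0 : ℝ) 1) : 1 + b * s ≠ 0 := by
    rw [uIcc_of_le zero_le_one] at hs
    have := hs.1
    positivity
  rw [intervalIntegral.integral_eq_sub_of_hasDerivAt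
    (f := fun s ↦ Real.pi / b * Real.log (1 + b * s))]
  · simp
  · intro s hs
    have := hpos s hs
    refine (((((hasDerivAt_id s).const_mul b).const_add 1).log this).const_mul
      (Real.pi / b)).congr_deriv ?_
    simp only [id]
    field_simp
  · exact ContinuousOn.intervalIntegrable
      (ContinuousOn.div (by fun_prop) (by fun_prop) hpos)

/-- `∫₀^∞ log(1+u²)/(b²+u²) du = (π/b) log(1+b)` for `b > 0`. -/
lemma integral_Ioi_log_one_add_sq_div (b : ℝ) (hb : 0 < b) :
    ∫ u in Ioi (0 : ℝ), Real.log (1 + u ^ 2) / (b ^ 2 + u ^ 2)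
      = Real.pi / b * Real.log (1 + b) := by
  set K : ℝ → ℝ → ℝ := fun s u ↦ 2 * s * u ^ 2 / ((1 + s ^ 2 * u ^ 2) * (b ^ 2 + u ^ 2)) with hK
  have hgood : ∀ᵐ s ∂(volume.restrict (Ioc (0 : ℝ) 1)),
      IntegrableOn (K s) (Ioi 0) ∧ ∫ u in Ioi (0 : ℝ), K s u = Real.pi / (1 + b * s) := by
    have hne : ∀ᵐ s ∂(volume.restrict (Ioc (0 : ℝ) 1)), s ≠ b⁻¹ :=
      ae_restrict_of_ae (Measure.ae_ne volume b⁻¹)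
    filter_upwards [hne, ae_restrict_mem measurableSet_Ioc] with s hs hs0
    exact integrableOn_and_integral_Ioi_rational s b hs0.1 hb
      fun h ↦ hs (eq_inv_of_mul_eq_one_left h)
  have hint : Integrable (fun s : ℝ ↦ Real.pi / (1 + b * s)) (volume.restrict (Ioc 0 1)) := by
    refine (ContinuousOn.integrableOn_Icc (ContinuousOn.div (by fun_prop) (by fun_prop)
      fun s hs ↦ ?_)).mono_set Ioc_subset_Icc_self
    have := hs.1
    positivity
  have hprod : Integrable (Function.uncurry K)
      ((volume.restrict (Ioc (0 : ℝ) 1)).prod (volume.restrict (Ioi (0 : ℝ)))) := by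
    have hmeas : Measurable (Function.uncurry K) := by
      simp only [hK, Function.uncurry_def]
      fun_prop
    refine (integrable_prod_iff hmeas.aestronglyMeasurable).2
      ⟨hgood.mono fun s hs ↦ hs.1, hint.congr ?_⟩
    filter_upwards [hgood, ae_restrict_mem measurableSet_Ioc] with s hs hs0
    rw [← hs.2]
    refine integral_congr_ae (Eventually.of_forall fun u ↦ ?_)
    have := hs0.1
    simp only [Function.uncurry_apply_pair, hK]
    rw [Real.norm_of_nonneg (by positivity)]
  have hswap := integral_integral_swap hprod
  rw [integral_congr_ae (hgood.mono fun s hs ↦ hs.2),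
    ← intervalIntegral.integral_of_le zero_le_one, integral_pi_div_one_add_mul b hb] at hswap
  rw [hswap]
  refine integral_congr_ae (Eventually.of_forall fun u ↦ ?_)
  simp only [← integral_log_one_add_sq_eq u, hK]
  rw [← intervalIntegral.integral_of_le zero_le_one, ← intervalIntegral.integral_div]
  simp only [div_div]

lemma image_inv_sqrt_one_add_sq :
    (fun u : ℝ ↦ (√(1 + u ^ 2))⁻¹) '' Ioi 0 = Ioo 0 1 := by
  ext x
  constructor
  · rintro ⟨u, hu, rfl⟩
    have hu0 : 0 < u := hu
    refine ⟨by positivity, inv_lt_one_of_one_lt₀ ?_⟩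
    rw [Real.lt_sqrt zero_le_one]
    nlinarith
  · rintro ⟨h0, h1⟩
    have hx : 1 < (x ^ 2)⁻¹ := (one_lt_inv₀ (by positivity)).2 (by nlinarith)
    refine ⟨√((x ^ 2)⁻¹ - 1), Real.sqrt_pos.2 (by linarith), ?_⟩
    simp only
    rw [Real.sq_sqrt (by linarith), add_sub_cancel, Real.sqrt_inv, Real.sqrt_sq h0.le, inv_inv]

/-- The substitution `x = 1/√(1+u²)`. -/
lemma integral_log_div_eq_integral_Ioi (p : ℝ) (hp : 0 < p) :
    ∫ x in (0 : ℝ)..1, Real.log x / ((x ^ 2 + p ^ 2) * √(1 - x ^ 2))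
      = ∫ u in Ioi (0 : ℝ), -(1 / (2 * p ^ 2)) *
          (Real.log (1 + u ^ 2) / ((√(1 + p ^ 2) / p) ^ 2 + u ^ 2)) := by
  have hderiv (u : ℝ) : HasDerivAt (fun u : ℝ ↦ (√(1 + u ^ 2))⁻¹)
      (-(u / √(1 + u ^ 2) ^ 3)) u := by
    have h : 0 < 1 + u ^ 2 := by positivity
    have hr : √(1 + u ^ 2) ≠ 0 := (Real.sqrt_pos.2 h).ne'
    refine ((((hasDerivAt_pow 2 u).const_add 1).sqrt h.ne').fun_inv hr).congr_deriv ?_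
    field_simp
    simp
  have hinj : InjOn (fun u : ℝ ↦ (√(1 + u ^ 2))⁻¹) (Ioi 0) := by
    intro u hu v hv h
    have h' : √(1 + u ^ 2) = √(1 + v ^ 2) := inv_injective h
    rw [Real.sqrt_inj (by positivity) (by positivity)] at h'
    exact (sq_eq_sq₀ (le_of_lt hu) (le_of_lt hv)).1 (by linarith)
  rw [intervalIntegral.integral_of_le zero_le_one, integral_Ioc_eq_integral_Ioo,
    ← image_inv_sqrt_one_add_sq,
    integral_image_eq_integral_abs_deriv_smul measurableSet_Ioi
      (fun u _ ↦ (hderiv u).hasDerivWithinAt) hinj]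
  refine setIntegral_congr_fun measurableSet_Ioi fun u hu ↦ ?_
  have hu0 : 0 < u := hu
  have h : 0 < 1 + u ^ 2 := by positivity
  set r := √(1 + u ^ 2) with hr
  have hr0 : 0 < r := Real.sqrt_pos.2 h
  have hr2 : r ^ 2 = 1 + u ^ 2 := Real.sq_sqrt h.le
  have hq2 : √(1 + p ^ 2) ^ 2 = 1 + p ^ 2 := Real.sq_sqrt (by positivity)
  have hs : √(1 - r⁻¹ ^ 2) = u / r := by
    rw [Real.sqrt_eq_iff_mul_self_eq_of_pos (by positivity)]
    field_simp
    linarith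
  have hlog : Real.log r⁻¹ = -(Real.log (1 + u ^ 2) / 2) := by
    rw [Real.log_inv, hr, Real.log_sqrt h.le]
  simp only [smul_eq_mul]
  rw [abs_neg, abs_of_nonneg (by positivity), hs, hlog, div_pow, hq2]
  have e1 : r⁻¹ ^ 2 + p ^ 2 = (1 + p ^ 2 * (1 + u ^ 2)) / r ^ 2 := by
    rw [← hr2]
    field_simp
  have e2 : (1 + p ^ 2) / p ^ 2 + u ^ 2 = (1 + p ^ 2 * (1 + u ^ 2)) / p ^ 2 := by
    field_simp
    ring
  rw [e1, e2]
  field_simp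

/-- For `p > 0`,
`∫₀¹ log x / ((x²+p²)√(1-x²)) dx
  = -(π/2) ∫₁^∞ dx/((x²+p²)√(x²-1)) + π log p / (2p√(1+p²))`. -/
theorem log_integral_identity (p : ℝ) (hp : 0 < p) :
    (∫ x in (0 : ℝ)..1, Real.log x / ((x ^ 2 + p ^ 2) * Real.sqrt (1 - x ^ 2)))
      = -(Real.pi / 2) *
          (∫ x in Set.Ioi (1 : ℝ), 1 / ((x ^ 2 + p ^ 2) * Real.sqrt (x ^ 2 - 1)))
        + Real.pi * Real.log p / (2 * p * Real.sqrt (1 + p ^ 2)) := by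
  have hq0 : 0 < √(1 + p ^ 2) := Real.sqrt_pos.2 (by positivity)
  have hlog : Real.log (1 + √(1 + p ^ 2) / p) = Real.log (p + √(1 + p ^ 2)) - Real.log p := by
    rw [← Real.log_div (by positivity) hp.ne', add_div, div_self hp.ne']
  rw [integral_log_div_eq_integral_Ioi p hp, integral_const_mul,
    integral_Ioi_log_one_add_sq_div _ (by positivity),
    integral_Ioi_one_div_sq_add_sq_mul_sqrt p hp, hlog]
  field_simp
  ring
end
end
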